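/- Let (W,S) be a finite Coxeter group of rank at most 4 and let R be a set of representatives of the conjugacy classes of W. Then for each w in R there exists a linear character φ_w of the centralizer C_W(w) such that the regular character of W equals the sum over w in R of the induced class functions Ind_{C_W(w)}^W φ_w. -/

import Mathlib

open scoped Classical

/-- The induced class function `Ind_H^G φ` of a function `φ` on a subgroup `H` of a finite
group `G`:  `(Ind_H^G φ)(g) = (1/|H|) Σ_{x ∈ G, x⁻¹gx ∈ H} φ(x⁻¹gx)`. -/
noncomputable def indFun {G : Type*} [Group G] [Fintype G] (H : Subgroup G)
    (φ : H → ℂ) (g : G) : ℂ :=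
  (Nat.card H : ℂ)⁻¹ * ∑ x : G, if h : x⁻¹ * g * x ∈ H then φ ⟨x⁻¹ * g * x, h⟩ else 0

/-- The regular character of a finite group. -/
noncomputable def regularChar (G : Type*) [Group G] [Fintype G] (g : G) : ℂ :=
  if g = 1 then (Fintype.card G : ℂ) else 0

section Reformulation

theorem commute_conj_iff {G : Type*} [Group G] (x g h : G) :
    Commute g (x * h * x⁻¹) ↔ Commute (x⁻¹ * g * x) h := by
  constructor <;> intro H
  · have := (Commute.conj_iff (x⁻¹)).2 H
    simpa [mul_assoc] using this
  · have := (Commute.conj_iff x).2 H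
    simpa [mul_assoc] using this

variable {G : Type*} [Group G] [Fintype G]

/-- Equivalent form of the decomposition, in terms of one function on commuting pairs which does not
refer to a choice of representatives. -/
def HasRegularDecomposition (G : Type*) [Group G] [Fintype G] : Prop :=
  ∃ Ψ : G → G → ℂ,
    (∀ x g h, Commute g h → Ψ (x * g * x⁻¹) (x * h * x⁻¹) = Ψ g h) ∧
    (∀ h, Ψ 1 h = 1) ∧
    (∀ g g' h, Commute g h → Commute g' h → Ψ (g * g') h = Ψ g h * Ψ g' h) ∧
    ∀ g, g ≠ 1 → ∑ h, (if Commute g h then Ψ g h else 0) = 0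

theorem card_conj_fiber (g x₀ : G) :
    (Finset.univ.filter fun x : G => x * g * x⁻¹ = x₀ * g * x₀⁻¹).card =
      Nat.card (Subgroup.centralizer {g}) := by
  rw [Nat.card_eq_fintype_card, ← Finset.card_univ]
  refine Finset.card_bij' (fun x hx => ⟨x₀⁻¹ * x, ?_⟩) (fun y _ => x₀ * y) ?_ ?_ ?_ ?_
  · rw [Subgroup.mem_centralizer_singleton_iff]
    have h := (Finset.mem_filter.1 hx).2
    rw [mul_inv_eq_iff_eq_mul] at h
    rw [mul_assoc, h]
    group
  · simp
  · rintro ⟨y, hy⟩ -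
    rw [Subgroup.mem_centralizer_singleton_iff] at hy
    simp only [Finset.mem_filter, Finset.mem_univ, true_and, mul_inv_rev]
    rw [mul_assoc x₀ y g, hy]
    group
  · simp
  · simp

theorem sum_conj (g : G) (F : G → ℂ) :
    ∑ x, F (x * g * x⁻¹) =
      Nat.card (Subgroup.centralizer {g}) * ∑ y, if IsConj g y then F y else 0 := by
  rw [← Finset.sum_fiberwise (s := Finset.univ) (g := fun x : G => x * g * x⁻¹), Finset.mul_sum]
  refine Finset.sum_congr rfl fun y _ => ?_
  rw [Finset.sum_congr rfl (g := fun _ => F y) fun x hx => by rw [(Finset.mem_filter.1 hx).2],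
    Finset.sum_const, nsmul_eq_mul]
  split_ifs with h
  · obtain ⟨x₀, rfl⟩ := isConj_iff.1 h
    rw [card_conj_fiber]
  · rw [Finset.filter_eq_empty_iff.2 fun x _ hx => h (isConj_iff.2 ⟨x, hx⟩)]
    simp

theorem HasRegularDecomposition.exists_centralizer_characters (hG : HasRegularDecomposition G)
    (R : Finset G) (hR : ∀ w : G, ∃! r, r ∈ R ∧ IsConj r w) :
    ∃ φ : (w : G) → (Subgroup.centralizer {w} →* ℂˣ),
      ∀ g : G, regularChar G g =
        ∑ w ∈ R, indFun (Subgroup.centralizer {w}) (fun y => (φ w y : ℂ)) g := by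
  obtain ⟨Ψ, hc, h1, hm, h0⟩ := hG
  have hcomm {w : G} (y : Subgroup.centralizer {w}) : Commute (y : G) w :=
    Subgroup.mem_centralizer_singleton_iff.1 y.2
  let φ (w : G) : Subgroup.centralizer {w} →* ℂˣ := MonoidHom.toHomUnits
    { toFun := fun y => Ψ y w
      map_one' := h1 w
      map_mul' := fun y z => hm y z w (hcomm y) (hcomm z) }
  refine ⟨φ, fun g => ?_⟩
  have key (w : G) : indFun (Subgroup.centralizer {w}) (fun y => (φ w y : ℂ)) g =
      ∑ h, if IsConj w h then (if Commute g h then Ψ g h else 0) else 0 := by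
    have hne : (Nat.card (Subgroup.centralizer {w}) : ℂ) ≠ 0 :=
      Nat.cast_ne_zero.2 Nat.card_pos.ne'
    rw [indFun, inv_mul_eq_iff_eq_mul₀ hne, ← sum_conj w fun h => if Commute g h then Ψ g h else 0]
    refine Finset.sum_congr rfl fun x _ => ?_
    simp only [Subgroup.mem_centralizer_singleton_iff]
    by_cases h : Commute g (x * w * x⁻¹)
    · have h' := (commute_conj_iff x g w).1 h
      rw [if_pos h, dif_pos h'.eq]
      change Ψ (x⁻¹ * g * x) w = _
      rw [← hc x _ _ h']
      congr 1
      group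
    · rw [if_neg h, dif_neg]
      exact fun h' => h ((commute_conj_iff x g w).2 h')
  simp only [key]
  rw [Finset.sum_comm]
  have hsum (h : G) : ∑ w ∈ R, (if IsConj w h then (if Commute g h then Ψ g h else 0) else 0) =
      if Commute g h then Ψ g h else 0 := by
    obtain ⟨r, ⟨hr, hrh⟩, hu⟩ := hR h
    rw [Finset.sum_eq_single_of_mem r hr, if_pos hrh]
    exact fun b hb hbr => if_neg fun hbh => hbr (hu b ⟨hb, hbh⟩)
  simp only [hsum, regularChar]
  split_ifs with hg
  · subst hg
    simp [h1]
  · exact (h0 g hg).symm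

theorem HasRegularDecomposition.of_mulEquiv {H : Type*} [Group H] [Fintype H] (e : G ≃* H)
    (hG : HasRegularDecomposition G) : HasRegularDecomposition H := by
  obtain ⟨Ψ, hc, h1, hm, h0⟩ := hG
  have hcomm {g h : H} (H : Commute g h) : Commute (e.symm g) (e.symm h) := H.map e.symm
  refine ⟨fun g h => Ψ (e.symm g) (e.symm h), fun x g h H => ?_, fun h => ?_,
    fun g g' h H H' => ?_, fun g hg => ?_⟩
  · simpa using hc (e.symm x) _ _ (hcomm H)
  · simpa using h1 _
  · simpa using hm _ _ _ (hcomm H) (hcomm H')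
  · refine Eq.trans ?_ (h0 (e.symm g) (by simpa using hg))
    refine Fintype.sum_equiv e.symm.toEquiv _ _ fun h => ?_
    have : Commute g h ↔ Commute (e.symm g) (e.symm h) :=
      ⟨hcomm, fun H => by simpa using H.map e⟩
    simp [this]

theorem HasRegularDecomposition.prod {H : Type*} [Group H] [Fintype H]
    (hG : HasRegularDecomposition G) (hH : HasRegularDecomposition H) :
    HasRegularDecomposition (G × H) := by
  obtain ⟨Ψ, hc, h1, hm, h0⟩ := hG
  obtain ⟨Ψ', hc', h1', hm', h0'⟩ := hH
  refine ⟨fun g h => Ψ g.1 h.1 * Ψ' g.2 h.2, fun x g h hgh => ?_, fun h => ?_,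
    fun g g' h hgh hgh' => ?_, fun g hg => ?_⟩
  · rw [Prod.commute_iff] at hgh
    simp [hc _ _ _ hgh.1, hc' _ _ _ hgh.2]
  · simp [h1, h1']
  · rw [Prod.commute_iff] at hgh hgh'
    simp only [Prod.fst_mul, Prod.snd_mul, hm _ _ _ hgh.1 hgh'.1, hm' _ _ _ hgh.2 hgh'.2]
    ring
  · have : ∑ h : G × H, (if Commute g h then Ψ g.1 h.1 * Ψ' g.2 h.2 else 0) =
        (∑ h, if Commute g.1 h then Ψ g.1 h else 0) *
          ∑ h, if Commute g.2 h then Ψ' g.2 h else 0 := by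
      rw [Fintype.sum_mul_sum, Fintype.sum_prod_type]
      refine Finset.sum_congr rfl fun a _ => Finset.sum_congr rfl fun b _ => ?_
      by_cases ha : Commute g.1 a <;> by_cases hb : Commute g.2 b <;>
        simp [Prod.commute_iff, ha, hb]
    rw [this]
    by_cases hg1 : g.1 = 1
    · rw [h0' g.2 fun hg2 => hg (Prod.ext hg1 hg2), mul_zero]
    · rw [h0 g.1 hg1, zero_mul]

end Reformulation

section Representatives

variable {G : Type*} [Group G] [Fintype G]

theorem HasRegularDecomposition.of_representatives {ι : Type*} [Fintype ι] (r : ι → G)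
    (χ : ι → G → ℂ) (hcover : ∀ h, ∃ i, IsConj (r i) h)
    (huniq : ∀ i j, IsConj (r i) (r j) → i = j) (h1 : ∀ i, χ i 1 = 1)
    (hm : ∀ i g g', Commute g (r i) → Commute g' (r i) → χ i (g * g') = χ i g * χ i g')
    (hsum : ∀ j, r j ≠ 1 → ∑ i, (Nat.card (Subgroup.centralizer {r i}) : ℂ)⁻¹ *
      ∑ y, (if IsConj (r j) y then (if Commute y (r i) then χ i y else 0) else 0) = 0) :
    HasRegularDecomposition G := by
  have hcover' : ∀ h, ∃ i, ∃ x, x * r i * x⁻¹ = h := fun h =>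
    (hcover h).imp fun i hi => isConj_iff.1 hi
  choose c t ht using hcover'
  have hinv (i : ι) (g : G) (hg : Commute g (r i)) : χ i g * χ i g⁻¹ = 1 := by
    rw [← hm i _ _ hg hg.inv_left, mul_inv_cancel, h1]
  have hconj (i : ι) (y g : G) (hy : Commute y (r i)) (hg : Commute g (r i)) :
      χ i (y * g * y⁻¹) = χ i g := by
    rw [hm i _ _ (hy.mul_left hg) hy.inv_left, hm i _ _ hy hg, mul_right_comm, hinv i y hy, one_mul]
  let Ψ (g h : G) : ℂ := χ (c h) ((t h)⁻¹ * g * t h)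
  have hΨ (i : ι) (x g : G) (hg : Commute g (x * r i * x⁻¹)) :
      Ψ g (x * r i * x⁻¹) = χ i (x⁻¹ * g * x) := by
    set h := x * r i * x⁻¹ with hh
    have hi : c h = i := by
      refine huniq _ _ (isConj_iff.2 ⟨x⁻¹ * t h, ?_⟩)
      have := ht h
      simp only [mul_inv_rev, inv_inv]
      calc x⁻¹ * t h * r (c h) * ((t h)⁻¹ * x) = x⁻¹ * (t h * r (c h) * (t h)⁻¹) * x := by group
        _ = r i := by rw [this, hh]; group
    have hth := ht h
    rw [hi] at hth
    have h2 : Commute (x⁻¹ * t h) (r i) := by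
      have : r i = (x⁻¹ * t h) * r i * (x⁻¹ * t h)⁻¹ := by
        calc r i = x⁻¹ * h * x := by rw [hh]; group
          _ = x⁻¹ * (t h * r i * (t h)⁻¹) * x := by rw [hth]
          _ = _ := by group
      exact (mul_inv_eq_iff_eq_mul.1 this.symm)
    change χ (c h) _ = _
    rw [hi, ← hconj i (x⁻¹ * t h) ((t h)⁻¹ * g * t h) h2]
    · congr 1
      group
    · rw [← commute_conj_iff, hth]
      exact hg
  have hΨ' (g h : G) (x : G) (i : ι) (hx : x * r i * x⁻¹ = h) (hg : Commute g h) :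
      Ψ g h = χ i (x⁻¹ * g * x) := by
    subst hx
    exact hΨ i x g hg
  refine ⟨Ψ, fun x g h hgh => ?_, fun h => ?_, fun g g' h hg hg' => ?_, fun g hg => ?_⟩
  · have hx : x * t h * r (c h) * (x * t h)⁻¹ = x * h * x⁻¹ := by
      conv_rhs => rw [← ht h]
      group
    rw [hΨ' _ _ _ _ hx ((Commute.conj_iff x).2 hgh)]
    simp only [Ψ]
    congr 1
    group
  · simp [Ψ, h1]
  · have H (g : G) (hg : Commute g h) : Commute ((t h)⁻¹ * g * t h) (r (c h)) := by
      rw [← commute_conj_iff, ht h]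
      exact hg
    simp only [Ψ]
    rw [← hm _ _ _ (H g hg) (H g' hg')]
    congr 1
    group
  · obtain ⟨j, hj⟩ := hcover g
    have hj1 : r j ≠ 1 := by
      intro h
      rw [h] at hj
      exact hg (isConj_one_right.1 hj)
    have hconjg (y : G) : IsConj (r j) y ↔ IsConj g y :=
      ⟨fun h => hj.symm.trans h, fun h => hj.trans h⟩
    have step (i : ι) : ∑ h, (if IsConj (r i) h then (if Commute g h then Ψ g h else 0) else 0) =
        Nat.card (Subgroup.centralizer {g}) * ((Nat.card (Subgroup.centralizer {r i}) : ℂ)⁻¹ *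
          ∑ y, (if IsConj (r j) y then (if Commute y (r i) then χ i y else 0) else 0)) := by
      have hne : (Nat.card (Subgroup.centralizer {r i}) : ℂ) ≠ 0 :=
        Nat.cast_ne_zero.2 Nat.card_pos.ne'
      simp only [hconjg]
      rw [mul_left_comm, ← sum_conj, eq_inv_mul_iff_mul_eq₀ hne, ← sum_conj]
      refine Fintype.sum_equiv (Equiv.inv G) _ _ fun x => ?_
      simp only [Equiv.inv_apply, inv_inv]
      by_cases h : Commute g (x * r i * x⁻¹)
      · rw [if_pos h, if_pos ((commute_conj_iff _ _ _).1 h), hΨ i x g h]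
      · rw [if_neg h, if_neg (mt (commute_conj_iff _ _ _).2 h)]
    have hsplit (h : G) : (if Commute g h then Ψ g h else 0) =
        ∑ i, if IsConj (r i) h then (if Commute g h then Ψ g h else 0) else 0 := by
      obtain ⟨i, hi⟩ := hcover h
      rw [Finset.sum_eq_single_of_mem i (Finset.mem_univ i), if_pos hi]
      exact fun k _ hk => if_neg fun hkh => hk (huniq _ _ (hkh.trans hi.symm))
    rw [Finset.sum_congr rfl fun h _ => hsplit h, Finset.sum_comm]
    simp_rw [step]
    rw [← Finset.mul_sum, hsum j hj1, mul_zero]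

end Representatives

section Counting

variable {G : Type*} [Group G] [Fintype G] {ι : Type*} [Fintype ι] {r : ι → G} {n : ι → ℕ}
  {A : ι → Finset G}

theorem card_class_mul_card_centralizer (g : G) :
    (Finset.univ.filter fun y => IsConj g y).card * Nat.card (Subgroup.centralizer {g}) =
      Fintype.card G := by
  have h := sum_conj g fun _ => 1
  simp only [Finset.sum_const, Finset.card_univ, nsmul_eq_mul, mul_one, Finset.sum_boole] at h
  rw [mul_comm]
  exact_mod_cast h.symm

theorem card_centralizer_eq_card_filter (g : G) :
    Nat.card (Subgroup.centralizer {g}) = (Finset.univ.filter fun y => Commute y g).card := by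
  rw [Nat.card_eq_fintype_card, Fintype.card_subtype]
  simp only [Subgroup.mem_centralizer_singleton_iff, commute_iff_eq]

theorem class_card_eq_of_sum_eq (hA : ∀ i, ∀ y ∈ A i, Commute y (r i))
    (hn : ∀ i, Fintype.card G ≤ n i * (A i).card) (hsum : ∑ i, n i = Fintype.card G)
    (hcover : ∀ h, ∃ i, IsConj (r i) h) :
    (∀ i, (Finset.univ.filter fun y => IsConj (r i) y).card = n i) ∧
      (∀ i j, IsConj (r i) (r j) → i = j) ∧
      ∀ i y, y ∈ A i ↔ Commute y (r i) := by
  have hsub (i : ι) : A i ⊆ Finset.univ.filter fun y => Commute y (r i) := fun y hy => by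
    simpa using hA i y hy
  have hpos : 0 < Fintype.card G := Fintype.card_pos
  have hle (i : ι) : (Finset.univ.filter fun y => IsConj (r i) y).card ≤ n i := by
    have h1 := card_class_mul_card_centralizer (r i)
    rw [card_centralizer_eq_card_filter] at h1
    have h2 := Finset.card_le_card (hsub i)
    have h3 : 0 < (A i).card := Nat.pos_of_ne_zero fun h => by
      have := hn i
      rw [h, mul_zero] at this
      omega
    exact Nat.le_of_mul_le_mul_right ((Nat.mul_le_mul_left _ h2).trans (h1.le.trans (hn i))) h3
  have hunion (s : Finset ι) (hs : ∀ h, ∃ i ∈ s, IsConj (r i) h) :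
      Fintype.card G ≤ ∑ i ∈ s, (Finset.univ.filter fun y => IsConj (r i) y).card := by
    rw [← Finset.card_univ]
    refine (Finset.card_le_card fun y _ => ?_).trans Finset.card_biUnion_le
    simpa using hs y
  have hcard : ∀ i, (Finset.univ.filter fun y => IsConj (r i) y).card = n i := by
    have := (Finset.sum_eq_sum_iff_of_le fun i (_ : i ∈ Finset.univ) => hle i).1
      (le_antisymm (Finset.sum_le_sum fun i _ => hle i)
        (hsum.le.trans (hunion Finset.univ fun h => by simpa using hcover h)))
    exact fun i => this i (Finset.mem_univ i)
  refine ⟨hcard, fun i j hij => ?_, fun i y => ⟨hA i y, fun hy => ?_⟩⟩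
  · by_contra hne
    have h1 := hunion (Finset.univ.erase j) fun h => by
      obtain ⟨k, hk⟩ := hcover h
      by_cases hkj : k = j
      · exact ⟨i, by simp [hne], hij.trans (hkj ▸ hk)⟩
      · exact ⟨k, by simp [hkj], hk⟩
    have h2 := Finset.sum_erase_add _ (fun i => (Finset.univ.filter fun y => IsConj (r i) y).card)
      (Finset.mem_univ j)
    have h3 : 0 < (Finset.univ.filter fun y => IsConj (r j) y).card :=
      Finset.card_pos.2 ⟨r j, Finset.mem_filter.2 ⟨Finset.mem_univ _, IsConj.refl _⟩⟩
    have h4 : ∑ i, (Finset.univ.filter fun y => IsConj (r i) y).card = Fintype.card G := by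
      rw [← hsum]
      exact Finset.sum_congr rfl fun i _ => hcard i
    omega
  · have h1 := card_class_mul_card_centralizer (r i)
    rw [card_centralizer_eq_card_filter, hcard i] at h1
    have h2 : 0 < n i := by
      rw [← hcard i]
      exact Finset.card_pos.2 ⟨r i, Finset.mem_filter.2 ⟨Finset.mem_univ _, IsConj.refl _⟩⟩
    have h3 := Finset.eq_of_subset_of_card_le (hsub i)
      (Nat.le_of_mul_le_mul_left (h1.le.trans (hn i)) h2)
    rw [h3]
    simpa using hy

theorem HasRegularDecomposition.of_subsets (χ : ι → G → ℂ)
    (hA : ∀ i, ∀ y ∈ A i, Commute y (r i))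
    (hn : ∀ i, Fintype.card G ≤ n i * (A i).card) (hsum : ∑ i, n i = Fintype.card G)
    (hcover : ∀ h, ∃ i, IsConj (r i) h) (h1 : ∀ i, χ i 1 = 1)
    (hm : ∀ i, ∀ g ∈ A i, ∀ g' ∈ A i, χ i (g * g') = χ i g * χ i g')
    (hvanish : ∀ j, r j ≠ 1 →
      ∑ i, (n i : ℂ) * ∑ y ∈ A i, (if IsConj (r j) y then χ i y else 0) = 0) :
    HasRegularDecomposition G := by
  obtain ⟨hcard, huniq, hmem⟩ := class_card_eq_of_sum_eq hA hn hsum hcover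
  refine .of_representatives r χ hcover huniq h1
    (fun i g g' hg hg' => hm i g ((hmem i g).2 hg) g' ((hmem i g').2 hg')) fun j hj => ?_
  have hG : (Fintype.card G : ℂ) ≠ 0 := Nat.cast_ne_zero.2 Fintype.card_ne_zero
  have hterm (i : ι) : (Nat.card (Subgroup.centralizer {r i}) : ℂ)⁻¹ *
      ∑ y, (if IsConj (r j) y then (if Commute y (r i) then χ i y else 0) else 0) =
      (Fintype.card G : ℂ)⁻¹ *
        ((n i : ℂ) * ∑ y ∈ A i, (if IsConj (r j) y then χ i y else 0)) := by
    have h := card_class_mul_card_centralizer (r i)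
    rw [hcard i] at h
    have h0 : (Nat.card (Subgroup.centralizer {r i}) : ℂ) ≠ 0 :=
      Nat.cast_ne_zero.2 Nat.card_pos.ne'
    have hn0 : (n i : ℂ) ≠ 0 := fun h0 => hG (by rw [← h, Nat.cast_mul, h0, zero_mul])
    have hAi : A i = Finset.univ.filter fun y => Commute y (r i) := by
      ext y
      simp [hmem]
    rw [hAi, Finset.sum_filter, ← h, Nat.cast_mul, mul_inv, ← mul_assoc]
    congr 1
    · field_simp
    · refine Finset.sum_congr rfl fun y _ => ?_
      split_ifs <;> rfl
  simp_rw [hterm]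
  rw [← Finset.mul_sum, hvanish j hj, mul_zero]

end Counting

section Evaluation

/-- Passes `n` to `k`; the case distinction makes the kernel evaluate `n` first. -/
def withNat {α : Type} (n : ℕ) (k : ℕ → α) : α :=
  Nat.rec (k 0) (fun m _ => k (Nat.succ m)) n

theorem withNat_eq {α : Type} (n : ℕ) (k : ℕ → α) : withNat n k = k n := by
  cases n <;> rfl

end Evaluation

section PackedMatrices

/-- Packs a list of natural numbers into lanes of 24 bits. -/
def packLanes : List ℕ → ℕ
  | [] => 0
  | a :: l => a + 2 ^ 24 * packLanes l

theorem packLanes_land (l l' : List ℕ) (hl : ∀ a ∈ l, a < 2 ^ 24) (hl' : ∀ a ∈ l', a < 2 ^ 24) :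
    packLanes l &&& packLanes l' = packLanes (l.zipWith (· &&& ·) l') := by
  induction l generalizing l' with
  | nil => simp [packLanes]
  | cons a l ih =>
    cases l' with
    | nil => simp [packLanes]
    | cons b l' =>
      have ha := hl a (by simp)
      have hb := hl' b (by simp)
      have := ih l' (fun x hx => hl x (by simp [hx])) (fun x hx => hl' x (by simp [hx]))
      rw [List.zipWith_cons_cons, packLanes, packLanes, packLanes, ← this,
        add_comm a, add_comm b, add_comm (a &&& b)]
      refine Nat.eq_of_testBit_eq fun i => ?_
      rw [Nat.testBit_land, Nat.testBit_two_pow_mul_add _ ha, Nat.testBit_two_pow_mul_add _ hb,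
        Nat.testBit_two_pow_mul_add _ (Nat.and_lt_two_pow _ hb)]
      split_ifs <;> rw [Nat.testBit_land]

theorem packLanes_shiftRight (l : List ℕ) (hl : ∀ a ∈ l, a < 2 ^ 24) (k : ℕ) :
    packLanes l >>> (24 * k) = packLanes (l.drop k) := by
  induction k generalizing l with
  | zero => rfl
  | succ k ih =>
    cases l with
    | nil => simp [packLanes]
    | cons a l =>
      rw [List.drop_succ_cons, ← ih l fun x hx => hl x (by simp [hx]), mul_add, mul_one, add_comm,
        Nat.shiftRight_add, packLanes]
      congr 1
      have := hl a (by simp)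
      rw [Nat.shiftRight_eq_div_pow]
      omega

theorem packLanes_add_zipWith (l l' : List ℕ) (h : l.length = l'.length) :
    packLanes l + packLanes l' = packLanes (l.zipWith (· + ·) l') := by
  induction l generalizing l' with
  | nil => cases l' <;> simp_all [packLanes]
  | cons a l ih =>
    cases l' with
    | nil => simp at h
    | cons b l' =>
      rw [List.zipWith_cons_cons, packLanes, packLanes, packLanes, ← ih l' (by simpa using h)]
      ring

theorem packLanes_map_mul (c : ℕ) (l : List ℕ) :
    packLanes (l.map (c * ·)) = c * packLanes l := by
  induction l with
  | nil => rfl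
  | cons a l ih =>
    rw [List.map_cons, packLanes, packLanes, ih]
    ring

/-- The residues modulo 31 of all lanes of a packed list. -/
def laneMod (y : ℕ) : ℕ :=
  Nat.sub y (Nat.mul 31 (Nat.shiftRight (Nat.land (Nat.mul y 4229)
    39094180353179880079775068131913730382530430192294893536202967927711750489713439533076849747300431518861706527637504)
    17))

theorem packLanes_quotient (l : List ℕ) (hl : ∀ a ∈ l, a < 3601) :
    Nat.land (Nat.mul (packLanes l) 4229) (packLanes (l.map fun _ => 16646144)) =
      2 ^ 17 * packLanes (l.map (· / 31)) := by
  have h1 : Nat.mul (packLanes l) 4229 = packLanes (l.map (4229 * ·)) := by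
    rw [packLanes_map_mul]
    exact Nat.mul_comm _ _
  rw [h1, ← packLanes_map_mul]
  refine (packLanes_land _ _ ?_ ?_).trans ?_
  · intro a ha
    obtain ⟨b, hb, rfl⟩ := List.mem_map.1 ha
    have := hl b hb
    omega
  · simp
  · rw [List.zipWith_map, List.zipWith_self, List.map_map]
    congr 1
    refine List.map_congr_left fun a ha => ?_
    have := hl a ha
    have h2 : 4229 * a &&& 16646144 = (4229 * a / 2 ^ 17 % 2 ^ 7) * 2 ^ 17 := by
      have h3 : (16646144 : ℕ) = (2 ^ 7 - 1) * 2 ^ 17 := by norm_num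
      refine Nat.eq_of_testBit_eq fun i => ?_
      rw [Nat.testBit_land, h3, Nat.testBit_mul_two_pow, Nat.testBit_mul_two_pow,
        Nat.testBit_mod_two_pow, Nat.testBit_two_pow_sub_one, Nat.testBit_div_two_pow]
      by_cases hi : 17 ≤ i
      · simp only [hi, decide_true, Bool.true_and, Nat.sub_add_cancel, Bool.and_comm]
      · simp only [hi, decide_false, Bool.false_and, Bool.and_false]
    have h4 : 4229 * a / 131072 = a / 31 := by omega
    have h5 : a / 31 % 128 = a / 31 := by omega
    simp only [Function.comp]
    rw [h2, mul_comm (2 ^ 17)]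
    norm_num only
    rw [h4, h5]

theorem laneMod_packLanes (l : List ℕ) (hlen : l.length = 16) (hl : ∀ a ∈ l, a < 3601) :
    laneMod (packLanes l) = packLanes (l.map (· % 31)) := by
  have h := packLanes_quotient l hl
  have h1 : packLanes (l.map fun _ => 16646144) =
      39094180353179880079775068131913730382530430192294893536202967927711750489713439533076849747300431518861706527637504 := by
    rw [List.map_const', hlen]
    rfl
  rw [h1] at h
  rw [laneMod, h]
  have h2 : Nat.shiftRight (2 ^ 17 * packLanes (l.map (· / 31))) 17 = packLanes (l.map (· / 31)) :=
    (Nat.shiftRight_eq_div_pow _ _).trans (Nat.mul_div_cancel_left _ (by norm_num))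
  rw [h2]
  have h3 : packLanes l =
      Nat.mul 31 (packLanes (l.map (· / 31))) + packLanes (l.map (· % 31)) := by
    refine Eq.trans ?_ (congrArg (· + _) (packLanes_map_mul 31 _))
    rw [packLanes_add_zipWith _ _ (by simp), List.map_map, List.zipWith_map, List.zipWith_self]
    conv_lhs => rw [← List.map_id l]
    congr 1
    refine List.map_congr_left fun a _ => ?_
    simp only [id, Function.comp]
    omega
  exact (congrArg (· - _) h3).trans (Nat.add_sub_cancel_left ..)

/-- The outer product of the `k`-th column of `x` and the `k`-th row of `y`. -/
def packedOuter (x y k k' : ℕ) : ℕ :=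
  Nat.mul (Nat.land (Nat.shiftRight x k)
    8343698861742818599568911384447877086237429891310761349107124077119354343327963272250849755135)
    (Nat.land (Nat.shiftRight y k') 79228162514264337593543950335)

/-- The product of packed `4 × 4` matrices modulo 31, without the reduction. -/
def packedPreMul (x y : ℕ) : ℕ :=
  Nat.add (Nat.add (packedOuter x y 0 0) (packedOuter x y 24 96))
    (Nat.add (packedOuter x y 48 192) (packedOuter x y 72 288))

/-- The product of packed `4 × 4` matrices modulo 31. -/
def packedMul (x y : ℕ) : ℕ :=
  withNat (packedPreMul x y) laneMod

/-- Packs a `4 × 4` matrix of natural numbers. -/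
def packNatMatrix (A : Fin 4 → Fin 4 → ℕ) : ℕ :=
  packLanes [A 0 0, A 0 1, A 0 2, A 0 3, A 1 0, A 1 1, A 1 2, A 1 3,
    A 2 0, A 2 1, A 2 2, A 2 3, A 3 0, A 3 1, A 3 2, A 3 3]

/-- Packs a `4 × 4` matrix modulo 31. -/
def packMatrix (A : Matrix (Fin 4) (Fin 4) (ZMod 31)) : ℕ :=
  packNatMatrix fun i j => (A i j).val

theorem land_lane_mask {a : ℕ} (h : a < 31) : a &&& 16777215 = a := by
  have h1 : (16777215 : ℕ) = 2 ^ 24 - 1 := by norm_num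
  rw [h1, Nat.and_two_pow_sub_one_eq_mod]
  omega

theorem packed_column {A : Fin 4 → Fin 4 → ℕ} (hA : ∀ i j, A i j < 31) (k : Fin 4) :
    Nat.land (Nat.shiftRight (packNatMatrix A) (24 * k))
    8343698861742818599568911384447877086237429891310761349107124077119354343327963272250849755135 =
      packLanes [A 0 k, 0, 0, 0, A 1 k, 0, 0, 0, A 2 k, 0, 0, 0, A 3 k] := by
  have hA' (i j) : A i j < 16777216 := (hA i j).trans (by norm_num)
  have h1 : packNatMatrix A >>> (24 * (k : ℕ)) = packLanes _ :=
    packLanes_shiftRight _ (by simp [hA']) k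
  refine (congrArg (Nat.land · _) h1).trans ?_
  refine (packLanes_land _
    [16777215, 0, 0, 0, 16777215, 0, 0, 0, 16777215, 0, 0, 0, 16777215] ?_ (by simp)).trans ?_
  · fin_cases k <;> simp [hA']
  · fin_cases k <;> simp [land_lane_mask, hA]

theorem packed_row {A : Fin 4 → Fin 4 → ℕ} (hA : ∀ i j, A i j < 31) (k : Fin 4) :
    Nat.land (Nat.shiftRight (packNatMatrix A) (24 * (4 * k))) 79228162514264337593543950335 =
      packLanes [A k 0, A k 1, A k 2, A k 3] := by
  have hA' (i j) : A i j < 16777216 := (hA i j).trans (by norm_num)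
  have h1 : packNatMatrix A >>> (24 * (4 * (k : ℕ))) = packLanes _ :=
    packLanes_shiftRight _ (by simp [hA']) (4 * k)
  refine (congrArg (Nat.land · _) h1).trans ?_
  refine (packLanes_land _ [16777215, 16777215, 16777215, 16777215] ?_ (by simp)).trans ?_
  · fin_cases k <;> simp [hA']
  · fin_cases k <;> simp [land_lane_mask, hA]

theorem packNatMatrix_add (A B : Fin 4 → Fin 4 → ℕ) :
    packNatMatrix A + packNatMatrix B = packNatMatrix fun i j => A i j + B i j :=
  packLanes_add_zipWith _ _ rfl

theorem packedOuter_packNatMatrix {A B : Fin 4 → Fin 4 → ℕ} (hA : ∀ i j, A i j < 31)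
    (hB : ∀ i j, B i j < 31) (k : Fin 4) :
    packedOuter (packNatMatrix A) (packNatMatrix B) (24 * k) (24 * (4 * k)) =
      packNatMatrix fun i j => A i k * B k j := by
  rw [packedOuter, packed_column hA, packed_row hB]
  refine (Nat.mul_eq ..).trans ?_
  simp only [packNatMatrix, packLanes]
  ring

theorem packedMul_packMatrix (A B : Matrix (Fin 4) (Fin 4) (ZMod 31)) :
    packedMul (packMatrix A) (packMatrix B) = packMatrix (A * B) := by
  have hA (i j) : (A i j).val < 31 := ZMod.val_lt _
  have hB (i j) : (B i j).val < 31 := ZMod.val_lt _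
  have h : packedPreMul (packMatrix A) (packMatrix B) =
      packNatMatrix fun i j => (A i 0).val * (B 0 j).val + (A i 1).val * (B 1 j).val +
        ((A i 2).val * (B 2 j).val + (A i 3).val * (B 3 j).val) := by
    have h0 := packedOuter_packNatMatrix hA hB 0
    have h1 := packedOuter_packNatMatrix hA hB 1
    have h2 := packedOuter_packNatMatrix hA hB 2
    have h3 := packedOuter_packNatMatrix hA hB 3
    have e0 : packedPreMul (packMatrix A) (packMatrix B) = _ + _ + (_ + _) :=
      congrArg₂ (· + ·) (congrArg₂ (· + ·) h0 h1) (congrArg₂ (· + ·) h2 h3)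
    rw [e0]
    simp only [packNatMatrix_add]
  have hlt (i j) : (A i 0).val * (B 0 j).val + (A i 1).val * (B 1 j).val +
        ((A i 2).val * (B 2 j).val + (A i 3).val * (B 3 j).val) < 3601 := by
    have hk (k) : (A i k).val * (B k j).val ≤ 30 * 30 :=
      Nat.mul_le_mul (Nat.le_of_lt_succ (hA i k)) (Nat.le_of_lt_succ (hB k j))
    have h0 := hk 0
    have h1 := hk 1
    have h2 := hk 2
    have h3 := hk 3
    omega
  rw [packedMul, withNat_eq, h]
  refine (laneMod_packLanes _ rfl ?_).trans ?_
  · simp only [List.forall_mem_cons, List.not_mem_nil, false_imp_iff, implies_true, hlt, and_self]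
  · refine congrArg packLanes ?_
    have hmod (i j) : (((A i 0).val * (B 0 j).val + (A i 1).val * (B 1 j).val +
        ((A i 2).val * (B 2 j).val + (A i 3).val * (B 3 j).val)) % 31) = ((A * B) i j).val := by
      rw [← ZMod.val_natCast]
      congr 1
      push_cast
      simp only [ZMod.natCast_zmod_val, Matrix.mul_apply, Fin.sum_univ_four]
      ring
    simp only [List.map_cons, List.map_nil, hmod]

end PackedMatrices

/-- Binary search trees of key-value pairs. -/
inductive SearchTree
  | nil
  | node (key val : ℕ) (l r : SearchTree)

namespace SearchTree

/-- The entries in increasing order of the keys. -/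
def toList : SearchTree → List (ℕ × ℕ)
  | nil => []
  | node c v l r => l.toList ++ (c, v) :: r.toList

noncomputable section

/-- The list of entries, in continuation passing style. -/
def withList (t : SearchTree) : List (ℕ × ℕ) → (List (ℕ × ℕ) → Bool) → Bool :=
  SearchTree.rec (fun acc k => k acc)
    (fun c v _ _ ihl ihr acc k => ihr acc fun acc => ihl ((c, v) :: acc) k) t

/-- Inserts an entry, combining the values by `f` if the key is present. -/
def withInsert (f : ℕ → ℕ → ℕ) (t : SearchTree) (c v : ℕ) : (SearchTree → Bool) → Bool :=
  SearchTree.rec (fun k => k (node c v nil nil))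
    (fun c' v' l r ihl ihr k =>
      cond (Nat.beq c c') (withNat (f v' v) fun u => k (node c' u l r))
        (cond (Nat.ble c c') (ihl fun l' => k (node c' v' l' r))
          (ihr fun r' => k (node c' v' l r')))) t

/-- Looks up a key; fails if it is absent. -/
def withLookup (t : SearchTree) (c : ℕ) (k : ℕ → Bool) : Bool :=
  SearchTree.rec false
    (fun c' v' _ _ ihl ihr => cond (Nat.beq c c') (k v') (cond (Nat.ble c c') ihl ihr)) t

theorem withList_eq (t : SearchTree) (acc : List (ℕ × ℕ)) (k : List (ℕ × ℕ) → Bool) :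
    t.withList acc k = k (t.toList ++ acc) := by
  induction t generalizing acc k with
  | nil => rfl
  | node c v l r ihl ihr =>
    refine (ihr acc fun acc => l.withList ((c, v) :: acc) k).trans ?_
    rw [ihl, toList, List.append_assoc, List.cons_append]

theorem exists_of_withLookup {t : SearchTree} {c : ℕ} {k : ℕ → Bool} (h : t.withLookup c k) :
    ∃ v, (c, v) ∈ t.toList ∧ k v := by
  induction t with
  | nil => exact absurd h Bool.false_ne_true
  | node c' v' l r ihl ihr =>
    replace h : cond (Nat.beq c c') (k v') (cond (Nat.ble c c') (l.withLookup c k)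
      (r.withLookup c k)) = true := h
    cases h1 : Nat.beq c c' with
    | true =>
      rw [h1] at h
      exact ⟨v', by simp [toList, Nat.eq_of_beq_eq_true h1], h⟩
    | false =>
      rw [h1, cond_false] at h
      cases h2 : Nat.ble c c' <;> rw [h2] at h
      · obtain ⟨v, hv, hk⟩ := ihr h
        exact ⟨v, by simp [toList, hv], hk⟩
      · obtain ⟨v, hv, hk⟩ := ihl h
        exact ⟨v, by simp [toList, hv], hk⟩

theorem exists_of_withInsert {f : ℕ → ℕ → ℕ} {t : SearchTree} {c v : ℕ} {k : SearchTree → Bool}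
    (h : t.withInsert f c v k) :
    ∃ t' : SearchTree, k t' ∧
      ((t'.toList.Perm ((c, v) :: t.toList)) ∨
        ∃ v' l, t.toList.Perm ((c, v') :: l) ∧ t'.toList.Perm ((c, f v' v) :: l)) := by
  induction t generalizing k with
  | nil => exact ⟨_, h, .inl (by simp [toList])⟩
  | node c' v' l r ihl ihr =>
    replace h : cond (Nat.beq c c') (withNat (f v' v) fun u => k (node c' u l r))
        (cond (Nat.ble c c') (l.withInsert f c v fun l' => k (node c' v' l' r))
          (r.withInsert f c v fun r' => k (node c' v' l r'))) = true := h
    cases h1 : Nat.beq c c' with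
    | true =>
      rw [h1, cond_true, withNat_eq] at h
      obtain rfl := Nat.eq_of_beq_eq_true h1
      exact ⟨_, h, .inr ⟨v', _, List.perm_middle, List.perm_middle⟩⟩
    | false =>
      rw [h1, cond_false] at h
      cases h2 : Nat.ble c c' <;> rw [h2] at h
      · obtain ⟨t', hk, hp | ⟨u, m, hp, hp'⟩⟩ := ihr h
        · refine ⟨_, hk, .inl ?_⟩
          exact ((hp.cons _).append_left _).trans
            (((List.Perm.swap ..).append_left _).trans List.perm_middle)
        · refine ⟨_, hk, .inr ⟨u, l.toList ++ (c', v') :: m, ?_, ?_⟩⟩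
          · refine ((hp.cons _).append_left _).trans ?_
            exact ((List.Perm.swap ..).append_left _).trans List.perm_middle
          · refine ((hp'.cons _).append_left _).trans ?_
            exact ((List.Perm.swap ..).append_left _).trans List.perm_middle
      · obtain ⟨t', hk, hp | ⟨u, m, hp, hp'⟩⟩ := ihl h
        · exact ⟨_, hk, .inl (hp.append_right _)⟩
        · exact ⟨_, hk, .inr ⟨u, m ++ (c', v') :: r.toList, hp.append_right _,
            hp'.append_right _⟩⟩

theorem exists_of_withInsert_left {t : SearchTree} {c v : ℕ} {k : SearchTree → Bool}
    {P : ℕ × ℕ → Prop} (ht : ∀ p ∈ t.toList, P p) (hP : P (c, v))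
    (h : t.withInsert (fun a _ => a) c v k) :
    ∃ t' : SearchTree, k t' ∧ ∀ p ∈ t'.toList, P p := by
  obtain ⟨t', hk, hp | ⟨v', l, hp, hp'⟩⟩ := exists_of_withInsert h
  · refine ⟨t', hk, fun p hmem => ?_⟩
    rcases List.mem_cons.1 (hp.mem_iff.1 hmem) with rfl | h
    exacts [hP, ht _ h]
  · exact ⟨t', hk, fun p hmem => ht p (hp.mem_iff.2 (hp'.mem_iff.1 hmem))⟩

/-- The sum of the values, weighted by a function of the keys. -/
def weightedSum (F : ℕ → ℂ) (l : List (ℕ × ℕ)) : ℂ :=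
  (l.map fun p => (p.2 : ℂ) * F p.1).sum

theorem weightedSum_cons (F : ℕ → ℂ) (p : ℕ × ℕ) (l : List (ℕ × ℕ)) :
    weightedSum F (p :: l) = p.2 * F p.1 + weightedSum F l := by
  simp [weightedSum]

theorem weightedSum_perm (F : ℕ → ℂ) {l l' : List (ℕ × ℕ)} (h : l.Perm l') :
    weightedSum F l = weightedSum F l' :=
  (h.map _).sum_eq

theorem exists_of_withInsert_add {t : SearchTree} {c v : ℕ} {k : SearchTree → Bool}
    (h : t.withInsert Nat.add c v k) :
    ∃ t' : SearchTree, k t' ∧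
      ∀ F, weightedSum F t'.toList = v * F c + weightedSum F t.toList := by
  obtain ⟨t', hk, hp | ⟨v', l, hp, hp'⟩⟩ := exists_of_withInsert h
  · refine ⟨t', hk, fun F => ?_⟩
    rw [weightedSum_perm F hp, weightedSum_cons]
  · refine ⟨t', hk, fun F => ?_⟩
    rw [weightedSum_perm F hp, weightedSum_perm F hp', weightedSum_cons, weightedSum_cons]
    have : ((Nat.add v' v : ℕ) : ℂ) = v' + v := Nat.cast_add _ _
    rw [this]
    ring

end

end SearchTree

noncomputable section

open SearchTree

/-- Checks that the keys of `l` increase, starting from at least `b`, and that `l` has at least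
`n` entries. -/
def increasing (l : List (ℕ × ℕ)) : (b n : ℕ) → Bool :=
  List.rec (fun _ n => Nat.beq n 0)
    (fun p _ ih b n => cond (Nat.ble b p.1)
      (withNat (Nat.succ p.1) fun b => withNat (Nat.pred n) fun n => ih b n) false) l

theorem increasing_spec {l : List (ℕ × ℕ)} {b n : ℕ} (h : increasing l b n) :
    (l.map Prod.fst).Nodup ∧ (∀ p ∈ l, b ≤ p.1) ∧ n ≤ l.length := by
  induction l generalizing b n with
  | nil =>
    have : n = 0 := Nat.eq_of_beq_eq_true h
    simp [this]
  | cons p l ih =>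
    replace h : cond (Nat.ble b p.1)
      (withNat (Nat.succ p.1) fun b => withNat (Nat.pred n) fun n => increasing l b n) false =
        true := h
    cases h1 : Nat.ble b p.1 <;> rw [h1] at h
    · exact absurd h Bool.false_ne_true
    · rw [cond_true, withNat_eq, withNat_eq] at h
      obtain ⟨ha, hb, hc⟩ := ih h
      have h2 := Nat.le_of_ble_eq_true h1
      refine ⟨?_, ?_, ?_⟩
      · rw [List.map_cons, List.nodup_cons]
        refine ⟨fun hmem => ?_, ha⟩
        obtain ⟨q, hq, he⟩ := List.mem_map.1 hmem
        have := hb q hq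
        omega
      · intro q hq
        rcases List.mem_cons.1 hq with rfl | hq
        · exact h2
        · have := hb q hq
          omega
      · rw [List.length_cons]
        have : n.pred = n - 1 := rfl
        omega

/-- Checks a property of all entries of a list. -/
def allEntries {α : Type} (f : α → Bool) (l : List α) : Bool :=
  List.rec true (fun p _ ih => cond (f p) ih false) l

theorem allEntries_iff {α : Type} {f : α → Bool} {l : List α} :
    allEntries f l ↔ ∀ p ∈ l, f p := by
  induction l with
  | nil => simp [allEntries]
  | cons p l ih =>
    rw [List.forall_mem_cons, ← ih]
    change cond (f p) (allEntries f l) false = true ↔ _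
    cases f p <;> simp

/-- Applies the steps selected by the digits of `D` to the entry `(x, v)`, recording the results
in the tree and on the stack. -/
def withSteps (F G : ℕ → ℕ → ℕ) (x v : ℕ) (steps : List (ℕ × ℕ)) :
    ℕ → List (ℕ × ℕ) → SearchTree → (ℕ → List (ℕ × ℕ) → SearchTree → Bool) → Bool :=
  List.rec (fun D st t k => k D st t)
    (fun s _ ih D st t k => withNat (Nat.div D 2) fun D' =>
      cond (Nat.beq (Nat.mod D 2) 0) (ih D' st t k)
        (withNat (F s.1 x) fun y => withNat (G s.2 v) fun u =>
          t.withInsert (fun a _ => a) y u fun t' => ih D' ((y, u) :: st) t' k)) steps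

/-- A depth first search along `steps`, guided by the digits of `D`. -/
def withSearch (F G : ℕ → ℕ → ℕ) (steps : List (ℕ × ℕ)) (fuel : ℕ) :
    ℕ → List (ℕ × ℕ) → SearchTree → (SearchTree → Bool) → Bool :=
  Nat.rec (fun _ _ t k => k t)
    (fun _ ih D st t k =>
      List.rec (k t) (fun p st' _ => withSteps F G p.1 p.2 steps D st' t fun D' st'' t' =>
        ih D' st'' t' k) st) fuel

section Search

variable {F G : ℕ → ℕ → ℕ} {steps : List (ℕ × ℕ)} {P : ℕ × ℕ → Prop}

theorem exists_of_withSteps {x v : ℕ}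
    (hstep : ∀ s ∈ steps, P (F s.1 x, G s.2 v)) {D : ℕ}
    {st : List (ℕ × ℕ)} {t : SearchTree} {k : ℕ → List (ℕ × ℕ) → SearchTree → Bool}
    (hst : ∀ p ∈ st, P p) (ht : ∀ p ∈ t.toList, P p) (h : withSteps F G x v steps D st t k) :
    ∃ D' st' t', k D' st' t' ∧ (∀ p ∈ st', P p) ∧ ∀ p ∈ t'.toList, P p := by
  induction steps generalizing D st t with
  | nil => exact ⟨D, st, t, h, hst, ht⟩
  | cons s steps ih =>
    have ih' {D st t} := @ih (fun s hs => hstep s (List.mem_cons_of_mem _ hs)) D st t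
    replace h : (withNat (Nat.div D 2) fun D' =>
      cond (Nat.beq (Nat.mod D 2) 0) (withSteps F G x v steps D' st t k)
        (withNat (F s.1 x) fun y => withNat (G s.2 v) fun u =>
          t.withInsert (fun a _ => a) y u fun t' =>
            withSteps F G x v steps D' ((y, u) :: st) t' k)) = true := h
    rw [withNat_eq] at h
    cases h1 : Nat.beq (Nat.mod D 2) 0 <;> rw [h1] at h
    · rw [cond_false, withNat_eq, withNat_eq] at h
      have hs := hstep s List.mem_cons_self
      obtain ⟨t', hk, ht'⟩ := exists_of_withInsert_left ht hs h
      exact ih' (List.forall_mem_cons.2 ⟨hs, hst⟩) ht' hk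
    · exact ih' hst ht h

theorem exists_of_withSearch
    (hstep : ∀ s ∈ steps, ∀ x v, P (x, v) → P (F s.1 x, G s.2 v))
    {fuel D : ℕ} {st : List (ℕ × ℕ)} {t : SearchTree} {k : SearchTree → Bool}
    (hst : ∀ p ∈ st, P p) (ht : ∀ p ∈ t.toList, P p)
    (h : withSearch F G steps fuel D st t k) :
    ∃ t' : SearchTree, k t' ∧ ∀ p ∈ t'.toList, P p := by
  induction fuel generalizing D st t with
  | zero => exact ⟨t, h, ht⟩
  | succ fuel ih =>
    cases st with
    | nil => exact ⟨t, h, ht⟩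
    | cons p st =>
      replace h : (withSteps F G p.1 p.2 steps D st t fun D' st'' t' =>
        withSearch F G steps fuel D' st'' t' k) = true := h
      obtain ⟨D', st', t', hk, hst', ht'⟩ := exists_of_withSteps
        (fun s hs => hstep s hs p.1 p.2 (hst p List.mem_cons_self))
        (fun q hq => hst q (List.mem_cons_of_mem _ hq)) ht h
      exact ih hst' ht' hk

end Search

end

/-- A linear character of a centralizer: either by generators, with the exponents of their values,
and the digits of a search enumerating the centralizer, or, for a central element, by the exponents
of the values at the simple reflections. -/
inductive CentralizerCharacter
  | generated (gens : List (List ℕ × ℕ)) (digits : ℕ)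
  | central (exponents : List ℕ)

/-- A conjugacy class: a word for a representative, the size of the class, the digits of a search
enumerating the class, and a linear character of the centralizer of the representative. -/
structure ClassDatum where
  word : List ℕ
  size : ℕ
  digits : ℕ
  char : CentralizerCharacter

noncomputable section

open SearchTree

/-- The `j`-th element of a list. -/
def nthD {α : Type} (l : List α) (d : α) : ℕ → α :=
  List.rec (fun _ => d) (fun a _ ih j => Nat.rec a (fun m _ => ih m) j) l

/-- The packed matrix of a word in the generators. -/
def wordCode (one : ℕ) (gens : List (ℕ × ℕ)) (w : List ℕ) : ℕ :=
  List.rec (fun acc => acc)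
    (fun j _ ih acc => withNat (packedMul acc (nthD gens (one, 0) j).1) ih) w one

/-- The exponent of a linear character at a word in the generators. -/
def wordExponent (e : List ℕ) (w : List ℕ) : ℕ → ℕ :=
  List.rec (fun acc => acc) (fun j _ ih acc => withNat (Nat.add acc (nthD e 0 j)) ih) w

/-- Enumerates the conjugacy classes in a tree with the packed matrices as keys. -/
def withClasses (one : ℕ) (gens : List (ℕ × ℕ)) (reps : List ClassDatum) :
    ℕ → SearchTree → (SearchTree → Bool) → Bool :=
  List.rec (fun _ T k => k T)
    (fun R _ ih j T k => withNat (wordCode one gens R.word) fun x =>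
      T.withInsert (fun a _ => a) x j fun T =>
        withSearch (fun a x => withNat (packedMul a x) fun y => packedMul y a) (fun _ v => v) gens
          R.size R.digits [(x, j)] T fun T => withNat (Nat.succ j) fun j => ih j T k) reps

/-- Whether the packed matrix `x` commutes with all members of a list. -/
def commutesWith (x : ℕ) (gens : List (ℕ × ℕ)) : Bool :=
  allEntries (fun p => Nat.beq (packedMul p.1 x) (packedMul x p.1)) gens

/-- Computes the packed matrices of generators given as words. -/
def withCodes (one : ℕ) (gens : List (ℕ × ℕ)) (l : List (List ℕ × ℕ)) :
    (List (ℕ × ℕ) → Bool) → Bool :=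
  List.rec (fun k => k [])
    (fun p _ ih k => withNat (wordCode one gens p.1) fun g => ih fun l => k ((g, p.2) :: l)) l

/-- Adds the values of a linear character on the elements listed in `L` to the counts `Q`. -/
def withValues (n size : ℕ) (T : SearchTree) (L : List (ℕ × ℕ)) :
    SearchTree → (SearchTree → Bool) → Bool :=
  List.rec (fun Q k => k Q)
    (fun p _ ih Q k => T.withLookup p.1 fun j => withNat (Nat.add (Nat.mul j n) p.2) fun key =>
      Q.withInsert Nat.add key size fun Q => ih Q k) L

/-- Enumerates a centralizer, checks that the exponents of the generators define a linear
character and adds its values to the counts `Q`. -/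
def withGenerated (n N one : ℕ) (gens : List (ℕ × ℕ)) (T : SearchTree) (x size : ℕ)
    (l : List (List ℕ × ℕ)) (digits : ℕ) (Q : SearchTree) (k : SearchTree → Bool) : Bool :=
  withCodes one gens l fun gs => cond (commutesWith x gs)
    (withSearch (fun g y => packedMul y g) (fun e v => Nat.mod (Nat.add v e) n) gs N digits
      [(one, 0)] (node one 0 nil nil) fun t => t.withList [] fun L =>
        cond (increasing L 0 (Nat.div N size))
          (cond (allEntries (fun p => allEntries (fun g => withNat (packedMul p.1 g.1) fun y =>
              t.withLookup y fun e => Nat.beq e (Nat.mod (Nat.add p.2 g.2) n)) gs) L)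
            (withValues n size T L Q k) false) false) false

/-- Adds the values of a linear character of the whole group to the counts `Q`. -/
def withCentralValues (n : ℕ) (e : List ℕ) (reps : List ClassDatum) :
    ℕ → SearchTree → (SearchTree → Bool) → Bool :=
  List.rec (fun _ Q k => k Q)
    (fun R _ ih j Q k => withNat (Nat.add (Nat.mul j n) (Nat.mod (wordExponent e R.word 0) n))
      fun key => Q.withInsert Nat.add key R.size fun Q => withNat (Nat.succ j) fun j => ih j Q k)
    reps

/-- Adds the values of the linear characters of all centralizers to the counts `Q`. -/
def withCounts (n N one : ℕ) (gens : List (ℕ × ℕ)) (all : List ClassDatum) (T : SearchTree)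
    (reps : List ClassDatum) : SearchTree → (SearchTree → Bool) → Bool :=
  List.rec (fun Q k => k Q)
    (fun R _ ih Q k => withNat (wordCode one gens R.word) fun x =>
      CentralizerCharacter.rec
        (fun l digits => cond (Nat.beq (Nat.mul R.size (Nat.div N R.size)) N)
          (withGenerated n N one gens T x R.size l digits Q fun Q => ih Q k) false)
        (fun e => cond (Nat.beq R.size 1) (cond (commutesWith x gens)
          (withCentralValues n e all 0 Q fun Q => ih Q k) false) false) R.char) reps

/-- Adds `v` at the shifts of a key. -/
def withShifts (n key v : ℕ) (shifts : List ℕ) :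
    SearchTree → (SearchTree → Bool) → Bool :=
  List.rec (fun t k => k t)
    (fun d _ ih t k => withNat (Nat.add (Nat.mul (Nat.div key n) n)
        (Nat.mod (Nat.add (Nat.mod key n) d) n)) fun key' =>
      t.withInsert Nat.add key' v fun t => ih t k) shifts

/-- Multiplies the counts outside the trivial class by a difference of two sums of powers. -/
def withShiftedCounts (n : ℕ) (plus minus : List ℕ) (L : List (ℕ × ℕ)) :
    SearchTree → SearchTree → (SearchTree → SearchTree → Bool) → Bool :=
  List.rec (fun t t' k => k t t')
    (fun p _ ih t t' k => cond (Nat.ble n p.1)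
      (withShifts n p.1 p.2 plus t fun t => withShifts n p.1 p.2 minus t' fun t' => ih t t' k)
      (ih t t' k)) L

/-- Equality of lists of entries. -/
def sameEntries (l : List (ℕ × ℕ)) : List (ℕ × ℕ) → Bool :=
  List.rec (fun l' => List.rec true (fun _ _ _ => false) l')
    (fun p _ ih l' => List.rec false
      (fun q m _ => cond (Nat.beq p.1 q.1) (cond (Nat.beq p.2 q.2) (ih m) false) false) l') l

/-- Checks that linear characters of the centralizers decompose the regular character. -/
def checkDecomposition (n N one : ℕ) (gens : List (ℕ × ℕ)) (reps : List ClassDatum)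
    (plus minus : List ℕ) : Bool :=
  withClasses one gens reps 0 nil fun T => T.withList [] fun L => cond (increasing L 0 N)
    (withCounts n N one gens reps T reps nil fun Q => Q.withList [] fun K =>
      withShiftedCounts n plus minus K nil nil fun t t' =>
        t.withList [] fun l => t'.withList [] fun l' => sameEntries l l') false

theorem eq_of_sameEntries {l l' : List (ℕ × ℕ)} (h : sameEntries l l') : l = l' := by
  induction l generalizing l' with
  | nil =>
    cases l' with
    | nil => rfl
    | cons q l' => exact absurd h Bool.false_ne_true
  | cons p l ih =>
    cases l' with
    | nil => exact absurd h Bool.false_ne_true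
    | cons q l' =>
      replace h : cond (Nat.beq p.1 q.1) (cond (Nat.beq p.2 q.2) (sameEntries l l') false) false =
        true := h
      cases h1 : Nat.beq p.1 q.1 <;> rw [h1] at h
      · exact absurd h Bool.false_ne_true
      cases h2 : Nat.beq p.2 q.2 <;> rw [h2] at h
      · exact absurd h Bool.false_ne_true
      rw [Prod.ext (Nat.eq_of_beq_eq_true h1) (Nat.eq_of_beq_eq_true h2), ih h]

theorem of_cond_eq_true {a b : Bool} (h : cond a b false = true) : a = true ∧ b = true := by
  cases a
  · exact absurd h Bool.false_ne_true
  · exact ⟨rfl, h⟩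

section Shifts

variable {n : ℕ} {ζ : ℂ}

/-- The summand of class `j` in the counts. -/
def classWeight (n : ℕ) (ζ : ℂ) (j key : ℕ) : ℂ :=
  if key / n = j then ζ ^ (key % n) else 0

theorem classWeight_add (hn : 0 < n) (i j e : ℕ) (he : e < n) :
    classWeight n ζ j (i * n + e) = if i = j then ζ ^ e else 0 := by
  rw [classWeight, mul_comm, Nat.mul_add_div hn, Nat.mul_add_mod, Nat.div_eq_of_lt he,
    Nat.mod_eq_of_lt he, add_zero]

theorem exists_of_withShifts (hn : 0 < n) (hζ : ζ ^ n = 1) {key v : ℕ} {shifts : List ℕ}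
    {t : SearchTree} {k : SearchTree → Bool} (h : withShifts n key v shifts t k) :
    ∃ t' : SearchTree, k t' ∧ ∀ j, weightedSum (classWeight n ζ j) t'.toList =
      v * classWeight n ζ j key * (shifts.map (ζ ^ ·)).sum +
        weightedSum (classWeight n ζ j) t.toList := by
  induction shifts generalizing t with
  | nil => exact ⟨t, h, by simp⟩
  | cons d shifts ih =>
    replace h : (withNat (Nat.add (Nat.mul (Nat.div key n) n)
        (Nat.mod (Nat.add (Nat.mod key n) d) n)) fun key' =>
      t.withInsert Nat.add key' v fun t => withShifts n key v shifts t k) = true := h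
    rw [withNat_eq] at h
    obtain ⟨t', h', ht'⟩ := exists_of_withInsert_add h
    obtain ⟨t'', h'', ht''⟩ := ih h'
    refine ⟨t'', h'', fun j => ?_⟩
    rw [ht'', ht']
    have : classWeight n ζ j (Nat.add (Nat.mul (Nat.div key n) n)
        (Nat.mod (Nat.add (Nat.mod key n) d) n)) = classWeight n ζ j key * ζ ^ d := by
      refine (classWeight_add hn _ j _ (Nat.mod_lt _ hn)).trans ?_
      have : ζ ^ (Nat.add (Nat.mod key n) d % n) = ζ ^ (key % n + d) :=
        (pow_eq_pow_mod _ hζ).symm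
      rw [this, classWeight, pow_add, ite_mul, zero_mul]
      rfl
    rw [this, List.map_cons, List.sum_cons]
    ring

theorem exists_of_withShiftedCounts (hn : 0 < n) (hζ : ζ ^ n = 1) {j : ℕ} (hj : 0 < j)
    {plus minus : List ℕ} {L : List (ℕ × ℕ)} {t t' : SearchTree}
    {k : SearchTree → SearchTree → Bool} (h : withShiftedCounts n plus minus L t t' k) :
    ∃ u u' : SearchTree, k u u' ∧
      weightedSum (classWeight n ζ j) u.toList - weightedSum (classWeight n ζ j) u'.toList =
        weightedSum (classWeight n ζ j) L *
          ((plus.map (ζ ^ ·)).sum - (minus.map (ζ ^ ·)).sum) +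
        weightedSum (classWeight n ζ j) t.toList - weightedSum (classWeight n ζ j) t'.toList := by
  induction L generalizing t t' with
  | nil => exact ⟨t, t', h, by simp [weightedSum]⟩
  | cons p L ih =>
    replace h : cond (Nat.ble n p.1)
      (withShifts n p.1 p.2 plus t fun t => withShifts n p.1 p.2 minus t' fun t' =>
        withShiftedCounts n plus minus L t t' k)
      (withShiftedCounts n plus minus L t t' k) = true := h
    cases h1 : Nat.ble n p.1 <;> rw [h1] at h
    · obtain ⟨u, u', hk, hu⟩ := ih h
      refine ⟨u, u', hk, ?_⟩
      have h2 : p.1 < n := by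
        by_contra hlt
        exact Bool.false_ne_true (h1.symm.trans (Nat.ble_eq_true_of_le (not_lt.1 hlt)))
      have h3 : classWeight n ζ j p.1 = 0 := by
        rw [classWeight, Nat.div_eq_of_lt h2, if_neg hj.ne]
      rw [hu, weightedSum_cons, h3, mul_zero, zero_add]
    · obtain ⟨t₁, h₁, ht₁⟩ := exists_of_withShifts hn hζ h
      obtain ⟨t₂, h₂, ht₂⟩ := exists_of_withShifts hn hζ h₁
      obtain ⟨u, u', hk, hu⟩ := ih h₂
      refine ⟨u, u', hk, ?_⟩
      rw [hu, ht₁, ht₂, weightedSum_cons]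
      ring

end Shifts

end

noncomputable section

open SearchTree

section Soundness

theorem nthD_mem_or {α : Type} (l : List α) (d : α) (j : ℕ) : nthD l d j ∈ l ∨ nthD l d j = d := by
  induction l generalizing j with
  | nil => exact .inr rfl
  | cons a l ih =>
    cases j with
    | zero => exact .inl List.mem_cons_self
    | succ j => exact (ih j).imp_left (List.mem_cons_of_mem a)

theorem exists_nthD_eq {α : Type} {l : List α} {a : α} (d : α) (h : a ∈ l) :
    ∃ j, nthD l d j = a := by
  induction l with
  | nil => cases h
  | cons b l ih =>
    rcases List.mem_cons.1 h with rfl | h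
    · exact ⟨0, rfl⟩
    · obtain ⟨j, hj⟩ := ih h
      exact ⟨j + 1, hj⟩

theorem injective_of_nodup {W : Type*} [Fintype W] {c : W → ℕ} {L : List (ℕ × ℕ)} (hL : (L.map Prod.fst).Nodup)
    (hc : ∀ p ∈ L, ∃ y, c y = p.1) (hcard : Fintype.card W ≤ L.length) :
    Function.Injective c ∧ L.length = Fintype.card W ∧ ∀ y, ∃ v, (c y, v) ∈ L := by
  have hsub : (L.map Prod.fst).toFinset ⊆ Finset.univ.image c := by
    intro x hx
    obtain ⟨p, hp, rfl⟩ := List.mem_map.1 (List.mem_toFinset.1 hx)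
    obtain ⟨y, hy⟩ := hc p hp
    exact Finset.mem_image.2 ⟨y, Finset.mem_univ _, hy⟩
  have h1 : (L.map Prod.fst).toFinset.card = L.length := by
    rw [List.toFinset_card_of_nodup hL, List.length_map]
  have h2 := Finset.card_le_card hsub
  have h3 : (Finset.univ.image c).card ≤ Fintype.card W := Finset.card_image_le
  have h4 : (Finset.univ.image c).card = (Finset.univ : Finset W).card := by
    rw [Finset.card_univ]
    omega
  refine ⟨fun x y hxy => ?_, by omega, fun y => ?_⟩
  · exact Finset.injOn_of_card_image_eq h4 (Finset.mem_coe.2 (Finset.mem_univ x))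
      (Finset.mem_coe.2 (Finset.mem_univ y)) hxy
  · have h5 := Finset.eq_of_subset_of_card_le hsub (by omega)
    have h6 : c y ∈ (L.map Prod.fst).toFinset := by
      rw [h5]
      exact Finset.mem_image_of_mem _ (Finset.mem_univ y)
    obtain ⟨p, hp, hpy⟩ := List.mem_map.1 (List.mem_toFinset.1 h6)
    exact ⟨p.2, by rwa [← hpy]⟩

theorem eq_of_mem_of_nodup {L : List (ℕ × ℕ)} (hL : (L.map Prod.fst).Nodup) {x u v : ℕ}
    (hu : (x, u) ∈ L) (hv : (x, v) ∈ L) : u = v :=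
  congrArg Prod.snd (List.inj_on_of_nodup_map hL hu hv rfl)

variable {W : Type*} [Group W] {c : W → ℕ} {s : ℕ → W} {one : ℕ} {gens : List (ℕ × ℕ)}
  {n N : ℕ} {ζ : ℂ}

theorem wordCode_eq (hmul : ∀ x y, packedMul (c x) (c y) = c (x * y)) (hone : one = c 1)
    (hs : ∀ j, (nthD gens (one, 0) j).1 = c (s j)) (w : List ℕ) :
    wordCode one gens w = c (w.map s).prod := by
  have key : ∀ (w : List ℕ) (g : W), List.rec (motive := fun _ => ℕ → ℕ) (fun acc => acc)
      (fun j _ ih acc => withNat (packedMul acc (nthD gens (one, 0) j).1) ih) w (c g) =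
        c (g * (w.map s).prod) := by
    intro w
    induction w with
    | nil => simp
    | cons j w ih =>
      intro g
      refine (withNat_eq _ _).trans ?_
      rw [hs, hmul, ih, List.map_cons, List.prod_cons, mul_assoc]
  have := key w 1
  rwa [one_mul, ← hone] at this

theorem map_prod_eq_pow_wordExponent {X : W →* ℂ} {e : List ℕ}
    (hX : ∀ i, X (s i) = ζ ^ nthD e 0 i) (w : List ℕ) :
    X (w.map s).prod = ζ ^ wordExponent e w 0 := by
  have key : ∀ (w : List ℕ) (a : ℕ), ζ ^ wordExponent e w a = ζ ^ a * X (w.map s).prod := by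
    intro w
    induction w with
    | nil => simp [wordExponent]
    | cons j w ih =>
      intro a
      have : wordExponent e (j :: w) a = wordExponent e w (a + nthD e 0 j) := withNat_eq _ _
      rw [this, ih, pow_add, List.map_cons, List.prod_cons, map_mul, hX, mul_assoc]
  rw [key, pow_zero, one_mul]

/-- The property of the entries of the tree of conjugacy classes. -/
def IsClassEntry (c : W → ℕ) (s : ℕ → W) (reps : List ClassDatum) (p : ℕ × ℕ) : Prop :=
  ∃ R, reps[p.2]? = some R ∧ ∃ y, c y = p.1 ∧ IsConj (R.word.map s).prod y

theorem exists_of_withClasses (hmul : ∀ x y, packedMul (c x) (c y) = c (x * y)) (hone : one = c 1)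
    (hs : ∀ j, (nthD gens (one, 0) j).1 = c (s j)) (hinv : ∀ j, s j * s j = 1)
    {all reps : List ClassDatum} {j : ℕ} (hreps : ∀ i, reps[i]? = all[j + i]?) {T : SearchTree}
    (hT : ∀ p ∈ T.toList, IsClassEntry c s all p) {k : SearchTree → Bool}
    (h : withClasses one gens reps j T k) :
    ∃ T' : SearchTree, k T' ∧ ∀ p ∈ T'.toList, IsClassEntry c s all p := by
  induction reps generalizing j T with
  | nil => exact ⟨T, h, hT⟩
  | cons R reps ih =>
    replace h : (withNat (wordCode one gens R.word) fun x =>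
      T.withInsert (fun a _ => a) x j fun T =>
        withSearch (fun a x => withNat (packedMul a x) fun y => packedMul y a) (fun _ v => v) gens
          R.size R.digits [(x, j)] T fun T => withNat (Nat.succ j) fun j =>
            withClasses one gens reps j T k) = true := h
    rw [withNat_eq, wordCode_eq hmul hone hs] at h
    have hR : IsClassEntry c s all (c (R.word.map s).prod, j) :=
      ⟨R, (hreps 0).symm, _, rfl, IsConj.refl _⟩
    obtain ⟨T₁, h₁, hT₁⟩ := exists_of_withInsert_left hT hR h
    have hstep : ∀ g ∈ gens, ∀ x v, IsClassEntry c s all (x, v) → IsClassEntry c s all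
        (withNat (packedMul g.1 x) fun y => packedMul y g.1, v) := by
      rintro g hg x v ⟨R', hR', y, rfl, hy⟩
      obtain ⟨i, rfl⟩ := exists_nthD_eq (one, 0) hg
      refine ⟨R', hR', s i * y * s i, ?_, ?_⟩
      · dsimp only
        rw [withNat_eq, hs, hmul, hmul]
      · exact hy.trans (isConj_iff.2 ⟨s i, by rw [inv_eq_of_mul_eq_one_right (hinv i)]⟩)
    obtain ⟨T₂, h₂, hT₂⟩ := exists_of_withSearch hstep (by simpa using hR) hT₁ h₁
    rw [withNat_eq] at h₂
    exact ih (fun i => by simpa [add_assoc, add_comm 1] using hreps (i + 1)) hT₂ h₂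

theorem commute_of_commutesWith (hmul : ∀ x y, packedMul (c x) (c y) = c (x * y))
    (hc : Function.Injective c) {r : W} {gs : List (ℕ × ℕ)} (h : commutesWith (c r) gs) {g : W}
    {e : ℕ} (hg : (c g, e) ∈ gs) : Commute g r := by
  have := Nat.eq_of_beq_eq_true (allEntries_iff.1 h _ hg)
  rw [hmul, hmul] at this
  exact hc this

theorem exists_of_withCodes (hmul : ∀ x y, packedMul (c x) (c y) = c (x * y)) (hone : one = c 1)
    (hs : ∀ j, (nthD gens (one, 0) j).1 = c (s j)) {l : List (List ℕ × ℕ)}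
    {k : List (ℕ × ℕ) → Bool} (h : withCodes one gens l k) :
    ∃ gs, k gs ∧ ∀ p ∈ gs, ∃ g, p.1 = c g := by
  induction l generalizing k with
  | nil => exact ⟨[], h, by simp⟩
  | cons p l ih =>
    replace h : (withNat (wordCode one gens p.1) fun g =>
      withCodes one gens l fun l => k ((g, p.2) :: l)) = true := h
    rw [withNat_eq, wordCode_eq hmul hone hs] at h
    obtain ⟨gs, hk, hgs⟩ := ih h
    exact ⟨_, hk, List.forall_mem_cons.2 ⟨⟨_, rfl⟩, hgs⟩⟩

theorem exists_of_withValues (hn : 0 < n) {size : ℕ} {T : SearchTree} {idx : ℕ → ℕ}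
    (hidx : ∀ x v, (x, v) ∈ T.toList → v = idx x) {L : List (ℕ × ℕ)} (hL : ∀ p ∈ L, p.2 < n)
    {Q : SearchTree} {k : SearchTree → Bool} (h : withValues n size T L Q k) :
    ∃ Q' : SearchTree, k Q' ∧ ∀ j, weightedSum (classWeight n ζ j) Q'.toList =
      size * (L.map fun p => if idx p.1 = j then ζ ^ p.2 else 0).sum +
        weightedSum (classWeight n ζ j) Q.toList := by
  induction L generalizing Q with
  | nil => exact ⟨Q, h, by simp⟩
  | cons p L ih =>
    replace h : (T.withLookup p.1 fun j => withNat (Nat.add (Nat.mul j n) p.2) fun key =>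
      Q.withInsert Nat.add key size fun Q => withValues n size T L Q k) = true := h
    obtain ⟨v, hv, h⟩ := exists_of_withLookup h
    obtain rfl := hidx _ _ hv
    rw [withNat_eq] at h
    obtain ⟨Q₁, h₁, hQ₁⟩ := exists_of_withInsert_add h
    obtain ⟨Q₂, h₂, hQ₂⟩ := ih (fun p hp => hL p (List.mem_cons_of_mem _ hp)) h₁
    refine ⟨Q₂, h₂, fun j => ?_⟩
    rw [hQ₂, hQ₁, List.map_cons, List.sum_cons]
    have : classWeight n ζ j (Nat.add (Nat.mul (idx p.1) n) p.2) = _ :=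
      classWeight_add hn (idx p.1) j p.2 (hL p List.mem_cons_self)
    rw [this]
    ring

theorem exists_of_withCentralValues (hζ : ζ ^ n = 1) (hn : 0 < n) {e : List ℕ}
    {reps : List ClassDatum} {i : ℕ} {Q : SearchTree} {k : SearchTree → Bool}
    (h : withCentralValues n e reps i Q k) :
    ∃ Q' : SearchTree, k Q' ∧ ∀ j, weightedSum (classWeight n ζ j) Q'.toList =
      (if i ≤ j then (reps[j - i]?).elim 0 fun R => R.size * ζ ^ wordExponent e R.word 0 else 0) +
        weightedSum (classWeight n ζ j) Q.toList := by
  induction reps generalizing i Q with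
  | nil => exact ⟨Q, h, by simp⟩
  | cons R reps ih =>
    replace h : (withNat (Nat.add (Nat.mul i n) (Nat.mod (wordExponent e R.word 0) n))
      fun key => Q.withInsert Nat.add key R.size fun Q => withNat (Nat.succ i) fun i =>
        withCentralValues n e reps i Q k) = true := h
    rw [withNat_eq] at h
    obtain ⟨Q₁, h₁, hQ₁⟩ := exists_of_withInsert_add h
    rw [withNat_eq] at h₁
    obtain ⟨Q₂, h₂, hQ₂⟩ := ih h₁
    refine ⟨Q₂, h₂, fun j => ?_⟩
    have hw : classWeight n ζ j (Nat.add (Nat.mul i n) (Nat.mod (wordExponent e R.word 0) n)) =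
        if i = j then ζ ^ (wordExponent e R.word 0) else 0 := by
      refine (classWeight_add hn i j _ (Nat.mod_lt _ hn)).trans ?_
      have : ζ ^ (Nat.mod (wordExponent e R.word 0) n) = ζ ^ (wordExponent e R.word 0) :=
        (pow_eq_pow_mod _ hζ).symm
      rw [← this]
      rfl
    rw [hQ₂, hQ₁, hw]
    rcases lt_trichotomy i j with hij | rfl | hij
    · obtain ⟨m, rfl⟩ := Nat.exists_eq_add_of_lt hij
      rw [if_pos (by omega), if_neg (by omega), if_pos (by omega),
        show i + m + 1 - i = m + 1 by omega, show i + m + 1 - i.succ = m by omega,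
        List.getElem?_cons_succ]
      ring
    · rw [if_neg (by omega), if_pos rfl, if_pos le_rfl, Nat.sub_self]
      simp
    · rw [if_neg (by omega), if_neg (by omega), if_neg (by omega)]
      ring

variable [Fintype W]

/-- `χ` restricts to a linear character of the set `A` of elements commuting with `r`. -/
structure IsCharacterOn (r : W) (size N : ℕ) (A : Finset W) (χ : W → ℂ) : Prop where
  commute : ∀ y ∈ A, Commute y r
  le_card : N ≤ size * A.card
  map_one : χ 1 = 1
  map_mul : ∀ g ∈ A, ∀ g' ∈ A, χ (g * g') = χ g * χ g'

theorem isCharacterOn_of_list (hc : Function.Injective c) (hζ : ζ ^ n = 1) (hn : 0 < n) {r : W}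
    {size : ℕ} (hN : 0 < N) {L : List (ℕ × ℕ)} (hL : (L.map Prod.fst).Nodup)
    (hlen : N ≤ size * L.length)
    (hP : ∀ p ∈ L, ∃ y, c y = p.1 ∧ Commute y r ∧
      ∀ z f, (c z, f) ∈ L → ∃ f', (c (z * y), f') ∈ L ∧ f' ≡ f + p.2 [MOD n]) :
    ∃ A χ, IsCharacterOn r size N A χ ∧ ∀ (F : ℕ → Prop) [DecidablePred F],
      (L.map fun p => if F p.1 then ζ ^ p.2 else 0).sum =
        ∑ y ∈ A, if F (c y) then χ y else 0 := by
  choose! d hd using hP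
  have hdc (y : W) (v : ℕ) (h : (c y, v) ∈ L) : d (c y, v) = y := hc (hd _ h).1
  have hnodup : (L.map d).Nodup := by
    refine (List.nodup_map_iff_inj_on (List.Nodup.of_map _ hL)).2 fun p hp q hq h => ?_
    refine List.inj_on_of_nodup_map hL hp hq ?_
    rw [← (hd p hp).1, ← (hd q hq).1, h]
  let χ (y : W) : ℂ := if h : ∃ v, (c y, v) ∈ L then ζ ^ h.choose else 0
  have hχ (y : W) (v : ℕ) (h : (c y, v) ∈ L) : χ y = ζ ^ v := by
    have hex : ∃ v, (c y, v) ∈ L := ⟨v, h⟩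
    simp only [χ, dif_pos hex]
    rw [eq_of_mem_of_nodup hL hex.choose_spec h]
  have hmem (y : W) : y ∈ (L.map d).toFinset ↔ ∃ v, (c y, v) ∈ L := by
    rw [List.mem_toFinset, List.mem_map]
    constructor
    · rintro ⟨p, hp, rfl⟩
      exact ⟨p.2, by rwa [(hd p hp).1]⟩
    · rintro ⟨v, hv⟩
      exact ⟨_, hv, hdc y v hv⟩
  have hmul' (z y : W) (f v : ℕ) (hz : (c z, f) ∈ L) (hy : (c y, v) ∈ L) :
      (∃ f', (c (z * y), f') ∈ L) ∧ χ (z * y) = χ z * χ y := by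
    obtain ⟨f', hf', hmod⟩ := (hd _ hy).2.2 z f hz
    rw [hdc y v hy] at hf'
    refine ⟨⟨f', hf'⟩, ?_⟩
    rw [hχ _ _ hf', hχ _ _ hz, hχ _ _ hy, ← pow_add]
    rw [pow_eq_pow_mod f' hζ, hmod, ← pow_eq_pow_mod _ hζ]
  have hone : ∃ v, (c 1, v) ∈ L := by
    have hpos : 0 < L.length := Nat.pos_of_ne_zero fun h => by simp [h] at hlen; omega
    obtain ⟨p, hp⟩ := List.exists_mem_of_length_pos hpos
    have hp' : (c (d p), p.2) ∈ L := by rwa [(hd p hp).1]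
    have hpow (m : ℕ) : ∃ v, (c (d p ^ (m + 1)), v) ∈ L := by
      induction m with
      | zero => exact ⟨p.2, by simpa using hp'⟩
      | succ m ih =>
        obtain ⟨v, hv⟩ := ih
        rw [pow_succ]
        exact (hmul' _ _ _ _ hv hp').1
    have := hpow (orderOf (d p) - 1)
    rwa [Nat.sub_add_cancel (orderOf_pos _), pow_orderOf_eq_one] at this
  refine ⟨(L.map d).toFinset, χ, ⟨?_, ?_, ?_, ?_⟩, fun F _ => ?_⟩
  · intro y hy
    obtain ⟨v, hv⟩ := (hmem y).1 hy
    have := (hd _ hv).2.1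
    rwa [hdc y v hv] at this
  · rwa [List.toFinset_card_of_nodup hnodup, List.length_map]
  · obtain ⟨v, hv⟩ := hone
    have h := (hmul' 1 1 v v hv hv).2
    rw [mul_one] at h
    have h0 : χ 1 ≠ 0 := by
      rw [hχ _ _ hv]
      refine pow_ne_zero _ fun h0 => ?_
      rw [h0, zero_pow hn.ne'] at hζ
      exact zero_ne_one hζ
    exact mul_left_cancel₀ h0 (by rw [← h, mul_one])
  · intro g hg g' hg'
    obtain ⟨v, hv⟩ := (hmem g).1 hg
    obtain ⟨v', hv'⟩ := (hmem g').1 hg'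
    exact (hmul' _ _ _ _ hv hv').2
  · rw [List.sum_toFinset _ hnodup, List.map_map]
    congr 1
    refine List.map_congr_left fun p hp => ?_
    have hp' : (c (d p), p.2) ∈ L := by rwa [(hd p hp).1]
    simp only [Function.comp]
    rw [(hd p hp).1, hχ _ _ hp']

theorem exists_of_withGenerated (hmul : ∀ x y, packedMul (c x) (c y) = c (x * y))
    (hone : one = c 1) (hs : ∀ j, (nthD gens (one, 0) j).1 = c (s j)) (hc : Function.Injective c)
    (hζ : ζ ^ n = 1) (hn : 0 < n) (hN : 0 < N) {T : SearchTree} {idx : ℕ → ℕ}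
    (hidx : ∀ x v, (x, v) ∈ T.toList → v = idx x) {r : W} {size : ℕ}
    (hsize : size * (N / size) = N) {l : List (List ℕ × ℕ)} {digits : ℕ} {Q : SearchTree}
    {k : SearchTree → Bool} (h : withGenerated n N one gens T (c r) size l digits Q k) :
    ∃ A χ, IsCharacterOn r size N A χ ∧ ∃ Q' : SearchTree, k Q' ∧ ∀ j,
      weightedSum (classWeight n ζ j) Q'.toList =
        size * (∑ y ∈ A, if idx (c y) = j then χ y else 0) +
          weightedSum (classWeight n ζ j) Q.toList := by
  obtain ⟨gs, h, hgs⟩ := exists_of_withCodes hmul hone hs h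
  obtain ⟨hcomm, h⟩ := of_cond_eq_true h
  let Closed (L : List (ℕ × ℕ)) : Prop :=
    ∀ p ∈ L, ∀ g ∈ gs, (packedMul p.1 g.1, (p.2 + g.2) % n) ∈ L
  let P (p : ℕ × ℕ) : Prop := p.2 < n ∧ ∃ y, c y = p.1 ∧ Commute y r ∧ ∀ L, Closed L →
    ∀ z f, (c z, f) ∈ L → ∃ f', (c (z * y), f') ∈ L ∧ f' ≡ f + p.2 [MOD n]
  have hP1 : P (one, 0) :=
    ⟨hn, 1, hone.symm, Commute.one_left _, fun L _ z f hz => ⟨f, by rwa [mul_one], rfl⟩⟩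
  have hstep : ∀ g ∈ gs, ∀ x v, P (x, v) → P (packedMul x g.1, Nat.mod (Nat.add v g.2) n) := by
    rintro ⟨g₀, e⟩ hg x v ⟨hv, y, hy, hyr, hL⟩
    obtain ⟨g, hg'⟩ := hgs _ hg
    dsimp only at hg' hy
    subst hg' hy
    refine ⟨Nat.mod_lt _ hn, y * g, (hmul y g).symm,
      hyr.mul_left (commute_of_commutesWith hmul hc hcomm hg), fun L hcl z f hz => ?_⟩
    obtain ⟨f', hf', hmod⟩ := hL L hcl z f hz
    have h1 := hcl _ hf' _ hg
    refine ⟨(f' + e) % n, ?_, ?_⟩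
    · rw [← mul_assoc, ← hmul]
      exact h1
    · refine (Nat.mod_modEq _ _).trans ((hmod.add_right e).trans ?_)
      rw [add_assoc]
      exact (Nat.ModEq.refl f).add (Nat.mod_modEq _ _).symm
  obtain ⟨t, h, ht⟩ := exists_of_withSearch hstep (by simpa using hP1)
    (by simpa [toList] using hP1) h
  rw [withList_eq, List.append_nil] at h
  obtain ⟨hinc, h⟩ := of_cond_eq_true h
  obtain ⟨hclosed, h⟩ := of_cond_eq_true h
  obtain ⟨hnodup, -, hlen⟩ := increasing_spec hinc
  obtain ⟨Q', hQ', hS⟩ := exists_of_withValues (ζ := ζ) hn hidx (fun p hp => (ht p hp).1) h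
  have hcl : Closed t.toList := by
    intro p hp g hg
    have h1 := allEntries_iff.1 (allEntries_iff.1 hclosed p hp) g hg
    rw [withNat_eq] at h1
    obtain ⟨v, hv, he⟩ := exists_of_withLookup h1
    rw [Nat.eq_of_beq_eq_true he] at hv
    exact hv
  obtain ⟨A, χ, hA, hsum⟩ := isCharacterOn_of_list (r := r) (size := size) hc hζ hn hN hnodup
    (by
      calc N = size * (N / size) := hsize.symm
        _ ≤ _ := Nat.mul_le_mul_left _ hlen)
    fun p hp => by
      obtain ⟨-, y, hy, hyr, hy'⟩ := ht p hp
      exact ⟨y, hy, hyr, hy' _ hcl⟩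
  exact ⟨A, χ, hA, Q', hQ', fun j => by rw [hS, hsum fun x => idx x = j]⟩

end Soundness

end

noncomputable section

open SearchTree

section Soundness

variable {W : Type*} [Group W] {c : W → ℕ} {s : ℕ → W} {one : ℕ}
  {gens : List (ℕ × ℕ)} {n N : ℕ} {ζ : ℂ}

theorem commute_of_forall_generators (hs' : Subgroup.closure (Set.range s) = ⊤) {r : W}
    (h : ∀ j, Commute (s j) r) (y : W) : Commute y r := by
  have hle : Subgroup.closure (Set.range s) ≤ Subgroup.centralizer {r} := by
    rw [Subgroup.closure_le]
    rintro _ ⟨j, rfl⟩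
    exact Subgroup.mem_centralizer_singleton_iff.2 (h j)
  rw [hs'] at hle
  exact Subgroup.mem_centralizer_singleton_iff.1 (hle (Subgroup.mem_top y))

variable [Fintype W]

theorem exists_of_withCounts (hmul : ∀ x y, packedMul (c x) (c y) = c (x * y))
    (hone : one = c 1) (hs : ∀ j, (nthD gens (one, 0) j).1 = c (s j))
    (hs' : Subgroup.closure (Set.range s) = ⊤) (hc : Function.Injective c)
    (hcard : N = Fintype.card W) (hζ : ζ ^ n = 1) (hn : 0 < n)
    {all : List ClassDatum} {T : SearchTree} {idx : ℕ → ℕ}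
    (hidx : ∀ x v, (x, v) ∈ T.toList → v = idx x)
    (hall : ∀ y, ∃ R, all[idx (c y)]? = some R ∧ IsConj (R.word.map s).prod y)
    {reps : List ClassDatum} (hlin : ∀ R ∈ reps, ∀ e, R.char = .central e →
      ∃ X : W →* ℂ, ∀ i, X (s i) = ζ ^ nthD e 0 i)
    {Q : SearchTree} {k : SearchTree → Bool} (h : withCounts n N one gens all T reps Q k) :
    ∃ (A : Fin reps.length → Finset W) (χ : Fin reps.length → W → ℂ),
      (∀ i, IsCharacterOn (reps[i].word.map s).prod reps[i].size N (A i) (χ i)) ∧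
      ∃ Q' : SearchTree, k Q' ∧
        ((∀ j R, all[j]? = some R →
            (Finset.univ.filter fun y => idx (c y) = j).card = R.size) → ∀ j,
          weightedSum (classWeight n ζ j) Q'.toList =
            (∑ i, (reps[i].size : ℂ) * ∑ y ∈ A i, if idx (c y) = j then χ i y else 0) +
              weightedSum (classWeight n ζ j) Q.toList) := by
  induction reps generalizing Q with
  | nil => exact ⟨fun i => i.elim0, fun i => i.elim0, fun i => i.elim0, Q, h, by simp⟩
  | cons R reps ih =>
    have hN : 0 < N := hcard ▸ Fintype.card_pos
    let r := (R.word.map s).prod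
    suffices hR : ∃ A χ, IsCharacterOn r R.size N A χ ∧ ∃ Q' : SearchTree,
        withCounts n N one gens all T reps Q' k ∧
        ((∀ j R, all[j]? = some R →
            (Finset.univ.filter fun y => idx (c y) = j).card = R.size) → ∀ j,
          weightedSum (classWeight n ζ j) Q'.toList =
            (R.size * ∑ y ∈ A, if idx (c y) = j then χ y else 0) +
              weightedSum (classWeight n ζ j) Q.toList) by
      obtain ⟨A, χ, hA, Q₁, h₁, hQ₁⟩ := hR
      obtain ⟨A', χ', hA', Q₂, h₂, hQ₂⟩ :=
        ih (fun R' hR' => hlin R' (List.mem_cons_of_mem _ hR')) h₁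
      refine ⟨Fin.cons A A', Fin.cons χ χ', Fin.cases hA hA', Q₂, h₂, fun H j => ?_⟩
      rw [hQ₂ H, hQ₁ H, ← add_assoc]
      congr 1
      exact (add_comm _ _).trans (Fin.sum_univ_succ (n := reps.length) fun i =>
        ((R :: reps)[i].size : ℂ) * ∑ y ∈ (Fin.cons A A' : Fin (reps.length + 1) → Finset W) i,
          if idx (c y) = j then (Fin.cons χ χ' : Fin (reps.length + 1) → W → ℂ) i y else 0).symm
    replace h : (withNat (wordCode one gens R.word) fun x =>
      CentralizerCharacter.rec
        (fun l digits => cond (Nat.beq (Nat.mul R.size (Nat.div N R.size)) N)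
          (withGenerated n N one gens T x R.size l digits Q fun Q =>
            withCounts n N one gens all T reps Q k) false)
        (fun e => cond (Nat.beq R.size 1) (cond (commutesWith x gens)
          (withCentralValues n e all 0 Q fun Q => withCounts n N one gens all T reps Q k) false)
          false) R.char : Bool) = true := h
    rw [withNat_eq, wordCode_eq hmul hone hs] at h
    have hlinR := hlin R List.mem_cons_self
    cases hchar : R.char with
    | generated l digits =>
      rw [hchar] at h
      obtain ⟨hsize, h⟩ := of_cond_eq_true h
      obtain ⟨A, χ, hA, Q₁, h₁, hQ₁⟩ := exists_of_withGenerated hmul hone hs hc hζ hn hN hidx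
        (Nat.eq_of_beq_eq_true hsize) h
      exact ⟨A, χ, hA, Q₁, h₁, fun _ => hQ₁⟩
    | central e =>
      rw [hchar] at h
      obtain ⟨hsize, h⟩ := of_cond_eq_true h
      obtain ⟨hcomm, h⟩ := of_cond_eq_true h
      replace hsize : R.size = 1 := Nat.eq_of_beq_eq_true hsize
      obtain ⟨X, hX⟩ := hlinR e hchar
      obtain ⟨Q₁, h₁, hQ₁⟩ := exists_of_withCentralValues hζ hn h
      have hcr (y : W) : Commute y r := by
        refine commute_of_forall_generators hs' (fun j => ?_) y
        rcases nthD_mem_or gens (one, 0) j with hj | hj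
        · refine commute_of_commutesWith (e := (nthD gens (one, 0) j).2) hmul hc hcomm ?_
          rwa [← hs j]
        · have : s j = 1 := hc (by rw [← hs j, hj, hone])
          rw [this]
          exact Commute.one_left r
      refine ⟨Finset.univ, X, ⟨fun y _ => hcr y, ?_, map_one X, fun _ _ _ _ => map_mul X _ _⟩, Q₁,
        h₁, fun H j => ?_⟩
      · rw [hsize, one_mul, Finset.card_univ, hcard]
      · rw [hQ₁, hsize, if_pos (Nat.zero_le _), Nat.sub_zero, Nat.cast_one, one_mul,
          ← Finset.sum_filter]
        congr 1
        have hval : ∀ y ∈ Finset.univ.filter (fun y => idx (c y) = j),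
            ∃ R', all[j]? = some R' ∧ X y = ζ ^ wordExponent e R'.word 0 := by
          intro y hy
          obtain ⟨R', hR', hconj⟩ := hall y
          rw [(Finset.mem_filter.1 hy).2] at hR'
          refine ⟨R', hR', ?_⟩
          rw [← map_prod_eq_pow_wordExponent hX, ← isConj_iff_eq]
          exact X.map_isConj hconj.symm
        cases hj : all[j]? with
        | none =>
          rw [Finset.sum_eq_zero, Option.elim_none]
          intro y hy
          obtain ⟨R', hR', -⟩ := hval y hy
          simp [hj] at hR'
        | some R' =>
          rw [Finset.sum_congr rfl (g := fun _ => ζ ^ wordExponent e R'.word 0), Finset.sum_const,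
            H j R' hj, nsmul_eq_mul, Option.elim_some]
          intro y hy
          obtain ⟨R'', hR'', hy'⟩ := hval y hy
          rw [hj, Option.some.injEq] at hR''
          rw [hy', hR'']

theorem HasRegularDecomposition.of_checkDecomposition
    (hmul : ∀ x y, packedMul (c x) (c y) = c (x * y)) (hone : one = c 1)
    (hs : ∀ j, (nthD gens (one, 0) j).1 = c (s j)) (hinv : ∀ j, s j * s j = 1)
    (hs' : Subgroup.closure (Set.range s) = ⊤) (hcard : Fintype.card W ≤ N)
    (hζ : ζ ^ n = 1) (hn : 0 < n) {plus minus : List ℕ}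
    (hshift : (plus.map (ζ ^ ·)).sum - (minus.map (ζ ^ ·)).sum ≠ 0) {reps : List ClassDatum}
    (hlin : ∀ R ∈ reps, ∀ e, R.char = .central e → ∃ X : W →* ℂ, ∀ i, X (s i) = ζ ^ nthD e 0 i)
    (hhead : ∀ R, reps[0]? = some R → R.word = []) (hsum : (reps.map ClassDatum.size).sum = N)
    (h : checkDecomposition n N one gens reps plus minus) : HasRegularDecomposition W := by
  obtain ⟨T, h, hT⟩ := exists_of_withClasses hmul hone hs hinv (all := reps) (fun i => by simp)
    (by simp [toList]) h
  rw [withList_eq, List.append_nil] at h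
  obtain ⟨hinc, h⟩ := of_cond_eq_true h
  obtain ⟨hnodup, -, hlen⟩ := increasing_spec hinc
  obtain ⟨hc, hlen', hTall⟩ := injective_of_nodup hnodup
    (fun p hp => let ⟨_, _, y, hy, _⟩ := hT p hp; ⟨y, hy⟩) (hcard.trans hlen)
  have hN : N = Fintype.card W := by omega
  let idx (x : ℕ) : ℕ := if h : ∃ v, (x, v) ∈ T.toList then h.choose else 0
  have hidx (x v : ℕ) (hv : (x, v) ∈ T.toList) : v = idx x := by
    have hex : ∃ v, (x, v) ∈ T.toList := ⟨v, hv⟩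
    simp only [idx, dif_pos hex]
    exact eq_of_mem_of_nodup hnodup hv hex.choose_spec
  have hall (y : W) : ∃ R, reps[idx (c y)]? = some R ∧ IsConj (R.word.map s).prod y := by
    obtain ⟨v, hv⟩ := hTall y
    obtain ⟨R, hR, y', hy', hconj⟩ := hT _ hv
    rw [← hidx _ _ hv]
    exact ⟨R, hR, hc hy' ▸ hconj⟩
  obtain ⟨A, χ, hA, Q, h, hQ⟩ :=
    exists_of_withCounts hmul hone hs hs' hc hN hζ hn hidx hall hlin h
  rw [withList_eq, List.append_nil] at h
  have hall' (y : W) : ∃ i : Fin reps.length, i.1 = idx (c y) ∧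
      IsConj (reps[i].word.map s).prod y := by
    obtain ⟨R, hR, hconj⟩ := hall y
    obtain ⟨hlt, hR⟩ := List.getElem?_eq_some_iff.1 hR
    exact ⟨⟨_, hlt⟩, rfl, by simpa [hR] using hconj⟩
  have hcover (y : W) : ∃ i : Fin reps.length, IsConj (reps[i].word.map s).prod y :=
    (hall' y).imp fun i hi => hi.2
  have hsize : ∑ i : Fin reps.length, reps[i].size = Fintype.card W := by
    rw [← hN, ← hsum]
    exact Fin.sum_univ_fun_getElem reps ClassDatum.size
  have hle (i : Fin reps.length) : Fintype.card W ≤ reps[i].size * (A i).card :=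
    hN ▸ (hA i).le_card
  obtain ⟨hcl, huniq, -⟩ := class_card_eq_of_sum_eq (fun i => (hA i).commute) hle hsize hcover
  have hiff (i : Fin reps.length) (y : W) :
      idx (c y) = i ↔ IsConj (reps[i].word.map s).prod y := by
    obtain ⟨i', hi', hconj⟩ := hall' y
    rw [← hi']
    refine ⟨fun h => by rwa [← Fin.ext h], fun h => ?_⟩
    rw [huniq _ _ (hconj.trans h.symm)]
  refine .of_subsets χ (fun i => (hA i).commute) hle hsize hcover (fun i => (hA i).map_one)
    (fun i => (hA i).map_mul) fun j hj => ?_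
  have hj0 : 0 < j.1 := by
    refine Nat.pos_of_ne_zero fun h0 => hj ?_
    have : reps[0]? = some reps[j] := by
      rw [← h0]
      simp
    rw [hhead _ this, List.map_nil, List.prod_nil]
  obtain ⟨u, u', h, hu⟩ := exists_of_withShiftedCounts hn hζ hj0 h
  rw [withList_eq, withList_eq] at h
  have heq := eq_of_sameEntries h
  rw [List.append_nil, List.append_nil] at heq
  rw [heq, sub_self] at hu
  have hzero : weightedSum (classWeight n ζ j) (SearchTree.nil).toList = 0 := by
    simp [weightedSum, toList]
  rw [hzero, add_zero, sub_zero] at hu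
  have hQj := (mul_eq_zero.1 hu.symm).resolve_right hshift
  rw [hQ (fun i R hR => ?_), hzero, add_zero] at hQj
  · refine Eq.trans ?_ hQj
    exact Finset.sum_congr rfl fun i _ => congrArg _ <| Finset.sum_congr rfl fun y _ =>
      if_congr (hiff j y).symm rfl rfl
  · obtain ⟨hlt, rfl⟩ := List.getElem?_eq_some_iff.1 hR
    refine Eq.trans ?_ (hcl ⟨i, hlt⟩)
    exact congrArg _ (Finset.filter_congr fun y _ => hiff ⟨i, hlt⟩ y)

end Soundness

end

noncomputable section

section CosetTables

/-- The entry of a table. -/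
def tableEntry (t : List (List ℕ)) (x a : ℕ) : ℕ := nthD (nthD t [] x) 0 a

/-- The coset obtained from coset `x` by multiplication by the generator `a`. Entries less than the
number `k` of cosets are cosets; the entry `k + t` means that the representative of `x` satisfies
`x * a = t * x`. -/
def cosetDest (k : ℕ) (t : List (List ℕ)) (x a : ℕ) : ℕ :=
  cond (Nat.blt (tableEntry t x a) k) (tableEntry t x a) x

/-- One more than the generator moved to the left, or `0` if there is none. -/
def cosetShift (k : ℕ) (t : List (List ℕ)) (x a : ℕ) : ℕ :=
  cond (Nat.blt (tableEntry t x a) k) 0 (tableEntry t x a - k + 1)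

/-- The last generator leading to a smaller coset. -/
def cosetParent (k : ℕ) (t : List (List ℕ)) (z l : ℕ) : ℕ :=
  Nat.rec 0 (fun a ih => cond (Nat.blt (cosetDest k t z a) z) a ih) l

/-- Follows the edge `b` from coset `x`, which has to be an edge below `z` or the edge `r` at `z`. -/
def withEdge (k : ℕ) (t : List (List ℕ)) (z r x h b : ℕ) (cont : ℕ → ℕ → Bool) : Bool :=
  withNat (cosetDest k t x b) fun y => withNat (cosetShift k t x b) fun g =>
    cond (Nat.blt x z && Nat.blt y z || Nat.beq b r && (Nat.beq x z || Nat.beq y z))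
      (cond (Nat.beq g 0 || Nat.beq h 0) (withNat (Nat.add h g) fun h => cont y h) false) false

/-- Follows the edges `r, a, r, a, …, r, a`. -/
def withEdges (k : ℕ) (t : List (List ℕ)) (z r a : ℕ) (cont : ℕ → ℕ → Bool) :
    ℕ → ℕ → ℕ → Bool :=
  Nat.rec cont (fun _ ih x h =>
    withEdge k t z r x h r fun x h => withEdge k t z r x h a fun x h => ih x h)

/-- Checks a property of all natural numbers less than `n`. -/
def allBelow (n : ℕ) (p : ℕ → Bool) : Bool :=
  Nat.rec true (fun i ih => cond (p i) ih false) n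

theorem of_allBelow {n : ℕ} {p : ℕ → Bool} (h : allBelow n p) : ∀ i < n, p i := by
  induction n with
  | zero => simp
  | succ n ih =>
    obtain ⟨h1, h2⟩ := of_cond_eq_true (a := p n) (b := allBelow n p) h
    intro i hi
    rcases Nat.lt_succ_iff_lt_or_eq.1 hi with hi | rfl
    exacts [ih h2 i hi, h1]

/-- Checks a table of the `k` cosets of the subgroup generated by the first `l` generators in the
group generated by the first `l + 1` generators. -/
def checkCosets (M : List (List ℕ)) (l k : ℕ) (t : List (List ℕ)) : Bool :=
  allBelow k fun z => withNat (cosetParent k t z (l + 1)) fun r => allBelow (l + 1) fun a =>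
    cond (Nat.beq (tableEntry t (cosetDest k t z a) a)
        (cond (Nat.blt (tableEntry t z a) k) z (tableEntry t z a)))
      (cond (Nat.ble (cosetShift k t z a) l)
        (cond (Nat.beq z 0)
          (cond (Nat.blt 0 (cosetDest k t z a)) true (Nat.beq (tableEntry t z a) (k + a)))
          (cond (Nat.blt (cosetDest k t z r) z)
            (cond (Nat.blt z (cosetDest k t z a)) true
              (cond (Nat.beq a r) true
                (withEdges k t z r a (fun x h => withEdge k t z r x h r fun x h =>
                  Nat.beq x (cosetDest k t z a) && Nat.beq h (cosetShift k t z a))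
                  (tableEntry M r a - 1) z 0)))
            false))
        false) false

variable {W : Type*} [Group W] {s : ℕ → W} {k l : ℕ} {t M : List (List ℕ)}

/-- The generator `j` for the index `j + 1`, and the identity for the index `0`. -/
def shiftedGenerator (s : ℕ → W) : ℕ → W
  | 0 => 1
  | j + 1 => s j

/-- The representatives of the cosets. -/
def cosetRep (s : ℕ → W) (k : ℕ) (t : List (List ℕ)) (n z : ℕ) : W :=
  if _h : cosetDest k t z (cosetParent k t z n) < z then
    cosetRep s k t n (cosetDest k t z (cosetParent k t z n)) * s (cosetParent k t z n)
  else 1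
termination_by z

theorem blt_eq_true_iff {a b : ℕ} : Nat.blt a b = true ↔ a < b :=
  ⟨fun h => Nat.le_of_ble_eq_true h, fun h => Nat.ble_eq_true_of_le h⟩

theorem beq_eq_true_iff {a b : ℕ} : Nat.beq a b = true ↔ a = b :=
  ⟨Nat.eq_of_beq_eq_true, by rintro rfl; exact Nat.beq_refl a⟩

theorem cosetDest_lt {x a : ℕ} (hx : x < k) : cosetDest k t x a < k := by
  rw [cosetDest]
  cases h : Nat.blt (tableEntry t x a) k
  · exact hx
  · exact blt_eq_true_iff.1 h

/-- The relation expressed by an entry of the table. -/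
def IsCosetEdge (s : ℕ → W) (k : ℕ) (t : List (List ℕ)) (f : ℕ → W) (x a : ℕ) : Prop :=
  f x * s a = shiftedGenerator s (cosetShift k t x a) * f (cosetDest k t x a)

theorem exists_of_withEdge {f : ℕ → W} {z r x h b : ℕ} (hx : x < k) (hb : b < l)
    (hlow : ∀ x b, x < k → b < l → x < z → cosetDest k t x b < z → IsCosetEdge s k t f x b)
    (hr : ∀ x, x < k → (x = z ∨ cosetDest k t x r = z) → IsCosetEdge s k t f x r) {g : W}
    (hg : g = shiftedGenerator s h * f x) {cont : ℕ → ℕ → Bool}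
    (H : withEdge k t z r x h b cont) :
    ∃ y h', y < k ∧ cont y h' ∧ g * s b = shiftedGenerator s h' * f y := by
  rw [withEdge, withNat_eq, withNat_eq] at H
  obtain ⟨h1, H⟩ := of_cond_eq_true H
  obtain ⟨h2, H⟩ := of_cond_eq_true H
  rw [withNat_eq] at H
  refine ⟨_, _, cosetDest_lt hx, H, ?_⟩
  have hedge : IsCosetEdge s k t f x b := by
    simp only [Bool.or_eq_true, Bool.and_eq_true, blt_eq_true_iff, beq_eq_true_iff] at h1
    rcases h1 with h1 | ⟨rfl, h1⟩
    · exact hlow x b hx hb h1.1 h1.2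
    · exact hr x hx h1
  rw [hg, mul_assoc, hedge, ← mul_assoc]
  congr 1
  simp only [Bool.or_eq_true, beq_eq_true_iff] at h2
  rcases h2 with h2 | h2
  · rw [h2]
    exact mul_one _
  · rw [h2]
    refine (one_mul _).trans ?_
    congr 1
    exact (Nat.zero_add _).symm

theorem exists_of_withEdges {f : ℕ → W} {z r a m : ℕ} (ha : a < l) (hrl : r < l)
    (hlow : ∀ x b, x < k → b < l → x < z → cosetDest k t x b < z → IsCosetEdge s k t f x b)
    (hr : ∀ x, x < k → (x = z ∨ cosetDest k t x r = z) → IsCosetEdge s k t f x r) {g : W}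
    {cont : ℕ → ℕ → Bool} {x h : ℕ} (hx : x < k)
    (hg : g = shiftedGenerator s h * f x) (H : withEdges k t z r a cont m x h) :
    ∃ y h', y < k ∧ cont y h' ∧ g * (s r * s a) ^ m = shiftedGenerator s h' * f y := by
  induction m generalizing x h g with
  | zero => exact ⟨x, h, hx, H, by rw [pow_zero, mul_one, hg]⟩
  | succ m ih =>
    obtain ⟨x₁, h₁, hx₁, H, hg₁⟩ := exists_of_withEdge hx hrl hlow hr hg H
    obtain ⟨x₂, h₂, hx₂, H, hg₂⟩ := exists_of_withEdge hx₁ ha hlow hr hg₁ H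
    obtain ⟨x₃, h₃, hx₃, H, hg₃⟩ := ih hx₂ hg₂ H
    exact ⟨x₃, h₃, hx₃, H, by rw [← hg₃, pow_succ', mul_assoc, mul_assoc, mul_assoc]⟩

theorem exists_coset_representatives (hM : ∀ a ≤ l, ∀ b ≤ l, 0 < tableEntry M a b)
    (hrel : ∀ a ≤ l, ∀ b ≤ l, (s a * s b) ^ tableEntry M a b = 1) (hinv : ∀ a, s a * s a = 1)
    (h : checkCosets M l k t) :
    ∃ f : ℕ → W, f 0 = 1 ∧ ∀ x < k, ∀ a ≤ l, ∃ y < k, ∃ g ≤ l,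
      f x * s a = shiftedGenerator s g * f y := by
  let f := cosetRep s k t (l + 1)
  have hf0 : f 0 = 1 := by
    simp only [f]
    rw [cosetRep, dif_neg (Nat.not_lt_zero _)]
  have hcheck (z : ℕ) (hz : z < k) (a : ℕ) (ha : a ≤ l) := by
    have h1 := of_allBelow h z hz
    rw [withNat_eq] at h1
    exact of_allBelow h1 a (Nat.lt_succ_of_le ha)
  have hsymm (z : ℕ) (hz : z < k) (a : ℕ) (ha : a ≤ l) (hza : cosetDest k t z a ≠ z) :
      cosetDest k t (cosetDest k t z a) a = z ∧ cosetShift k t z a = 0 ∧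
        cosetShift k t (cosetDest k t z a) a = 0 := by
    have h1 := Nat.eq_of_beq_eq_true (of_cond_eq_true (hcheck z hz a ha)).1
    have h2 : Nat.blt (tableEntry t z a) k = true := by
      by_contra hne
      exact hza (by rw [cosetDest, Bool.eq_false_of_not_eq_true hne, cond_false])
    rw [h2, cond_true] at h1
    have h3 : Nat.blt z k = true := blt_eq_true_iff.2 hz
    refine ⟨?_, by rw [cosetShift, h2, cond_true], by rw [cosetShift, h1, h3, cond_true]⟩
    rw [cosetDest, h1, h3, cond_true]
  have hflip (x a : ℕ) (hx : x < k) (ha : a ≤ l) (hxa : cosetDest k t x a ≠ x)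
      (hE : IsCosetEdge s k t f x a) : IsCosetEdge s k t f (cosetDest k t x a) a := by
    obtain ⟨h1, h2, h3⟩ := hsymm x hx a ha hxa
    rw [IsCosetEdge, h2] at hE
    rw [IsCosetEdge, h1, h3]
    rw [show shiftedGenerator s 0 = 1 from rfl, one_mul] at hE ⊢
    rw [← hE, mul_assoc, hinv, mul_one]
  have key (z : ℕ) : ∀ x a, x < k → a ≤ l → x ≤ z → cosetDest k t x a ≤ z →
      IsCosetEdge s k t f x a := by
    induction z using Nat.strong_induction_on with
    | _ z ih =>
    have hlow (x a : ℕ) (hx : x < k) (ha : a < l + 1) (hxz : x < z) (hdz : cosetDest k t x a < z) :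
        IsCosetEdge s k t f x a :=
      ih (max x (cosetDest k t x a)) (max_lt hxz hdz) x a hx (Nat.le_of_lt_succ ha)
        (le_max_left _ _) (le_max_right _ _)
    suffices htop : ∀ a, z < k → a ≤ l → cosetDest k t z a ≤ z → IsCosetEdge s k t f z a by
      intro x a hx ha hxz hdz
      rcases hxz.lt_or_eq with hxz | rfl
      · rcases hdz.lt_or_eq with hdz | hdz
        · exact hlow x a hx (Nat.lt_succ_of_le ha) hxz hdz
        · have hne : cosetDest k t x a ≠ x := by omega
          obtain ⟨h1, -, -⟩ := hsymm x hx a ha hne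
          rw [hdz] at h1
          have h2 := hflip z a (hdz ▸ cosetDest_lt hx) ha (by omega)
            (htop a (hdz ▸ cosetDest_lt hx) ha (by omega))
          rwa [h1] at h2
      · exact htop a hx ha hdz
    intro a hz ha hdz
    set r := cosetParent k t z (l + 1) with hr
    have h1 := (of_cond_eq_true (of_cond_eq_true (hcheck z hz a ha)).2).2
    rcases Nat.eq_zero_or_pos z with rfl | hzpos
    · have hd0 : cosetDest k t 0 a = 0 := Nat.le_zero.1 hdz
      have h1 : cond (Nat.blt 0 (cosetDest k t 0 a)) true (Nat.beq (tableEntry t 0 a) (k + a)) =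
        true := h1
      rw [hd0] at h1
      have h2 : tableEntry t 0 a = k + a := Nat.eq_of_beq_eq_true h1
      have h3 : Nat.blt (k + a) k = false :=
        Bool.eq_false_of_not_eq_true fun h => by
          have := blt_eq_true_iff.1 h
          omega
      rw [IsCosetEdge, hd0, cosetShift, h2, h3, hf0, cond_false, Nat.add_sub_cancel_left,
        one_mul, mul_one]
      rfl
    · have hz0 : Nat.beq z 0 = false := Bool.eq_false_of_not_eq_true fun h => by
        have := Nat.eq_of_beq_eq_true h
        omega
      rw [hz0, cond_false] at h1
      obtain ⟨hrz, h1⟩ := of_cond_eq_true h1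
      replace hrz := blt_eq_true_iff.1 hrz
      rw [← hr] at hrz
      have hrl : r ≤ l := by
        have (n : ℕ) : cosetParent k t z n ≤ n - 1 := by
          induction n with
          | zero => exact le_rfl
          | succ n ih =>
            change cond (Nat.blt (cosetDest k t z n) z) n (cosetParent k t z n) ≤ n
            cases Nat.blt (cosetDest k t z n) z
            · exact ih.trans (Nat.sub_le _ _)
            · exact le_rfl
        exact this (l + 1)
      have hfz : f z = f (cosetDest k t z r) * s r := by
        simp only [f]
        rw [cosetRep, dif_pos hrz]
      have hEr : IsCosetEdge s k t f z r := by
        obtain ⟨-, h2, -⟩ := hsymm z hz r hrl hrz.ne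
        rw [IsCosetEdge, h2, hfz, mul_assoc, hinv, mul_one]
        exact (one_mul _).symm
      have hEr' (x : ℕ) (hx : x < k) (hxz : x = z ∨ cosetDest k t x r = z) :
          IsCosetEdge s k t f x r := by
        by_cases hne : x = z
        · rw [hne]
          exact hEr
        · have hd := hxz.resolve_left hne
          obtain ⟨h2, -, -⟩ := hsymm x hx r hrl (by omega)
          have h3 := hflip z r hz hrl hrz.ne hEr
          rwa [← hd, h2] at h3
      by_cases har : a = r
      · rw [har]
        exact hEr
      have h2 : Nat.blt z (cosetDest k t z a) = false := Bool.eq_false_of_not_eq_true fun h => by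
        have := blt_eq_true_iff.1 h
        omega
      have h3 : Nat.beq a r = false :=
        Bool.eq_false_of_not_eq_true fun h => har (Nat.eq_of_beq_eq_true h)
      rw [h2, cond_false, ← hr, h3, cond_false] at h1
      obtain ⟨x₁, h₁, hx₁, H, hg₁⟩ := exists_of_withEdges (l := l + 1) (g := f z)
        (Nat.lt_succ_of_le ha) (Nat.lt_succ_of_le hrl) hlow hEr' hz (one_mul _).symm h1
      obtain ⟨x₂, h₂, hx₂, H, hg₂⟩ :=
        exists_of_withEdge (l := l + 1) hx₁ (Nat.lt_succ_of_le hrl) hlow hEr' hg₁ H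
      simp only [Bool.and_eq_true, beq_eq_true_iff] at H
      rw [IsCosetEdge, ← H.1, ← H.2, ← hg₂, mul_assoc]
      congr 1
      have h4 := hrel r hrl a ha
      rw [← Nat.sub_add_cancel (hM r hrl a ha), pow_succ, ← mul_assoc] at h4
      rw [eq_inv_of_mul_eq_one_left h4, eq_comm]
      exact inv_eq_of_mul_eq_one_right (hinv a)
  refine ⟨f, hf0, fun x hx a ha => ⟨_, cosetDest_lt hx, _, ?_,
    key (max x (cosetDest k t x a)) x a hx ha (le_max_left _ _) (le_max_right _ _)⟩⟩
  exact Nat.le_of_ble_eq_true (of_cond_eq_true (of_cond_eq_true (hcheck x hx a ha)).2).1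

theorem card_closure_le_of_checkCosets [Finite W]
    (hM : ∀ a ≤ l, ∀ b ≤ l, 0 < tableEntry M a b)
    (hrel : ∀ a ≤ l, ∀ b ≤ l, (s a * s b) ^ tableEntry M a b = 1) (hinv : ∀ a, s a * s a = 1)
    (hk : 0 < k) (h : checkCosets M l k t) :
    Nat.card (Subgroup.closure (s '' Set.Iio (l + 1))) ≤
      Nat.card (Subgroup.closure (s '' Set.Iio l)) * k := by
  obtain ⟨f, hf0, hf⟩ := exists_coset_representatives hM hrel hinv h
  let H := Subgroup.closure (s '' Set.Iio l)
  let F (p : H × Fin k) : W := p.1 * f p.2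
  have hmem : ∀ y ∈ Subgroup.closure (s '' Set.Iio (l + 1)), y ∈ Set.range F := by
    have hstep (y : W) (hy : y ∈ Set.range F) (a : ℕ) (ha : a ≤ l) : y * s a ∈ Set.range F := by
      obtain ⟨⟨g, x⟩, rfl⟩ := hy
      obtain ⟨y, hy, j, hj, he⟩ := hf x x.2 a ha
      have hjH : shiftedGenerator s j ∈ H := by
        cases j with
        | zero => exact one_mem H
        | succ j => exact Subgroup.subset_closure ⟨j, hj, rfl⟩
      refine ⟨⟨g * ⟨_, hjH⟩, y, hy⟩, ?_⟩
      simp only [F, Subgroup.coe_mul]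
      rw [mul_assoc, mul_assoc, he]
    intro y hy
    induction hy using Subgroup.closure_induction_right with
    | one => exact ⟨⟨1, 0, hk⟩, by simp [F, hf0]⟩
    | mul_right x hx y hy ih =>
      obtain ⟨a, ha, rfl⟩ := hy
      exact hstep x ih a (Nat.le_of_lt_succ ha)
    | mul_inv_cancel x hx y hy ih =>
      obtain ⟨a, ha, rfl⟩ := hy
      rw [inv_eq_of_mul_eq_one_right (hinv a)]
      exact hstep x ih a (Nat.le_of_lt_succ ha)
  calc Nat.card (Subgroup.closure (s '' Set.Iio (l + 1))) ≤ Nat.card (Set.range F) :=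
        Nat.card_mono (Set.toFinite _) hmem
    _ ≤ Nat.card (H × Fin k) := Finite.card_range_le F
    _ = _ := by rw [Nat.card_prod, Nat.card_fin]

end CosetTables

end

noncomputable section

section Tables

/-- Checks the tables of the cosets of the parabolic subgroups generated by `l`, `l + 1`, …
generators in the next ones. -/
def checkCosetChain (M : List (List ℕ)) (ts : List (ℕ × List (List ℕ))) : ℕ → Bool :=
  List.rec (fun _ => true) (fun p _ ih l =>
    cond (Nat.blt 0 p.1) (cond (checkCosets M l p.1 p.2) (ih (l + 1)) false) false) ts

theorem card_closure_le_of_checkCosetChain {W : Type*} [Group W] [Finite W] {s : ℕ → W}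
    {M : List (List ℕ)} {r : ℕ} (hM : ∀ a < r, ∀ b < r, 0 < tableEntry M a b)
    (hrel : ∀ a < r, ∀ b < r, (s a * s b) ^ tableEntry M a b = 1) (hinv : ∀ a, s a * s a = 1)
    {ts : List (ℕ × List (List ℕ))} {l : ℕ} (hr : l + ts.length = r)
    (h : checkCosetChain M ts l) :
    Nat.card (Subgroup.closure (s '' Set.Iio r)) ≤
      Nat.card (Subgroup.closure (s '' Set.Iio l)) * (ts.map Prod.fst).prod := by
  induction ts generalizing l with
  | nil => simp_all
  | cons p ts ih =>
    obtain ⟨h1, h⟩ := of_cond_eq_true h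
    obtain ⟨h2, h⟩ := of_cond_eq_true h
    rw [List.length_cons] at hr
    have hle (a : ℕ) (ha : a ≤ l) : a < r := by omega
    refine (ih (by omega) h).trans ?_
    rw [List.map_cons, List.prod_cons, ← mul_assoc]
    exact Nat.mul_le_mul_right _ <| card_closure_le_of_checkCosets
      (fun a ha b hb => hM a (hle a ha) b (hle b hb))
      (fun a ha b hb => hrel a (hle a ha) b (hle b hb)) hinv (blt_eq_true_iff.1 h1) h2

/-- A reduction of `-2 cos (π / m)` modulo 31 for `2 ≤ m ≤ 5`, and `-2` for `m = 1`. -/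
def cartanEntry (m : ℕ) : ZMod 31 := nthD [0, 29, 0, 30, 23, 12] 0 m

/-- The matrix modulo 31 of the reflection `i` for a Coxeter matrix. -/
def reflectionMatrix (L : List (List ℕ)) (i : ℕ) : Matrix (Fin 4) (Fin 4) (ZMod 31) :=
  Matrix.of fun a b =>
    (if a = b then 1 else 0) + if a.1 = i then cartanEntry (tableEntry L i b) else 0

/-- Checks that the generators `i` and `j` can be mapped to `ζ ^ nthD e 0 i` and `ζ ^ nthD e 0 j` by
a linear character if `ζ` has order `n`. -/
def CentralizerCharacter.isValid (n r : ℕ) (L : List (List ℕ)) : CentralizerCharacter → Bool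
  | .generated _ _ => true
  | .central e => Nat.ble e.length r &&
      decide (∀ i < r, ∀ j < r, n ∣ (nthD e 0 i + nthD e 0 j) * tableEntry L i j)

theorem nthD_of_length_le {α : Type} {l : List α} {j : ℕ} (d : α) (h : l.length ≤ j) :
    nthD l d j = d := by
  induction l generalizing j with
  | nil => rfl
  | cons a l ih =>
    obtain _ | j := j
    · simp at h
    · exact ih (Nat.le_of_succ_le_succ h)

theorem CoxeterSystem.hasRegularDecomposition_of_tables {W : Type*} [Group W] [Fintype W] {r : ℕ}
    {M : CoxeterMatrix (Fin r)} (cs : CoxeterSystem M W) {L : List (List ℕ)}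
    (hM : ∀ i j : Fin r, M i j = tableEntry L i j)
    (hL : ∀ i < r, ∀ j < r, 0 < tableEntry L i j ∧
      (reflectionMatrix L i * reflectionMatrix L j) ^ tableEntry L i j = 1)
    {ts : List (ℕ × List (List ℕ))} (hts : ts.length = r) (hchain : checkCosetChain L ts 0)
    {n one : ℕ} (hone : one = packMatrix 1) {gens : List (ℕ × ℕ)} (hlen : gens.length = r)
    (hgens : ∀ i < r, (nthD gens (one, 0) i).1 = packMatrix (reflectionMatrix L i))
    {plus minus : List ℕ} (hn : 0 < n)
    (hshift : ∀ ζ : ℂ, IsPrimitiveRoot ζ n →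
      (plus.map (ζ ^ ·)).sum - (minus.map (ζ ^ ·)).sum ≠ 0)
    {reps : List ClassDatum} (hlin : ∀ R ∈ reps, CentralizerCharacter.isValid n r L R.char)
    (hhead : ∀ R, reps[0]? = some R → R.word = [])
    {N : ℕ} (hN : (ts.map Prod.fst).prod = N)
    (hsum : (reps.map ClassDatum.size).sum = N) (h : checkDecomposition n N one gens reps plus minus) :
    HasRegularDecomposition W := by
  subst hN
  have hlift : M.IsLiftable fun i => reflectionMatrix L i := fun i j => by
    rw [hM]
    exact (hL i i.2 j j.2).2
  let ρ : W →* Matrix (Fin 4) (Fin 4) (ZMod 31) := cs.lift ⟨_, hlift⟩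
  have hρ (i : Fin r) : ρ (cs.simple i) = reflectionMatrix L i := cs.lift_apply_simple hlift i
  let s (j : ℕ) : W := if h : j < r then cs.simple ⟨j, h⟩ else 1
  have hs (i : Fin r) : s i = cs.simple i := dif_pos i.2
  have hs1 (j : ℕ) (hj : r ≤ j) : s j = 1 := dif_neg hj.not_gt
  have hinv (j : ℕ) : s j * s j = 1 := by
    rcases lt_or_ge j r with hj | hj
    · rw [hs ⟨j, hj⟩, cs.simple_mul_simple_self]
    · rw [hs1 j hj, mul_one]
  have hclosure : Subgroup.closure (s '' Set.Iio r) = ⊤ := by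
    rw [eq_top_iff, ← cs.subgroup_closure_range_simple, Subgroup.closure_le]
    rintro _ ⟨i, rfl⟩
    exact Subgroup.subset_closure ⟨i, i.2, hs i⟩
  have hcard : Fintype.card W ≤ (ts.map Prod.fst).prod := by
    have := card_closure_le_of_checkCosetChain (s := s) (fun a ha b hb => (hL a ha b hb).1)
      (fun a ha b hb => by
        rw [hs ⟨a, ha⟩, hs ⟨b, hb⟩, ← hM ⟨a, ha⟩ ⟨b, hb⟩, cs.simple_mul_simple_pow]) hinv
      ((Nat.zero_add _).trans hts) hchain
    rw [hclosure] at this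
    simpa [Nat.card_eq_fintype_card] using this
  have hζ := Complex.isPrimitiveRoot_exp n hn.ne'
  refine .of_checkDecomposition (c := fun x => packMatrix (ρ x)) (s := s)
    (fun x y => by rw [map_mul, packedMul_packMatrix]) (by rw [hone, map_one]) (fun j => ?_) hinv
    (top_unique (hclosure ▸ Subgroup.closure_mono (Set.image_subset_range _ _))) hcard hζ.pow_eq_one
    hn (hshift _ hζ) (fun R hR e he => ?_) hhead hsum h
  · rcases lt_or_ge j r with hj | hj
    · rw [hgens j hj, hs ⟨j, hj⟩, hρ]
    · rw [hs1 j hj, map_one, nthD_of_length_le _ (hlen.trans_le hj), hone]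
  · have hvalid := hlin R hR
    rw [he] at hvalid
    obtain ⟨he', hdvd⟩ := Bool.and_eq_true_iff.1 hvalid
    replace hdvd := of_decide_eq_true hdvd
    have hX : M.IsLiftable fun i => Complex.exp (2 * Real.pi * Complex.I / n) ^ nthD e 0 i :=
      fun i j => by
        rw [hM, ← pow_add, ← pow_mul, hζ.pow_eq_one_iff_dvd]
        exact hdvd i i.2 j j.2
    refine ⟨cs.lift ⟨_, hX⟩, fun j => ?_⟩
    rcases lt_or_ge j r with hj | hj
    · rw [hs ⟨j, hj⟩, cs.lift_apply_simple hX]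
    · rw [hs1 j hj, map_one, nthD_of_length_le _ ((Nat.le_of_ble_eq_true he').trans hj), pow_zero]

end Tables

end

noncomputable section

/-- The packed identity matrix. -/
def packedOne : ℕ :=
  2348542582773833227889480596789337029142529613686704200290588472275127542271320336124233829410181964604899329

/-- The Coxeter matrix of type `A4`. -/
def coxeterTableA4 : List (List ℕ) := [[1, 3, 2, 2], [3, 1, 3, 2], [2, 3, 1, 3], [2, 2, 3, 1]]

/-- Coset tables for the parabolic subgroups of type `A4`. -/
def cosetTablesA4 : List (ℕ × List (List ℕ)) :=
    [(2, [[1], [0]]), (3, [[3, 1], [2, 0], [1, 3]]), (4, [[4, 5, 1], [4, 2, 0], [3, 1, 5], [2, 4,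
    5]]), (5, [[5, 6, 7, 1], [5, 6, 2, 0], [5, 3, 1, 7], [4, 2, 6, 7], [3, 5, 6, 7]])]

/-- The Coxeter matrix of type `B4`. -/
def coxeterTableB4 : List (List ℕ) := [[1, 4, 2, 2], [4, 1, 3, 2], [2, 3, 1, 3], [2, 2, 3, 1]]

/-- Coset tables for the parabolic subgroups of type `B4`. -/
def cosetTablesB4 : List (ℕ × List (List ℕ)) :=
    [(2, [[1], [0]]), (4, [[4, 1], [2, 0], [1, 3], [4, 2]]), (6, [[6, 7, 1], [6, 2, 0], [3, 1, 7],
    [2, 4, 7], [6, 3, 5], [6, 7, 4]]), (8, [[8, 9, 10, 1], [8, 9, 2, 0], [8, 3, 1, 10], [4, 2, 9,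
    10], [3, 5, 9, 10], [8, 4, 6, 10], [8, 9, 5, 7], [8, 9, 10, 6]])]

/-- The Coxeter matrix of type `D4`. -/
def coxeterTableD4 : List (List ℕ) := [[1, 2, 3, 2], [2, 1, 3, 2], [3, 3, 1, 3], [2, 2, 3, 1]]

/-- Coset tables for the parabolic subgroups of type `D4`. -/
def cosetTablesD4 : List (ℕ × List (List ℕ)) :=
    [(2, [[1], [0]]), (2, [[2, 1], [2, 0]]), (6, [[6, 7, 1], [2, 3, 0], [1, 4, 6], [4, 1, 7], [3, 2,
    5], [7, 6, 4]]), (8, [[8, 9, 10, 1], [8, 9, 2, 0], [3, 4, 1, 10], [2, 5, 8, 10], [5, 2, 9, 10],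
    [4, 3, 6, 10], [9, 8, 5, 7], [9, 8, 10, 6]])]

/-- The Coxeter matrix of type `F4`. -/
def coxeterTableF4 : List (List ℕ) := [[1, 3, 2, 2], [3, 1, 4, 2], [2, 4, 1, 3], [2, 2, 3, 1]]

/-- Coset tables for the parabolic subgroups of type `F4`. -/
def cosetTablesF4 : List (ℕ × List (List ℕ)) :=
    [(2, [[1], [0]]), (3, [[3, 1], [2, 0], [1, 3]]), (8, [[8, 9, 1], [8, 2, 0], [3, 1, 4], [2, 8,
    5], [5, 9, 2], [4, 6, 3], [9, 5, 7], [9, 8, 6]]), (24, [[24, 25, 26, 1], [24, 25, 2, 0], [24, 3,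
    1, 26], [4, 2, 5, 26], [3, 24, 6, 26], [6, 25, 3, 7], [5, 8, 4, 9], [9, 25, 26, 5], [25, 6, 10,
    11], [7, 11, 26, 6], [25, 24, 8, 12], [25, 9, 13, 8], [25, 24, 14, 10], [25, 15, 11, 14], [25,
    16, 12, 13], [17, 13, 26, 16], [18, 14, 19, 15], [15, 25, 26, 18], [16, 25, 20, 17], [20, 24,
    16, 26], [19, 21, 18, 26], [24, 20, 22, 26], [24, 25, 21, 23], [24, 25, 26, 22]])]

/-- The Coxeter matrix of type `H4`. -/
def coxeterTableH4 : List (List ℕ) := [[1, 5, 2, 2], [5, 1, 3, 2], [2, 3, 1, 3], [2, 2, 3, 1]]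

/-- Coset tables for the parabolic subgroups of type `H4`. -/
def cosetTablesH4 : List (ℕ × List (List ℕ)) :=
    [(2, [[1], [0]]), (5, [[5, 1], [2, 0], [1, 3], [4, 2], [3, 5]]), (12, [[12, 13, 1], [12, 2, 0],
    [3, 1, 13], [2, 4, 13], [5, 3, 6], [4, 12, 7], [7, 13, 4], [6, 8, 5], [9, 7, 12], [8, 10, 12],
    [13, 9, 11], [13, 12, 10]]), (120, [[120, 121, 122, 1], [120, 121, 2, 0], [120, 3, 1, 122], [4,
    2, 121, 122], [3, 5, 121, 122], [6, 4, 7, 122], [5, 120, 8, 122], [8, 121, 5, 9], [7, 10, 6,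
    11], [11, 121, 122, 7], [12, 8, 120, 13], [9, 13, 122, 8], [10, 14, 120, 15], [15, 11, 16, 10],
    [121, 12, 17, 18], [13, 18, 19, 12], [19, 122, 13, 120], [121, 120, 14, 20], [121, 15, 21, 14],
    [16, 22, 15, 120], [121, 120, 23, 17], [121, 24, 18, 23], [25, 19, 24, 120], [121, 26, 20, 21],
    [27, 21, 22, 26], [22, 28, 27, 120], [29, 23, 120, 24], [24, 30, 25, 29], [122, 25, 31, 120],
    [26, 32, 120, 27], [33, 27, 34, 32], [122, 34, 28, 35], [36, 29, 37, 30], [30, 121, 38, 36],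
    [38, 31, 30, 39], [122, 39, 120, 31], [32, 121, 40, 33], [40, 120, 32, 41], [34, 42, 33, 43],
    [43, 35, 41, 34], [37, 44, 36, 45], [45, 120, 39, 37], [46, 38, 121, 47], [39, 47, 45, 38], [48,
    40, 121, 49], [41, 49, 43, 40], [42, 122, 121, 50], [50, 43, 51, 42], [44, 52, 121, 53], [53,
    45, 54, 44], [47, 122, 55, 46], [55, 54, 47, 121], [120, 48, 56, 57], [49, 57, 58, 48], [58, 51,
    49, 121], [51, 59, 50, 121], [120, 121, 52, 60], [120, 53, 61, 52], [54, 62, 53, 121], [63, 55,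
    122, 121], [120, 121, 64, 56], [120, 65, 57, 64], [66, 58, 65, 121], [59, 67, 122, 121], [120,
    68, 60, 61], [69, 61, 62, 68], [62, 70, 69, 121], [70, 63, 71, 121], [72, 64, 121, 65], [65, 73,
    66, 72], [67, 66, 74, 121], [74, 122, 67, 75], [68, 76, 121, 69], [77, 69, 78, 76], [71, 78, 70,
    79], [79, 122, 121, 71], [80, 72, 81, 73], [73, 120, 82, 80], [82, 74, 73, 83], [75, 83, 121,
    74], [76, 120, 84, 77], [84, 121, 76, 85], [78, 86, 77, 87], [87, 79, 85, 78], [81, 88, 80, 89],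
    [89, 121, 83, 81], [122, 82, 120, 90], [83, 90, 89, 82], [91, 84, 120, 92], [85, 92, 87, 84],
    [122, 87, 93, 86], [88, 94, 120, 95], [95, 89, 96, 88], [122, 96, 90, 120], [121, 91, 97, 98],
    [92, 98, 99, 91], [99, 93, 92, 120], [121, 120, 94, 100], [121, 95, 101, 94], [96, 102, 95,
    120], [121, 120, 103, 97], [121, 104, 98, 103], [105, 99, 104, 120], [121, 106, 100, 101], [107,
    101, 102, 106], [102, 122, 107, 120], [108, 103, 120, 104], [104, 109, 105, 108], [106, 110,
    120, 107], [111, 107, 122, 110], [112, 108, 113, 109], [109, 121, 122, 112], [110, 121, 114,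
    111], [114, 120, 110, 122], [113, 115, 112, 122], [116, 114, 121, 122], [115, 117, 121, 122],
    [120, 116, 118, 122], [120, 121, 117, 119], [120, 121, 122, 118]])]

end

noncomputable section

/-- The packed simple reflections in type `A3`, with a second component that is not used. -/
def generatorsA3 : List (ℕ × ℕ) :=
  [(2348542582773833227889480596789337029142529613686704200290588472275127542271320336124233829410181965108215838, 0),
    (2348542582773833227889480596789337029142529613686704200290588472944149936774853284977741119730165364232814593, 0),
    (2348542582773833227889480597678620325723686032481624979788540063673708493613442444193079876590872267054907393, 0)]

/-- The conjugacy classes in type `A3` with linear characters of the centralizers. -/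
def repsA3 : List ClassDatum :=
  [⟨[], 1, 0, .central [0, 0, 0]⟩,
    ⟨[0], 6, 1130, .generated [([2], 6), ([0], 6)] 7⟩,
    ⟨[0, 1], 8, 861, .generated [([0, 1], 4)] 3⟩,
    ⟨[0, 2], 3, 10, .generated [([0, 1, 0, 2, 1], 6), ([2], 0)] 823⟩,
    ⟨[0, 1, 2], 6, 143, .generated [([0, 1, 2], 3)] 7⟩]

set_option maxRecDepth 100000 in
theorem checkA3 : checkDecomposition 12 24 packedOne generatorsA3 repsA3 [0, 10] [6, 4] = true := by
  decide +kernel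

/-- The packed simple reflections in type `B3`, with a second component that is not used. -/
def generatorsB3 : List (ℕ × ℕ) :=
  [(2348542582773833227889480596789337029142529613686704200290588472275127542271320336124233829410181964990775326, 0),
    (2348542582773833227889480596789337029142529613686704200290588472944149936774852730380603519879802209425162241, 0),
    (2348542582773833227889480597678620325723686032481624979788540063673708493613442444193079876590872267054907393, 0)]

/-- The conjugacy classes in type `B3` with linear characters of the centralizers. -/
def repsB3 : List ClassDatum :=
  [⟨[], 1, 0, .central [6, 0, 0]⟩,
    ⟨[0], 3, 34, .generated [([0, 1, 0, 1, 2, 1, 0, 1], 0), ([0, 1, 0, 1], 6), ([2, 1, 0, 1, 2],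
    6)] 336534623⟩,
    ⟨[1], 6, 1053, .generated [([2, 1, 0, 1, 2], 0), ([0, 1, 0], 6), ([0, 1, 0, 1, 2, 1, 0, 1, 2],
    0)] 2143⟩,
    ⟨[0, 1], 6, 285, .generated [([0, 1, 2, 1, 0, 1, 2], 3), ([0, 1, 0, 1, 2, 1, 0, 1, 2], 6)]
    471⟩,
    ⟨[0, 2], 6, 8298, .generated [([2], 0), ([0], 0), ([0, 1, 0, 1, 2, 1, 0, 1], 0)] 2143⟩,
    ⟨[1, 2], 8, 6795, .generated [([0, 1, 0, 2, 1, 0, 1], 2)] 31⟩,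
    ⟨[0, 1, 2], 8, 8847, .generated [([0, 1, 2], 2)] 31⟩,
    ⟨[0, 1, 0, 1], 3, 20, .generated [([0, 1, 0, 1, 2, 1, 0, 1, 2], 0), ([0, 1, 0, 2, 1, 0, 1,
    2], 6), ([1, 0, 1], 6)] 8771423⟩,
    ⟨[0, 1, 0, 1, 2], 6, 790, .generated [([0, 2, 1, 0, 1], 3), ([0], 6)] 471⟩,
    ⟨[0, 1, 0, 1, 2, 1, 0, 1, 2], 1, 0, .central [6, 6, 6]⟩]

set_option maxRecDepth 100000 in
theorem checkB3 : checkDecomposition 12 48 packedOne generatorsB3 repsB3 [0, 10] [6, 4] = true := by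
  decide +kernel

/-- The packed simple reflections in type `H3`, with a second component that is not used. -/
def generatorsH3 : List (ℕ × ℕ) :=
  [(2348542582773833227889480596789337029142529613686704200290588472275127542271320336124233829410181964806225950, 0),
    (2348542582773833227889480596789337029142529613686704200290588472944149936774851858870815862972088680441708545, 0),
    (2348542582773833227889480597678620325723686032481624979788540063673708493613442444193079876590872267054907393, 0)]

/-- The conjugacy classes in type `H3` with linear characters of the centralizers. -/
def repsH3 : List ClassDatum :=
  [⟨[], 1, 0, .central [0, 0, 0]⟩,
    ⟨[0], 15, 137710916714, .generated [([0, 2], 0), ([1, 0, 1, 0, 2, 1, 0, 1, 0, 2, 1, 0, 1, 2],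
    15), ([0], 0)] 2143⟩,
    ⟨[0, 1], 12, 435037, .generated [([1, 0, 1, 2, 1, 0, 1, 0, 2, 1, 0, 1, 2], 6)] 511⟩,
    ⟨[0, 2], 15, 137710916714, .generated [([0, 1, 0, 1, 0, 2, 1, 0, 1, 0, 2, 1, 0, 1, 2], 0), ([0,
    1, 0, 1, 0, 2, 1, 0, 1, 0, 2, 1, 0, 1], 0), ([0, 2], 15)] 2143⟩,
    ⟨[1, 2], 20, 14449818251, .generated [([0, 1, 0, 1, 0, 2, 1, 0, 1, 0, 2, 1, 0], 10)] 31⟩,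
    ⟨[0, 1, 2], 12, 3236495, .generated [([1, 2, 1, 0, 1, 0, 2, 1, 0], 3)] 511⟩,
    ⟨[0, 1, 0, 1], 12, 435037, .generated [([0, 1, 0, 2, 1, 0, 1, 0, 2, 1, 0, 1, 2], 9)] 511⟩,
    ⟨[0, 1, 0, 1, 2], 20, 2343245663, .generated [([2, 1, 0, 1, 0], 5)] 31⟩,
    ⟨[0, 1, 0, 1, 2, 1, 0, 1, 2], 12, 3236495, .generated [([2, 1, 0], 6)] 511⟩,
    ⟨[0, 1, 0, 1, 0, 2, 1, 0, 1, 0, 2, 1, 0, 1, 2], 1, 0, .central [15, 15, 15]⟩]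

set_option maxRecDepth 100000 in
theorem checkH3 : checkDecomposition 30 120 packedOne generatorsH3 repsH3 [0, 25, 21, 16] [15, 10, 6, 1] = true := by
  decide +kernel

/-- The packed simple reflections in type `A4`, with a second component that is not used. -/
def generatorsA4 : List (ℕ × ℕ) :=
  [(2348542582773833227889480596789337029142529613686704200290588472275127542271320336124233829410181965108215838, 0),
    (2348542582773833227889480596789337029142529613686704200290588472944149936774853284977741119730165364232814593, 0),
    (2348542582773833227889480597678620325723686032481624979788540063673708493613442444193079876590872267054907393, 0),
    (70456281682736388420067312698884386888870345010113287765769904584188753577704723659373277371713774236794355713, 0)]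

/-- The conjugacy classes in type `A4` with linear characters of the centralizers. -/
def repsA4 : List ClassDatum :=
  [⟨[], 1, 0, .central [0, 0, 0, 0]⟩,
    ⟨[0], 10, 12720466, .generated [([3], 0), ([0, 2, 3], 30)] 2047⟩,
    ⟨[0, 1], 20, 1161093294150581, .generated [([0, 1, 3], 20)] 31⟩,
    ⟨[0, 2], 15, 2218480234, .generated [([1, 0, 2, 1], 0), ([1, 0, 2, 1, 0], 30)] 127⟩,
    ⟨[0, 1, 2], 30, 18637053267185597311, .generated [([2, 1, 0], 15)] 7⟩,
    ⟨[0, 1, 3], 20, 1161093294150581, .generated [([1, 0, 3], 10)] 31⟩,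
    ⟨[0, 1, 2, 3], 24, 2223011748223, .generated [([0, 1, 2, 3], 12)] 15⟩]

set_option maxRecDepth 100000 in
theorem checkA4 : checkDecomposition 60 120 packedOne generatorsA4 repsA4 [0, 50, 42, 32] [30, 20, 12, 2] = true := by
  decide +kernel

/-- The packed simple reflections in type `B4`, with a second component that is not used. -/
def generatorsB4 : List (ℕ × ℕ) :=
  [(2348542582773833227889480596789337029142529613686704200290588472275127542271320336124233829410181964990775326, 0),
    (2348542582773833227889480596789337029142529613686704200290588472944149936774852730380603519879802209425162241, 0),
    (2348542582773833227889480597678620325723686032481624979788540063673708493613442444193079876590872267054907393, 0),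
    (70456281682736388420067312698884386888870345010113287765769904584188753577704723659373277371713774236794355713, 0)]

/-- The conjugacy classes in type `B4` with linear characters of the centralizers. -/
def repsB4 : List ClassDatum :=
  [⟨[], 1, 0, .central [0, 12, 12, 12]⟩,
    ⟨[0], 4, 2114, .generated [([2, 1, 0, 1, 2, 3, 2], 0), ([0, 2, 1, 0, 1, 3], 12), ([2, 1, 0, 1,
    2, 3, 2, 1, 0, 1, 2], 0)] 53478912040704653632554149989076063051122903534741158735711433695⟩,
    ⟨[1], 12, 203441077, .generated [([0, 1, 0, 3, 2, 1, 0, 1, 2, 3], 0), ([0, 1, 0, 1, 3], 0),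
    ([0, 1, 0, 3], 0), ([0, 1, 0, 2, 1, 0, 1, 2, 3], 0)] 9802234541741670399⟩,
    ⟨[0, 1], 12, 138953653, .generated [([1, 0, 2, 1, 0, 1, 2], 6), ([1, 0, 2, 1, 0, 1, 2, 3], 18),
    ([0, 1, 0, 1, 3, 2, 1, 0, 1, 2, 3], 12)] 437847123163103⟩,
    ⟨[0, 2], 24, 2360565984603554410, .generated [([1, 0, 1, 2, 1, 0, 1, 2], 0), ([2, 3, 2, 1, 0, 1,
    2, 3], 0), ([0, 2, 3, 2, 1, 0, 1, 2, 3], 0), ([1, 0, 1, 2, 1, 0, 1, 2, 3, 2, 1, 0, 1, 2, 3],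
    12)] 140612479⟩,
    ⟨[1, 2], 32, 83155509795987929979, .generated [([0, 1, 0, 1, 2, 1, 0], 4), ([0, 1, 0, 1, 2, 1,
    0, 1, 2, 3, 2, 1, 0, 1, 2, 3], 0)] 30167⟩,
    ⟨[1, 3], 12, 270344501, .generated [([1, 2, 1, 3, 2], 0), ([1, 2, 1, 3, 2, 1], 12), ([0, 1, 0,
    1, 3], 12)] 577997621866911583⟩,
    ⟨[0, 1, 2], 32, 152771171886427110271, .generated [([2, 1, 0], 8), ([1, 0, 2, 1, 0, 1, 3, 2, 1,
    0, 1, 2, 3], 16)] 2047⟩,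
    ⟨[0, 1, 3], 24, 4534549586990005, .generated [([0, 1, 0, 1, 3], 0), ([0, 1], 12), ([0, 1, 2, 1,
    0, 1, 2, 3, 2, 1, 0, 1, 2], 0)] 9574399⟩,
    ⟨[0, 2, 3], 32, 1089233468681343972646, .generated [([0, 3, 2], 4), ([0, 1, 0, 1, 2, 1, 0, 1, 3,
    2, 1, 0, 1, 2], 20)] 2047⟩,
    ⟨[1, 2, 3], 48, 21778071482940092377721199183524365210943, .generated [([0, 1, 0, 2, 1, 0, 1, 3, 2,
    1, 0, 1, 2], 6), ([1, 2, 3], 6)] 127⟩,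
    ⟨[0, 1, 0, 1], 6, 17060, .generated [([2, 1, 0, 1, 2, 3, 2, 1, 0, 1, 2], 0), ([1, 0, 3, 2, 1,
    0, 1, 2], 0), ([0, 1, 0, 1, 3, 2, 1, 0, 1, 2], 0), ([0, 1, 0, 2, 1, 0, 1, 2, 3, 2, 1, 0, 1, 2],
    12)] 1462036862021315063003129330184609240979307446143⟩,
    ⟨[0, 1, 2, 3], 48, 41198654600658869889484975200639, .generated [([0, 1, 0, 1, 2, 1, 0, 1, 2, 3,
    2, 1], 3)] 127⟩,
    ⟨[0, 1, 0, 1, 2], 24, 11272423336995438, .generated [([1, 0, 1, 2, 3, 2, 1, 0, 1, 2, 3], 6),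
    ([0, 2, 1, 0, 1], 6), ([0, 1, 0, 1, 2, 1, 0, 1, 2], 0)] 34360835807⟩,
    ⟨[0, 1, 0, 1, 3], 12, 17884598948, .generated [([0, 1], 0), ([0, 1, 0, 3], 0), ([1, 0, 1, 2, 1,
    0, 1, 2, 3, 2, 1, 0, 1, 2, 3], 12), ([3], 0)] 38378469096668039336831⟩,
    ⟨[0, 1, 0, 1, 2, 3], 32, 20426010795783322200576256622, .generated [([0, 2, 1, 0, 1, 3, 2, 1, 0,
    1, 2], 4), ([1, 0, 1, 2, 1, 0, 1, 2, 3, 2, 1, 0, 1, 2, 3], 0)] 30167⟩,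
    ⟨[0, 1, 0, 1, 2, 1, 3, 2], 12, 112023, .generated [([0, 1, 0, 1, 2, 1, 0, 1, 2, 3, 2, 1], 6),
    ([1, 0, 1, 2, 3, 2], 18)] 47367169020492671⟩,
    ⟨[0, 1, 0, 1, 2, 1, 0, 1, 2], 4, 584, .generated [([1, 0], 0), ([1, 0, 2, 3, 2, 1, 0, 1, 2,
    3], 12), ([0, 1, 3, 2, 1, 0, 1, 2, 3], 12)]
    6427752177060806731837124294027913024107882418455837226760191⟩,
    ⟨[0, 1, 0, 1, 2, 1, 0, 1, 2, 3], 12, 281176652, .generated [([0, 3, 2, 1, 0, 1, 2], 0), ([0,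
    1, 3, 2, 1, 0, 1, 2], 0), ([0, 1], 12)] 2693224635075328456703⟩,
    ⟨[0, 1, 0, 1, 2, 1, 0, 1, 2, 3, 2, 1, 0, 1, 2, 3], 1, 0, .central [12, 12, 12, 12]⟩]

set_option maxRecDepth 100000 in
theorem checkB4 : checkDecomposition 24 384 packedOne generatorsB4 repsB4 [0, 20] [12, 8] = true := by
  decide +kernel

/-- The packed simple reflections in type `D4`, with a second component that is not used. -/
def generatorsD4 : List (ℕ × ℕ) :=
  [(2348542582773833227889480596789337029142529613686704200290588472275127542271320336124233829418626213906219038, 0),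
    (2348542582773833227889480596789337029142529613686704200290588472944149936774850908132865691800037557914304513, 0),
    (2348542582773833227889480597678620325723686032481813292840601664096623567296138674185562947254206188090294273, 0),
    (70456281682736388420067312698884386888870345010113287765769904584188753577704723659373277371713774236794355713, 0)]

/-- The conjugacy classes in type `D4` with linear characters of the centralizers. -/
def repsD4 : List ClassDatum :=
  [⟨[], 1, 0, .central [0, 0, 0, 0]⟩,
    ⟨[0], 12, 17255388084, .generated [([1, 3], 0), ([0, 2, 0, 1, 2, 3, 2, 0, 1, 2], 6), ([0, 3],
    0), ([1, 2, 0, 1, 2, 3, 2, 0, 1, 2, 3], 6)] 140612479⟩,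
    ⟨[0, 1], 6, 16788, .generated [([0, 1, 2, 0, 1, 2, 3], 0), ([1, 3, 2, 0, 1, 2, 3], 6), ([0, 2,
    0, 1, 2, 3], 0)] 2693224635860109031423⟩,
    ⟨[0, 2], 32, 302240752720605084990331, .generated [([1, 2, 0, 1, 3, 2, 0, 1, 2, 3], 4)] 31⟩,
    ⟨[0, 3], 6, 16692, .generated [([2, 0, 3, 2], 0), ([0, 1, 2, 0, 1, 2, 3, 2, 0, 1, 2], 0), ([0,
    1, 2, 0, 3, 2], 6)] 9291184102299647⟩,
    ⟨[1, 3], 6, 16692, .generated [([0, 2, 1, 3, 2, 0], 6), ([2, 1, 3, 2, 0, 1], 0), ([0, 1, 2, 0,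
    1, 2, 3, 2, 0, 1, 2], 0)] 149146759950366687⟩,
    ⟨[0, 1, 2], 24, 444239125174655, .generated [([3, 2, 0, 1, 2, 3], 0), ([0, 1, 2, 3, 2, 0, 1, 2,
    3], 3)] 127⟩,
    ⟨[0, 1, 3], 12, 17255388084, .generated [([1, 2, 0, 1, 2, 3, 2, 0, 1, 2], 0), ([2, 0, 1, 2, 3,
    2, 0, 1, 2, 3], 0), ([0, 2, 0, 1, 2, 3, 2, 0, 1, 2, 3], 0), ([1, 2, 0, 1, 2, 3, 2, 0, 1, 2, 3],
    6)] 140612479⟩,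
    ⟨[0, 2, 3], 24, 1129557944251711, .generated [([1, 2, 0, 1, 3, 2, 0, 1, 2], 0), ([0, 1, 2, 0, 3,
    2, 0, 1], 6)] 471⟩,
    ⟨[1, 2, 3], 24, 1147100196115775, .generated [([0, 1, 2, 1, 3, 2, 0, 1], 0), ([3, 2, 1], 3)]
    127⟩,
    ⟨[0, 1, 2, 3], 32, 604462964197215542921343, .generated [([3, 2, 0, 1], 4)] 31⟩,
    ⟨[0, 1, 2, 0, 3, 2], 12, 1073821079, .generated [([1, 2, 0, 1, 2, 3], 6), ([2, 1, 3, 2, 0, 1],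
    6), ([0, 1, 2, 0, 3, 2], 6)] 9574399⟩,
    ⟨[0, 1, 2, 0, 1, 2, 3, 2, 0, 1, 2, 3], 1, 0, .central [6, 6, 6, 6]⟩]

set_option maxRecDepth 100000 in
theorem checkD4 : checkDecomposition 12 192 packedOne generatorsD4 repsD4 [0, 10] [6, 4] = true := by
  decide +kernel

/-- The packed simple reflections in type `F4`, with a second component that is not used. -/
def generatorsF4 : List (ℕ × ℕ) :=
  [(2348542582773833227889480596789337029142529613686704200290588472275127542271320336124233829410181965108215838, 0),
    (2348542582773833227889480596789337029142529613686704200290588472788044720385138922986991091821626833690951681, 0),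
    (2348542582773833227889480597678620325723685295295583299888233178247514707920416211927412072747093486878064641, 0),
    (70456281682736388420067312698884386888870345010113287765769904584188753577704723659373277371713774236794355713, 0)]

/-- The conjugacy classes in type `F4` with linear characters of the centralizers. -/
def repsF4 : List ClassDatum :=
  [⟨[], 1, 0, .central [0, 0, 0, 0]⟩,
    ⟨[0], 12, 19151698, .generated [([3, 2, 1, 0, 2, 1, 2, 3, 2, 1, 0, 2, 1, 2, 3], 12), ([0, 2,
    1, 0, 3, 2, 1, 0, 2, 1], 12), ([0, 3, 2, 1, 0, 2, 1, 2, 3, 2, 1, 0, 2, 1], 0)]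
    414701446571527365445318226945417706325551430526027327103498239⟩,
    ⟨[2], 12, 551972589674, .generated [([0, 1, 2, 1, 0], 0), ([2, 3, 2, 1, 0, 2, 3], 12), ([1, 2,
    1, 0, 2, 3, 2, 1, 0, 2, 3], 0)] 13663626910367262210066771480755286015542963797424127⟩,
    ⟨[0, 1], 32, 1360633667767052436984757, .generated [([1, 0, 3, 2, 1, 0, 2, 1, 2, 3, 2, 1, 0, 2,
    1, 2, 3], 4), ([0, 2, 1, 0, 2, 1, 2, 3], 16)] 1124800663451647⟩,
    ⟨[0, 2], 72, 803469022169425258291621571884794991340659939491073394168426, .generated [([0, 1, 0, 2, 1,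
    0, 2, 1, 3, 2, 1, 0, 2, 1, 2, 3, 2, 1, 0, 2, 1, 2, 3], 0), ([1, 0, 2, 1, 0, 2, 1], 0), ([2],
    0), ([1, 0, 2, 1, 0, 2, 1, 3, 2, 1, 0, 2, 1, 2, 3, 2, 1, 0, 2, 1, 2, 3], 12)] 140612479⟩,
    ⟨[1, 2], 36, 316922327710447908336263633275, .generated [([0, 1, 2, 1, 0, 2, 1], 6), ([3, 2, 1, 2,
    3], 0), ([0, 1, 0, 2, 1, 0, 2, 1, 2], 12)] 2305902208251975519⟩,
    ⟨[2, 3], 32, 2444221059643674440998, .generated [([1, 2, 1, 2, 3, 2, 1, 2, 3], 0), ([0, 1, 2, 1,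
    3, 2, 1, 2], 8)] 2249601326901247⟩,
    ⟨[0, 1, 2], 96, 3885337794208429345311356677689199364741184036985162244540942436134573790346417896319,
    .generated [([0, 1, 0, 2, 1, 0, 2, 1, 2, 3, 2, 1, 0, 2, 1, 2, 3, 2, 1, 0, 2, 1, 2, 3], 0), ([2,
    1, 0], 8)] 2047⟩,
    ⟨[0, 1, 3], 96,
    68351585149469124533807232683923542535929455844196798190048462356381165092587896811370334624895925,
    .generated [([1, 0, 3], 4), ([0, 2, 1, 0, 2, 1, 2, 3, 2, 1, 0, 2, 1, 2, 3, 2, 1, 0, 2, 1, 2],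
    16)] 2047⟩,
    ⟨[0, 2, 3], 96,
    143343663499379469475676305956387614480646914730540752721634528879503637838714245307410612299885155169574,
    .generated [([1, 0, 2, 1, 0, 2, 1, 2, 3, 2, 1, 0, 2, 1, 2, 3, 2, 1, 0, 2, 1], 8), ([0, 1, 0, 2,
    1, 0, 2, 1, 3, 2, 1, 0, 2, 1, 2, 3, 2, 1, 0, 2, 1, 2], 16)] 2047⟩,
    ⟨[1, 2, 3], 96,
    1146749307995035755805896114874099902720775574482546412996141622208546043808596915389911506135367047001407,
    .generated [([0, 1, 2, 1, 0, 3, 2, 1, 0, 2, 1, 2, 3, 2, 1, 0, 2, 1], 4), ([1, 2, 1, 2, 3, 2, 1,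
    2, 3], 0)] 30167⟩,
    ⟨[0, 1, 2, 3], 96, 3719820866762262751315793850028526094604784865120018248086680575708093685651839,
    .generated [([1, 2, 1, 0, 2, 1, 3, 2, 1, 0, 2, 1, 2, 3, 2, 1, 0, 2, 1, 2], 4)] 2047⟩,
    ⟨[1, 2, 1, 2], 18, 37191290359914841, .generated [([1, 2, 1, 3, 2, 1, 0, 2, 1, 3, 2, 1, 0], 0),
    ([0, 1, 0, 2, 1, 0], 0), ([2, 1], 0), ([0, 1, 2, 1, 0, 2, 1, 2, 3, 2, 1, 0, 2, 1, 2, 3, 2, 1,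
    0, 2, 1, 2, 3], 12)] 5708992190513998641875235939819731307289984895⟩,
    ⟨[0, 1, 2, 1, 2], 72, 196159458462189407664356603874668339662541498971705791355, .generated [([3, 2, 1,
    0, 2, 1, 2, 3, 2, 1, 0, 2, 1, 2, 3], 0), ([0, 1, 2, 1, 3, 2, 1, 0, 2, 1, 2, 3, 2, 1, 0, 2, 1,
    2, 3], 12), ([1, 2, 1, 0, 2, 3, 2, 1, 0, 2, 1, 2, 3, 2, 1, 0, 2, 1, 2, 3], 0)] 9574399⟩,
    ⟨[1, 2, 1, 2, 3], 72, 1725436593125393123900496175053916563661569828829556156056984759646557, .generated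
    [([2, 1, 2, 3], 0), ([0, 1, 2, 1, 0, 3, 2, 1, 0, 2, 1, 3, 2, 1, 0], 0), ([0, 1, 0, 2, 1, 0, 2,
    1, 2, 3, 2, 1, 0, 2, 1, 2, 3, 2, 1, 0, 2, 1, 2, 3], 12)] 37067359⟩,
    ⟨[0, 1, 2, 1, 2, 3], 144,
    75154566171444096158468199482619840063290112341529712792385010435932691259051207241515797435634463783725005695,
    .generated [([1, 3, 2, 1, 0, 2], 3)] 127⟩,
    ⟨[0, 1, 0, 2, 1, 2, 3, 2], 16, 17725217151, .generated [([2, 1, 0, 2, 1, 3, 2, 1, 0, 2, 1, 2,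
    3, 2, 1, 0], 0), ([0, 1, 2, 3, 2, 1, 0, 2], 8)] 90329481584778022474526221055948767⟩,
    ⟨[0, 1, 0, 2, 1, 0, 2, 1, 2], 12, 19362566728, .generated [([0, 2, 1, 0, 3, 2, 1, 0, 2, 1, 2,
    3, 2, 1, 0, 2, 1, 2, 3], 12), ([1, 0, 2], 0), ([0, 1, 2, 3, 2, 1, 0, 2, 1, 2, 3, 2, 1, 0, 2, 1,
    2, 3], 0)] 6283234716494548030488952368657930027761160780580820746239⟩,
    ⟨[1, 2, 1, 2, 3, 2, 1, 2, 3], 12, 549811561505, .generated [([0, 1, 2, 1, 0, 3, 2, 1, 0, 2, 1,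
    2, 3, 2, 1, 0, 2], 12), ([1, 2, 1, 2, 3, 2, 1, 2], 0), ([1, 3, 2, 1, 2], 12)]
    3531684193340353583255715529177573630589650860081783216127⟩,
    ⟨[0, 1, 0, 2, 1, 0, 2, 1, 2, 3], 32, 48528921739872332364, .generated [([1, 0, 2, 1, 0, 2, 1, 2,
    3], 4), ([0, 1, 0, 2, 1, 0, 2, 1, 2, 3, 2, 1, 0, 2, 1, 2, 3], 20)] 8724822321151⟩,
    ⟨[0, 1, 2, 1, 2, 3, 2, 1, 2, 3], 32, 6050971574210181544787, .generated [([0, 1, 2, 1, 3, 2, 1,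
    2], 8), ([3], 0)] 3832744848619383⟩,
    ⟨[0, 1, 0, 2, 1, 0, 2, 3, 2, 1, 2, 3], 12, 8526203, .generated [([1, 2, 1, 0, 2, 1, 3, 2, 1,
    0, 2, 1, 2, 3, 2, 1, 0, 2, 1, 2], 12), ([0, 1, 0, 2, 1, 0, 2, 1, 2, 3, 2, 1, 0, 2, 1, 2, 3, 2],
    6)] 6761009336520174268457013692180307453589995015077887⟩,
    ⟨[0, 1, 0, 2, 1, 0, 2, 1, 2, 3, 2, 1, 2, 3], 36, 4841674814288309310280537, .generated [([1, 2,
    1, 3, 2, 1, 0, 2, 1, 3, 2, 1, 0], 6), ([1, 2], 0), ([1, 2, 3, 2, 1, 0, 2, 1, 3, 2, 1, 0], 6)]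
    148638871171610623⟩,
    ⟨[0, 1, 0, 2, 1, 0, 2, 3, 2, 1, 0, 2, 1, 2, 3, 2], 16, 17725217151, .generated [([0, 2, 1, 0,
    2, 1, 2, 3, 2, 1, 0, 2], 8), ([1, 0, 2, 1, 0, 2, 1, 2, 3, 2, 1, 0, 2, 1, 3, 2], 8)]
    3626197633954513529149623458087955199999⟩,
    ⟨[0, 1, 0, 2, 1, 0, 2, 1, 2, 3, 2, 1, 0, 2, 1, 2, 3, 2, 1, 0, 2, 1, 2, 3], 1, 0, .central [0,
    0, 12, 12]⟩]

set_option maxRecDepth 100000 in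
theorem checkF4 : checkDecomposition 24 1152 packedOne generatorsF4 repsF4 [0, 20] [12, 8] = true := by
  decide +kernel

end

noncomputable section

/-- The packed simple reflections in type `H4`, with a second component that is not used. -/
def generatorsH4 : List (ℕ × ℕ) :=
  [(2348542582773833227889480596789337029142529613686704200290588472275127542271320336124233829410181964806225950, 0),
    (2348542582773833227889480596789337029142529613686704200290588472944149936774851858870815862972088680441708545, 0),
    (2348542582773833227889480597678620325723686032481624979788540063673708493613442444193079876590872267054907393, 0),
    (70456281682736388420067312698884386888870345010113287765769904584188753577704723659373277371713774236794355713, 0)]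

/-- The conjugacy classes in type `H4` with linear characters of the centralizers. -/
def repsH4 : List ClassDatum :=
  [⟨[], 1, 0, .central [0, 0, 0, 0]⟩,
    ⟨[0], 60, 6428307036202726042214146699605299532092919218193757505722706, .generated [([2, 1, 0, 1, 0,
    3, 2, 1, 0, 1, 0, 2, 1, 0, 1, 3, 2], 0), ([0, 1, 0, 1, 0, 2, 1, 0, 1, 0, 2, 1, 0, 1, 3, 2, 1,
    0, 1, 0, 2, 1, 0, 1, 2, 3, 2, 1, 0, 1, 0, 2, 1, 0, 1, 3], 15)]
    303553055737023300521287399348765004101393998602553114724166142599075591772138099024448830780226036014195900994561894399⟩,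
    ⟨[0, 1], 144,
    1439353329805142854104714603991612965404745998819329644083815241129017498395974834718471494398692119477,
    .generated [([1, 0, 3, 2, 1, 0, 1, 0, 2, 1, 0, 1, 2, 3, 2, 1, 0, 1, 0, 2, 1, 0, 1, 2, 3], 12),
    ([1, 0, 1, 3, 2, 1, 0, 1, 0, 2, 1, 0, 1, 2, 3, 2, 1, 0, 1, 0, 2, 1, 0, 1, 2, 3, 2, 1, 0, 1, 0,
    2, 1, 0, 1, 2], 18)] 1021660187706725000440614572664567165446862409536372735⟩,
    ⟨[0, 2], 450,
    77129997661473042834563731392906051613186983934262046443509601355555706437127933613777202776407499195825478461383098660175260448333506508518245760766112975710175819108433274443435419370093150854364375398839265300674194366731536014008400764683588147971389202926016313639462851753414055197651019474897011357007724556403599046833100471017782172690235528734635744031807333574291794724988653755299553129856301645071985215142590522304840275797377738314019015604146229866,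
    .generated [([1, 0, 1, 0, 2, 1, 0, 1, 0, 2, 1, 0, 1, 2, 3, 2, 1, 0, 1, 0, 2, 1, 0, 3, 2, 1, 0,
    1, 2, 3], 15), ([0, 1, 0, 1, 0, 2, 1, 0, 1, 0, 2, 1, 0, 1, 2, 3, 2, 1, 0, 1, 0, 2, 1, 0, 3, 2,
    1, 0, 1, 2, 3], 0), ([0, 3, 2, 1, 0, 1, 0, 2, 1, 0, 1, 2, 3, 2, 1, 0, 1, 0, 2, 1, 0, 1, 2, 3,
    2, 1, 0, 1, 0, 2, 1, 0, 1, 2, 3, 2, 1, 0, 1, 0, 2, 1, 0, 1, 2, 3], 15)] 1770893905566514411487⟩,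
    ⟨[1, 2], 400,
    762267489856730636901779976465611046190326659579300634250724263595636462457166391560652987890375278461848283439928287571997196989527830980703393539875743906927895027214220808237645164751564841460164543605782617996590364269077658055063576183356004389484223430620720581105036100455086888052066498664877035472913820830772628582785699069264578238554787602859619609236665015014166538939965820853459456375675,
    .generated [([1, 2, 1, 3, 2, 1, 0, 1, 0, 2, 1, 0, 1, 3, 2, 1, 0, 1, 0, 2, 1, 0], 0), ([1, 2, 3,
    2, 1, 0, 1, 2, 3], 5)] 35101827872767⟩,
    ⟨[0, 1, 2], 720,
    356498735347814441894420899963533957942196721433175483587890766287121703410936118339001086509681700003641550743542891700903584020095024378820105228662896852421108034223948807740312493940421873171462475151492107758944775913858522433922871135911417710673714519542447382578700692312158841066364569133701429954328146062141073324273813008634567479184956011277484452580694268170547712590606705377997413682763664260626723522033610386156695565688678974559975100412074178108433640519108979230235563323693776881515661194101868098116842068118405046436824113975105653663766629028947908456624335614670478164490440527721237706254024011415782098407265281856091772542429127970070487187816625367493727561653570007756523544391846094136723652388981464993007164583974032569494401915532605929845601433799888713538696835525860641391419407923741365782018943,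
    .generated [([1, 0, 1, 2, 1, 0, 1, 0, 2, 1, 0, 1, 3, 2, 1, 0, 1, 0, 2, 1, 0, 1, 2, 3, 2, 1, 0,
    1, 0, 2, 1, 0, 1, 2, 3, 2, 1, 0, 1, 0, 2, 1, 0, 1, 2, 3, 2, 1, 0, 1, 0, 2, 1, 0, 1, 2, 3], 12),
    ([1, 2, 1, 0, 1, 0, 2, 1, 0, 3, 2, 1, 0, 1, 0, 2, 1, 0, 1, 2, 3, 2, 1, 0, 1, 0, 2, 1, 0, 1, 2,
    3, 2, 1, 0, 1, 0, 2, 1, 0, 1, 2, 3, 2, 1, 0, 1, 0, 2, 1, 0, 1, 2, 3], 9)] 524287⟩,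
    ⟨[0, 1, 3], 720,
    975705332766858902709687897371967902109406221405119094157104540616140175460923616194802041124545691532110773978563239561439188891174977546930583989122551556666927876045912520486726872331202158318159282793280425411485585372023746937683025538151560507210538485428497334977331353725175655500579488665247764962741159454228151240924134469398882229735165837189251295880997536252343241720967362718976228698592642934210148052272987486442036658735360408564562779747940426502276942161517306154557386885591591759917338815878308265425270064037689033329863655590060236647948078210252171018919523924991089044200435348391479625045437449655757222580582579667577444141025356193806004803221246527761477794948691525833441065478124603529140549162453084986780152959402507769804883839190254688921829181576117,
    .generated [([1, 2, 1, 0, 1, 0, 2, 1, 0, 1, 2, 3, 2, 1, 0, 1, 0, 2, 1, 0, 1, 2, 3, 2, 1, 0, 1,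
    0, 2, 1, 0, 1, 2, 3, 2, 1, 0, 1, 0, 2, 1, 0, 1, 2, 3, 2, 1, 0, 1, 0, 2, 1, 0, 1, 2], 12), ([3],
    15)] 123565527⟩,
    ⟨[0, 2, 3], 1200,
    2039822034010530914917275448126237453722054024380513639119879536504139970039096661312744168762213035170043821653385014756194775642848991579527719250646244985726891809844906523635614958013909915773177400424279959996307705526082558259127645706911752340438191076652998268848466567479846657365769927674567426596225610384269337782469650633595693387386554848763335337291426850334015408581071936955274228777548535928534960034888446120415622430392969209375354277067781076979583953979427979458371960562175258623654396506132794401058693243027046701675572352506827588438466368600101954375055671795441426455969806573562254711758549411409181008491015552473994662211144833263579379356861868760141713833513102670835382220425514043138546928540297680170571653563225572768791207107595541663711664537094528144740752062076138698250711835155902673343484352697404161987485279963889875898385781523605275012808494166712351958090113973647251111201520420695453242639662078567460357500095473383728223554030440319131167498235525295574431312108129965384520615045324608198655898512791501929876371765349295903008867435579772147989892756059038434290921570520402120674766880603579389479577472499001267765850079246731030233014378983148882279722624866700587961660710,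
    .generated [([0, 1, 0, 1, 0, 2, 1, 0, 1, 0, 2, 1, 0, 1, 3, 2, 1, 0, 1, 0, 2, 1, 0, 1, 2, 3, 2,
    1, 0, 1, 0, 2, 1, 0, 1, 2, 3, 2, 1, 0, 1, 0, 2, 1, 0, 1, 2, 3, 2, 1, 0, 1, 0, 2, 1, 0, 1, 2],
    5), ([0, 2, 3], 5)] 2047⟩,
    ⟨[1, 2, 3], 1800,
    3260850563447128023395191325441954621248443199137007066248978974046754916620124168681675568644611284309527339696077965680487351606691569053704797993117786902767986447973760110069304683203284498675555153423919588224247709207347300310659738758581042505064334925630695026268304770183662734245909401754634482970018523284645103787726395028667398403904746273246785545974929515165245138051355772256335808084827536717867942152284078898118386026480892851114964986524524439971334217617374328058781558207372899090823802245633513833143490241334637271839884092013710547074232888803164772438874987734884363721828152124555375063811813446034245774706355025920777034296870476864434771203831735427116817198021840559648711693493131073156166731451995923388012683668569136999250806844422399833509406398213629964975075802755786084463703485865500902371601794460833314765574101334609669719772928933450041776030004579919711884113684775513380010783372920450141091394455096045377803511036321788439877649328004431365433441464257509245045844549919878960817799476718962876999738987348192446405462750715935628277019340878665922276295644565453736751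1449264800437239322465483892669213237038181545796621034640700392957819834451420415725016614585377111459311204353792170894104716837608589654881721137234826927322441419432622788875752166635217103406053428110453922979381407687225417429799143440851029985277567010216844772550585301869760650114762205497596348643300123997839927897726815151273891547788950643840365594239540444157703392014082983827443497315137339888573834476755568709405159151394683115658587922218245897380520197597269702594660910405620848156283855869292876805437777147533402669359122295861283763998127489919238362447222804453241687160051462108165080029084161190425386401632359757528251129000436856586438539560243915961547927535769555348421769536855078611043178198352921966417160025116653146158901257489140299370892586663595759590980695800264252637860213944842052797498538977447721035524966637921632700620386703738425647864034774654846663005503,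
    .generated [([1, 2, 3], 0), ([0, 1, 0, 1, 0, 2, 1, 0, 1, 0, 2, 1, 0, 1, 2, 3, 2, 1, 0, 1, 0, 2,
    1, 0, 1, 2, 3, 2, 1, 0, 1, 0, 2, 1, 0, 1, 2, 3, 2, 1, 0, 1, 0, 2, 1, 0, 1, 2, 3, 2, 1, 0, 1, 0,
    2, 1, 0, 1, 2, 3], 15)] 471⟩,
    ⟨[0, 1, 0, 1], 144,
    1439353329805142854104714603991612965404745998819329644083815241129017498395974834718471494398692119477,
    .generated [([0, 1, 0, 2, 1, 0, 1, 0, 2, 1, 0, 1, 2, 3, 2, 1, 0, 1, 0, 2, 1, 0, 1, 2, 3, 2, 1,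
    0, 1, 0, 2, 1, 0, 1, 2, 3, 2, 1, 0, 1, 0, 2, 1, 0, 1, 2, 3, 2, 1, 0, 1, 0, 2, 1, 0, 1, 2], 3),
    ([1, 3, 2, 1, 0, 1, 0, 2, 1, 0, 1, 2], 24)] 1021659845280163680055621492061766350668274579063439359⟩,
    ⟨[0, 1, 2, 3], 480,
    2323049533056130816492933591542465196072700229168240308583626284743789671358530589852078178369226869824168055695051524967108666446025911326639937053901302086233265802299383793300746898388435457434740008160222436588110957224316766677830082703585107624032336432402227584115233063601477971255400911112193355839376183125944723307483471053710108214293647158945222010417931382031452798940463329031467591280121419858554368347260925185685408687395237396121120033045163714316140333856425490594399222607103206049119834821843327,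
    .generated [([0, 1, 0, 1, 2, 1, 0, 1, 0, 2, 3, 2, 1, 0, 1, 0, 2, 1, 0, 1, 2, 3, 2, 1, 0, 1, 2,
    3], 2)] 536870911⟩,
    ⟨[0, 1, 0, 1, 2], 1200,
    2396483173690802601179604612236174703644824435283193572546854753905030455893466959854125373084157195226643652578623336363347562545755995345571463326694232035706967813162958491824294921533847583724276058573180407178323630835280000845412481545418879690254423689348155283430243865329996107921678599023438701441453930934005306440214559829324196254551499504032363294770927451931266900311427313117888843137473063264097932378022918984207723561409690101237044096863898945140381863056229846449033182964253804579962342857820027951352545720378749755494683218335083901599386569448693613545848514134154614094538184610489672430923300040985362658332538651238016667263446950525326008951391195350854820752845491954345978554252823342813477214629146650750895718463886870432899360217975123913995214489740206019918010208625239745411093328348850961733832962876173384062218689370429350420445840596602868474858000421022793840319735165582977277729934072445861956882223744232892791319159316279055583102770854442681412259215581039879377381411572226204924033774317195175403680769614851414282190753026384226860779544664517452803111729730885777571531960872744177210545251391745544444141488853358115574993870902088798866639118043598724406724020505623628442549435373990358395174354877733860184444473001494041862783845416754915750746235291879110330149188091259745272560511,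
    .generated [([2, 1, 0, 1, 0], 5), ([0, 1, 0, 1, 0, 2, 1, 0, 1, 2, 3, 2, 1, 0, 1, 0, 2, 1, 0, 1,
    2, 3, 2, 1, 0, 1, 0, 2, 1, 0, 1, 2, 3, 2, 1, 0, 1, 0, 2, 1, 0, 1, 2, 3, 2, 1, 0, 1, 0, 2, 1, 0,
    1, 2, 3], 20)] 2047⟩,
    ⟨[0, 1, 0, 1, 3], 720,
    975705332766858902709687897371967902109406221405119094157104540616140175460923616194802041124545691532110773978563239561439188891174977546930583989122551556666927876045912520486726872331202158318159282793280425411485585372023746937683025538151560507210538485428497334977331353725175655500579488665247764962741159454228151240924134469398882229735165837189251295880997536252343241720967362718976228698592642934210148052272987486442036658735360408564562779747940426502276942161517306154557386885591591759917338815878308265425270064037689033329863655590060236647948078210252171018919523924991089044200435348391479625045437449655757222580582579667577444141025356193806004803221246527761477794948691525833441065478124603529140549162453084986780152959402507769804883839190254688921829181576117,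
    .generated [([1, 2, 1, 0, 1, 0, 2, 1, 0, 1, 2, 3, 2, 1, 0, 1, 0, 2, 1, 0, 1, 2, 3, 2, 1, 0, 1,
    0, 2, 1, 0, 1, 2, 3, 2, 1, 0, 1, 0, 2, 1, 0, 1, 2, 3, 2, 1, 0, 1, 0, 2, 1, 0, 1, 2], 9), ([0,
    2, 1, 0, 1, 0, 2, 1, 0, 1, 2, 3, 2, 1, 0, 1, 0, 2, 1, 0, 1, 2, 3, 2, 1, 0, 1, 0, 2, 1, 0, 1, 2,
    3, 2, 1, 0, 1, 0, 2, 1, 0, 1, 2, 3, 2, 1, 0, 1, 0, 2, 1, 0, 1, 2, 3], 21)] 524287⟩,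
    ⟨[0, 1, 0, 1, 2, 3], 720,
    232626279060938000216175711129603958393420612440115870124940345361656576399503247918382631936572281651121483189456754933428611899878265775003798920029108631908963300187058009822419061440371961736289113434707409389208307808012629488930991990701950045395279263715513391530097687873550287957761108730880592999231494798705817496065282872654692638508617463019496511632684556397339773362582615949385312995104596039620801184794118613320787946444495699487596753091334552001617717959970072644551307250765703261434500744488557092326472714144194937001465912711290869530268222132809585248562345314435220593651768252767383989648034399282943249578056997471330062754380457538233998504445806288353615866134563451659353580148946075127621139784617286749656298877688242238032648964757977364054637439,
    .generated [([0, 1, 0, 1, 0, 2, 1, 0, 1, 0, 2, 1, 0, 3, 2, 1, 0, 1, 0, 2, 1, 0, 1, 2, 3, 2, 1,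
    0, 1, 0, 2, 1, 0, 1, 2, 3, 2, 1, 0, 1, 2, 3], 3)] 524287⟩,
    ⟨[0, 1, 0, 1, 2, 1, 3, 2], 480,
    2323049533056130816492933591542465196072700229168240308583626284743789671358530589852078178369226869824168055695051524967108666446025911326639937053901302086233265802299383793300746898388435457434740008160222436588110957224316766677830082703585107624032336432402227584115233063601477971255400911112193355839376183125944723307483471053710108214293647158945222010417931382031452798940463329031467591280121419858554368347260925185685408687395237396121120033045163714316140333856425490594399222607103206049119834821843327,
    .generated [([0, 1, 0, 1, 2, 1, 0, 1, 0, 2, 3, 2, 1, 0, 1, 0, 2, 1, 0, 1, 2, 3, 2, 1, 0, 1, 2,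
    3], 2)] 536870911⟩,
    ⟨[0, 1, 0, 1, 2, 1, 0, 1, 2], 720,
    356498735347814441894420899963533957942196721433175483587890766287121703410936118339001086509681700003641550743542891700903584020095024378820105228662896852421108034223948807740312493940421873171462475151492107758944775913858522433922871135911417710673714519542447382578700692312158841066364569133701429954328146062141073324273813008634567479184956011277484452580694268170547712590606705377997413682763664260626723522033610386156695565688678974559975100412074178108433640519108979230235563323693776881515661194101868098116842068118405046436824113975105653663766629028947908456624335614670478164490440527721237706254024011415782098407265281856091772542429127970070487187816625367493727561653570007756523544391846094136723652388981464993007164583974032569494401915532605929845601433799888713538696835525860641391419407923741365782018943,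
    .generated [([0, 1, 0, 1, 2, 1, 3, 2, 1, 0, 1, 0, 2, 1, 0, 1, 2, 3, 2, 1, 0, 1, 0, 2, 1, 0, 1,
    2, 3, 2, 1, 0, 1, 0, 2, 1, 0, 1, 2, 3, 2, 1, 0, 1, 0, 2, 1, 0, 1, 2, 3], 3), ([0, 1, 0, 1, 0,
    2, 1, 0, 1, 0, 2, 1, 0, 1, 2, 3, 2, 1, 0, 1, 0, 2, 1, 0, 1, 2, 3, 2, 1, 0, 1, 0, 2, 1, 0, 1, 2,
    3, 2, 1, 0, 1, 0, 2, 1, 0, 1, 2, 3, 2, 1, 0, 1, 0, 2, 1, 0, 1, 2, 3], 15)] 123565527⟩,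
    ⟨[0, 1, 0, 1, 2, 1, 0, 1, 2, 3], 1200,
    1617796778261020456497656933188876549808826925065145864908914352902847807385953375861539636558440918659593451191683803442948853485334016260754628920969331441948459416784348232085366471199882244549198066106639232872660182274303247342100892947880697012285743638359515007461772326064597289184102924508280307704988534436530602809783541394548364428980235774610792863300036833233707021495443865909303270290033310517631938497582719200887539957762219076013738782973870497977095940937366057519900027895364927120603790257233536885618411066512170081312025422634531571026171697883392306275730697454163687941747178885832477709132484613017246502308173050385230789099127186067709696495267281199996368303420399505123619653756503259073034816934947963766457642112497688101444964830009222310805537901892539179794884726208472222268035618566991545639456607845325399717589766176208506697940926589150899809732771858459957244639765729719958063074474909539172050217562272124352796445619560024246593814942014718376438519429239634757122393486351407112017480034988083597151704404777574786414285072277922279732498997297478945529544562388990847,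
    .generated [([0, 1, 0, 1, 2, 1, 0, 1, 0, 2, 1, 0, 1, 2, 3, 2, 1, 0, 1, 0, 2, 1, 0, 1, 2, 3, 2,
    1, 0, 1, 0, 2, 1, 0, 1, 2, 3, 2, 1, 0, 1, 0, 2, 1, 0, 1, 2, 3, 2, 1], 5)] 2047⟩,
    ⟨[0, 1, 0, 1, 0, 2, 1, 0, 1, 2, 3, 2], 24, 576469931999198079, .generated [([1, 0, 2, 1, 0, 1,
    0, 2, 1, 0, 1, 2, 3, 2, 1, 0, 1, 0, 2, 1, 0, 1, 2, 3, 2, 1, 0, 1, 0, 2, 1, 0, 1, 2, 3, 2, 1, 0,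
    1, 0, 2, 1, 3, 2], 6), ([0, 1, 2, 1, 0, 1, 0, 3, 2, 1, 0, 1, 0, 2, 1, 0, 3, 2, 1, 0], 24)]
    11166329089744325952054071138814938705280149942978621406528426087933841661534763665349785598190067844937630074054374579846300019575812946252131283037711087583481871397011027644337046230744432694377663969933572522089675681037132637228610318389760147689720080067634569279469679002075109563787983580553726723583267351174597386818346008219291626226596040718941695⟩,
    ⟨[0, 1, 0, 1, 0, 2, 1, 0, 1, 0, 2, 1, 3, 2], 288,
    368527092646774761084507564111750070391685280683172847410531666373351985401327847334900888141322453862531827071290737574110195746801504019286913313358404766666728557440196469619538631060949342309164391266422541343345497122704998754119946999690571776370679956815332213259137366998617307141808168996530340759698303,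
    .generated [([0, 1, 0, 1, 0, 2, 1, 0, 1, 2, 3, 2, 1, 0, 1, 0, 2, 1, 0, 1, 2, 3, 2, 1, 0, 1, 0,
    2, 1, 0, 1, 2, 3, 2], 0), ([2, 1, 0, 1, 0, 2], 6)] 143939223255250431⟩,
    ⟨[0, 1, 0, 1, 0, 2, 1, 0, 1, 0, 2, 1, 0, 1, 2], 60,
    3213876089266293163839315525572625854476668973277371578847816, .generated [([0, 1, 2, 1, 0, 1, 0, 3, 2,
    1, 0, 1, 0, 2, 1, 0, 1, 2, 3, 2, 1, 0, 1, 0, 2, 1, 0, 1, 2, 3, 2, 1, 0, 1, 0, 2, 1, 0, 1, 2, 3,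
    2, 1, 0, 1, 0, 2, 1, 0, 1, 2, 3], 15), ([0, 1, 0, 2, 1, 0, 1, 0, 2, 1, 3, 2, 1, 0, 1, 0, 2, 1,
    0, 1, 2, 3, 2, 1, 0, 1, 0, 2, 1, 0, 1, 2, 3, 2, 1, 0, 1, 0, 2, 1, 0, 1, 2, 3, 2, 1, 0, 1, 0, 2,
    1, 0, 1, 2, 3], 0)]
    151776527868511650260643699674382502050696999301276557362083071299537795886069049512224415390113018007097950497280948223⟩,
    ⟨[0, 1, 0, 1, 0, 2, 1, 0, 1, 0, 2, 1, 0, 1, 2, 3], 144,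
    3165243105647732554479412283769279181379809782360868440369622713543247486499671219691993862898376914135837260,
    .generated [([0, 1, 0, 3, 2, 1, 0, 1, 0, 2, 1, 0, 1, 2, 3, 2, 1, 0, 1, 0, 2, 1, 0, 1, 2, 3, 2,
    1, 0, 1, 0, 2, 1, 0, 1, 2, 3, 2, 1, 0, 1, 0, 2, 1, 0, 1, 2], 3), ([0, 1, 0, 1, 2, 1, 0, 1, 0,
    2, 1, 0, 1, 2, 3], 3)] 36346030658534468381906456562630655⟩,
    ⟨[0, 1, 0, 1, 2, 1, 0, 1, 2, 3, 2, 1, 0, 1, 2, 3], 480,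
    2323049533056130816492933591542465196072700229168240308583626284743789671358530589852078178369226869824168055695051524967108666446025911326639937053901302086233265802299383793300746898388435457434740008160222436588110957224316766677830082703585107624032336432402227584115233063601477971255400911112193355839376183125944723307483471053710108214293647158945222010417931382031452798940463329031467591280121419858554368347260925185685408687395237396121120033045163714316140333856425490594399222607103206049119834821843327,
    .generated [([0, 1, 0, 1, 0, 2, 1, 0, 1, 0, 2, 1, 0, 3, 2, 1, 0, 1, 0, 2, 1, 0, 1, 2, 3, 2, 1,
    0, 1, 0, 2, 1, 0, 1, 2, 3, 2, 1, 0, 1, 0, 2, 1, 0, 1, 2, 3, 2, 1, 0, 1, 2], 4)] 536870911⟩,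
    ⟨[0, 1, 0, 1, 0, 2, 1, 0, 1, 0, 2, 3, 2, 1, 0, 1, 2, 3], 720,
    232626279060938000216175711129603958393420612440115870124940345361656576399503247918382631936572281651121483189456754933428611899878265775003798920029108631908963300187058009822419061440371961736289113434707409389208307808012629488930991990701950045395279263715513391530097687873550287957761108730880592999231494798705817496065282872654692638508617463019496511632684556397339773362582615949385312995104596039620801184794118613320787946444495699487596753091334552001617717959970072644551307250765703261434500744488557092326472714144194937001465912711290869530268222132809585248562345314435220593651768252767383989648034399282943249578056997471330062754380457538233998504445806288353615866134563451659353580148946075127621139784617286749656298877688242238032648964757977364054637439,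
    .generated [([3, 2, 1, 0, 1, 0], 3)] 524287⟩,
    ⟨[0, 1, 0, 1, 0, 2, 1, 0, 1, 0, 2, 1, 0, 3, 2, 1, 0, 1, 2, 3], 40,
    2636713249085237309206204787014523, .generated [([1, 0, 2, 1, 0, 1, 2, 3, 2, 1, 0, 1], 10), ([2, 1,
    0, 1, 0, 2, 1, 3, 2, 1, 0, 1, 0, 2, 1, 0, 1, 2, 3, 2, 1, 0, 1, 0, 2, 1, 0, 1, 2, 3, 2, 1, 0, 1,
    0, 2, 1, 0, 1, 3], 0)]
    49772656629143641091094811961123703334843019812516854941315567716599019875425795397885030062724194332031496230394951235259100398064416649232550740803868394791500515243999⟩,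
    ⟨[0, 1, 0, 1, 0, 2, 1, 0, 1, 0, 2, 1, 0, 1, 2, 3, 2, 1, 0, 1, 2, 3], 400,
    1130335790668284451827842190126238587681926293018473975775880209783303405175789410947130062570545644398881713918515090186900244707175038127987278847115144296306705731042342638672299199873459866612827341495672574029385742571618617062824420375244696985670410161171268692296430081748966602448827513189073066514091522097339147343118974256147776482843897644736409616970085356769356011271260562345082254898604452237214656262826841772031560096105149435614041,
    .generated [([0, 1, 0, 1, 0, 2, 1, 0, 1, 0, 2, 1, 0, 3, 2, 1, 0, 1, 2, 3], 10), ([3, 2, 1, 0,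
    1, 0, 2, 1, 0, 1, 3, 2, 1, 0, 1, 0, 2, 1, 0], 20)] 34071031789567⟩,
    ⟨[0, 1, 0, 1, 0, 2, 1, 0, 1, 0, 2, 3, 2, 1, 0, 1, 0, 2, 1, 0, 1, 2, 3, 2], 24,
    576469931999198079, .generated [([1, 0, 2, 1, 0, 1, 0, 3, 2, 1, 0, 1, 0, 2, 1, 0, 1, 2, 3, 2, 1,
    0, 1, 0, 2, 1, 0, 1, 2, 3, 2, 1, 0, 1, 0, 2, 1, 0, 1, 2], 6), ([0, 1, 2, 3, 2, 1, 0, 1, 0, 2,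
    1, 0, 1, 2, 3, 2, 1, 0, 1, 0], 12)]
    3733662566702091646020940461937520673869367431862386217726692562303566273886525918608802809418894753923403483420324344102642294613001683380736315334429691267943534767696298124445223328863158469232702897225236316384885615122001404152307063443589830355353507105673903516692126429988467375628670200950122476848451691652841365292667464345249120255⟩,
    ⟨[0, 1, 0, 1, 0, 2, 1, 0, 1, 0, 2, 1, 0, 3, 2, 1, 0, 1, 0, 2, 1, 0, 1, 2, 3, 2], 288,
    368527092646774761084507564111750070391685280683172847410531666373351985401327847334900888141322453862531827071290737574110195746801504019286913313358404766666728557440196469619538631060949342309164391266422541343345497122704998754119946999690571776370679956815332213259137366998617307141808168996530340759698303,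
    .generated [([0, 1, 0, 1, 0, 2, 1, 0, 1, 3, 2, 1, 0, 1, 0, 2, 1, 0, 1, 2, 3, 2, 1, 0, 1, 0, 2,
    1, 0, 1, 2, 3, 2, 1, 0, 1, 0, 2, 1, 0, 1, 2, 3, 2, 1, 0, 1, 0, 2, 1, 0, 1, 2, 3], 6), ([2, 1,
    0, 1, 3, 2, 1, 0, 1, 0, 2, 1, 0, 1], 0)] 3074452214561374207⟩,
    ⟨[0, 1, 0, 1, 0, 2, 1, 0, 1, 2, 3, 2, 1, 0, 1, 0, 2, 1, 0, 1, 2, 3, 2, 1, 0, 1, 2, 3], 480,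
    1170609743081147733776836272505236007549457390874567532394710366461780736465439857846345253047879296805994466442511443245435182391044220645539497387756445312568955183301946434866918120338377042396140219546788885288637836559312854976895399385506938262665700528508455419900454333762294642037887331441614264584061759304488880045043776908392878967988956505549416450628298915601659345271815118273857958339693901663370037765035244163760887412654435958249725108788345212734413474942689055710282995129253903019202634406668074457029825674774717794157296511,
    .generated [([0, 2, 1, 0, 1, 0, 3, 2, 1, 0, 1, 0, 2, 1, 0, 1, 2, 3, 2, 1, 0, 1, 0, 2, 1, 0, 1,
    2, 3, 2, 1, 0, 1, 0, 2, 1, 0, 1, 3, 2, 1, 0, 1, 0], 2)] 536870911⟩,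
    ⟨[0, 1, 0, 1, 0, 2, 1, 0, 1, 0, 2, 1, 0, 1, 3, 2, 1, 0, 1, 0, 2, 1, 0, 3, 2, 1, 0, 1, 2, 3],
    60, 1020847614884829247518741195286918845307, .generated [([2, 1, 0, 1, 0, 2, 1, 0, 1, 3, 2, 1, 0,
    1, 0, 2, 1, 0, 1, 2, 3, 2, 1, 0, 1, 0, 2, 1, 0, 1, 2, 3, 2, 1, 0, 1, 0, 2, 1, 0, 1, 2, 3, 2, 1,
    0, 1, 0], 0), ([0, 2, 1, 0, 1, 3, 2, 1, 0, 1, 0, 2, 1, 0, 1, 2, 3, 2, 1, 0, 1, 0, 2, 1, 0, 1,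
    2, 3, 2, 1, 0, 1, 0, 2, 1, 0, 1, 2], 15)]
    55209069920140441333397567353580721720922727088040868105011708068902598980138166482466483695644205459302043284848217423871⟩,
    ⟨[0, 1, 0, 1, 0, 2, 1, 0, 1, 0, 2, 1, 3, 2, 1, 0, 1, 0, 2, 1, 0, 1, 2, 3, 2, 1, 0, 1, 0, 2, 1,
    0, 1, 2, 3, 2], 24, 576469931999198079, .generated [([0, 1, 0, 2, 1, 0, 1, 0, 2, 1, 0, 1, 3, 2,
    1, 0, 1, 0, 2, 1, 0, 1, 2, 3, 2, 1, 0, 1, 0, 2, 1, 0, 1, 3, 2, 1, 0, 1, 2, 3], 0), ([1, 0, 1,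
    0, 2, 3, 2, 1, 0, 1, 0, 2, 1, 3], 6)]
    62143316818130353744934075509788045686672773354125345546205440869531177548437208151301987227676046182830430935757884216856162279259781562176961731985277617560486596330089980010702134322113703829973387176570774729865634965898298661723309220739038908777783400539882172972740523677689956953087818186310514456443221673444292806306153975660552078229503⟩,
    ⟨[0, 1, 0, 1, 0, 2, 1, 0, 1, 0, 2, 1, 0, 1, 2, 3, 2, 1, 0, 1, 0, 2, 1, 0, 1, 2, 3, 2, 1, 0, 1,
    0, 2, 1, 0, 1, 2, 3], 144,
    3165243105647732554479412283769279181379809782360868440369622713543247486499671219691993862898376914135837260,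
    .generated [([0, 1, 0, 3, 2, 1, 0, 1, 0, 2, 1, 0, 1, 2, 3, 2, 1, 0, 1, 0, 2, 1, 0, 1, 2, 3, 2,
    1, 0, 1, 0, 2, 1, 0, 1, 2, 3, 2, 1, 0, 1, 0, 2, 1, 0, 1, 2], 12), ([0, 1, 0, 1, 3, 2, 1, 0, 1,
    0, 2, 1, 0, 1, 2], 18)] 41537060175878538180896183915380735⟩,
    ⟨[0, 1, 0, 1, 0, 2, 1, 0, 1, 0, 2, 1, 0, 1, 3, 2, 1, 0, 1, 0, 2, 1, 0, 1, 3, 2, 1, 0, 1, 0, 2,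
    1, 0, 3, 2, 1, 0, 1, 2, 3], 40, 2636713249085237309206204787014523, .generated [([0, 1, 2, 3, 2, 1,
    0, 1, 0, 2, 1, 0, 1, 2, 3, 2, 1, 0, 1, 0, 2, 1, 0, 1, 3, 2, 1, 0], 10), ([1, 0, 1, 3, 2, 1, 0,
    1, 0, 2, 1, 0, 1, 2, 3, 2, 1, 0, 1, 0, 2, 1, 0, 1, 2, 3, 2, 1, 0, 1, 0, 2, 1, 0, 1, 3, 2, 1, 0,
    1], 20)]
    4249636432484441858481707313286765266224539282979273535426427476255947646997231954108844953343720524365628819650172180342339421360039049228165759539521519615⟩,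
    ⟨[0, 1, 0, 1, 0, 2, 1, 0, 1, 0, 2, 1, 0, 3, 2, 1, 0, 1, 0, 2, 1, 0, 1, 2, 3, 2, 1, 0, 1, 0, 2,
    1, 0, 1, 2, 3, 2, 1, 0, 1, 0, 2, 1, 0, 1, 2, 3, 2], 24, 576469931999198079, .generated [([0, 1,
    2, 1, 3, 2, 1, 0, 1, 0], 12), ([0, 2, 1, 0, 1, 0, 2, 3, 2, 1, 0, 1, 0, 2, 1, 0, 1, 2, 3, 2, 1,
    0, 1, 0, 2, 1, 0, 1, 3, 2, 1, 0, 1, 0, 2, 1], 18)]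
    7289761714476881329191118416514254147594082373830658614958888452985979825885032439643233410232178061230142663615414768182863745612651991788199152701197785898289113785203858314075824917592128784474245272553261025184890350516391220741219666145398154569038301519135381780238587291136035560741269852046283043382741496477118889471⟩,
    ⟨[0, 1, 0, 1, 0, 2, 1, 0, 1, 0, 2, 1, 0, 1, 2, 3, 2, 1, 0, 1, 0, 2, 1, 0, 1, 2, 3, 2, 1, 0, 1,
    0, 2, 1, 0, 1, 2, 3, 2, 1, 0, 1, 0, 2, 1, 0, 1, 2, 3, 2, 1, 0, 1, 0, 2, 1, 0, 1, 2, 3], 1, 0,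
    .central [15, 15, 15, 15]⟩]

set_option maxRecDepth 100000 in
theorem checkH4 : checkDecomposition 30 14400 packedOne generatorsH4 repsH4 [0, 25, 21, 16] [15, 10, 6, 1] = true := by
  decide +kernel

end

noncomputable section

section Groups

theorem IsPrimitiveRoot.shift_twelve_ne_zero {ζ : ℂ} (h : IsPrimitiveRoot ζ 12) :
    (([0, 10] : List ℕ).map (ζ ^ ·)).sum - (([6, 4] : List ℕ).map (ζ ^ ·)).sum ≠ 0 := by
  have h1 (k : ℕ) (hk : 0 < k) (hk' : k < 12) : 1 - ζ ^ k ≠ 0 :=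
    sub_ne_zero.2 (h.pow_ne_one_of_pos_of_lt hk.ne' hk').symm
  have h2 : (([0, 10] : List ℕ).map (ζ ^ ·)).sum - (([6, 4] : List ℕ).map (ζ ^ ·)).sum =
      (1 - ζ ^ 6) * (1 - ζ ^ 4) := by
    simp only [List.map_cons, List.map_nil, List.sum_cons, List.sum_nil]
    ring
  rw [h2]
  exact mul_ne_zero (h1 6 (by norm_num) (by norm_num)) (h1 4 (by norm_num) (by norm_num))

theorem IsPrimitiveRoot.shift_twentyFour_ne_zero {ζ : ℂ} (h : IsPrimitiveRoot ζ 24) :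
    (([0, 20] : List ℕ).map (ζ ^ ·)).sum - (([12, 8] : List ℕ).map (ζ ^ ·)).sum ≠ 0 := by
  have h1 (k : ℕ) (hk : 0 < k) (hk' : k < 24) : 1 - ζ ^ k ≠ 0 :=
    sub_ne_zero.2 (h.pow_ne_one_of_pos_of_lt hk.ne' hk').symm
  have h2 : (([0, 20] : List ℕ).map (ζ ^ ·)).sum - (([12, 8] : List ℕ).map (ζ ^ ·)).sum =
      (1 - ζ ^ 12) * (1 - ζ ^ 8) := by
    simp only [List.map_cons, List.map_nil, List.sum_cons, List.sum_nil]
    ring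
  rw [h2]
  exact mul_ne_zero (h1 12 (by norm_num) (by norm_num)) (h1 8 (by norm_num) (by norm_num))

theorem IsPrimitiveRoot.shift_thirty_ne_zero {ζ : ℂ} (h : IsPrimitiveRoot ζ 30) :
    (([0, 25, 21, 16] : List ℕ).map (ζ ^ ·)).sum - (([15, 10, 6, 1] : List ℕ).map (ζ ^ ·)).sum ≠ 0 := by
  have h1 (k : ℕ) (hk : 0 < k) (hk' : k < 30) : 1 - ζ ^ k ≠ 0 :=
    sub_ne_zero.2 (h.pow_ne_one_of_pos_of_lt hk.ne' hk').symm
  have h2 : (([0, 25, 21, 16] : List ℕ).map (ζ ^ ·)).sum - (([15, 10, 6, 1] : List ℕ).map (ζ ^ ·)).sum =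
      (1 - ζ ^ 15) * (1 - ζ ^ 10) * (1 - ζ ^ 6) := by
    simp only [List.map_cons, List.map_nil, List.sum_cons, List.sum_nil]
    linear_combination ζ * h.pow_eq_one
  rw [h2]
  exact mul_ne_zero (mul_ne_zero (h1 15 (by norm_num) (by norm_num)) (h1 10 (by norm_num) (by norm_num)))
    (h1 6 (by norm_num) (by norm_num))

theorem IsPrimitiveRoot.shift_sixty_ne_zero {ζ : ℂ} (h : IsPrimitiveRoot ζ 60) :
    (([0, 50, 42, 32] : List ℕ).map (ζ ^ ·)).sum - (([30, 20, 12, 2] : List ℕ).map (ζ ^ ·)).sum ≠ 0 := by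
  have h1 (k : ℕ) (hk : 0 < k) (hk' : k < 60) : 1 - ζ ^ k ≠ 0 :=
    sub_ne_zero.2 (h.pow_ne_one_of_pos_of_lt hk.ne' hk').symm
  have h2 : (([0, 50, 42, 32] : List ℕ).map (ζ ^ ·)).sum - (([30, 20, 12, 2] : List ℕ).map (ζ ^ ·)).sum =
      (1 - ζ ^ 30) * (1 - ζ ^ 20) * (1 - ζ ^ 12) := by
    simp only [List.map_cons, List.map_nil, List.sum_cons, List.sum_nil]
    linear_combination ζ ^ 2 * h.pow_eq_one
  rw [h2]
  exact mul_ne_zero (mul_ne_zero (h1 30 (by norm_num) (by norm_num)) (h1 20 (by norm_num) (by norm_num)))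
    (h1 12 (by norm_num) (by norm_num))

variable {W : Type*} [Group W] [Fintype W]

theorem CoxeterSystem.hasRegularDecomposition_A3 {M : CoxeterMatrix (Fin 3)}
    (cs : CoxeterSystem M W) (hM : ∀ i j : Fin 3, M i j = tableEntry coxeterTableA4 i j) :
    HasRegularDecomposition W :=
  cs.hasRegularDecomposition_of_tables hM (by decide +kernel) (ts := cosetTablesA4.take 3) rfl
    (by decide +kernel) (by decide +kernel) rfl (by decide +kernel) (by norm_num)
    (fun _ h => h.shift_twelve_ne_zero) (by decide +kernel)
    (by rintro _ ⟨⟩; rfl) rfl rfl checkA3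

theorem CoxeterSystem.hasRegularDecomposition_B3 {M : CoxeterMatrix (Fin 3)}
    (cs : CoxeterSystem M W) (hM : ∀ i j : Fin 3, M i j = tableEntry coxeterTableB4 i j) :
    HasRegularDecomposition W :=
  cs.hasRegularDecomposition_of_tables hM (by decide +kernel) (ts := cosetTablesB4.take 3) rfl
    (by decide +kernel) (by decide +kernel) rfl (by decide +kernel) (by norm_num)
    (fun _ h => h.shift_twelve_ne_zero) (by decide +kernel)
    (by rintro _ ⟨⟩; rfl) rfl rfl checkB3

theorem CoxeterSystem.hasRegularDecomposition_H3 {M : CoxeterMatrix (Fin 3)}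
    (cs : CoxeterSystem M W) (hM : ∀ i j : Fin 3, M i j = tableEntry coxeterTableH4 i j) :
    HasRegularDecomposition W :=
  cs.hasRegularDecomposition_of_tables hM (by decide +kernel) (ts := cosetTablesH4.take 3) rfl
    (by decide +kernel) (by decide +kernel) rfl (by decide +kernel) (by norm_num)
    (fun _ h => h.shift_thirty_ne_zero) (by decide +kernel)
    (by rintro _ ⟨⟩; rfl) rfl rfl checkH3

theorem CoxeterSystem.hasRegularDecomposition_A4 {M : CoxeterMatrix (Fin 4)}
    (cs : CoxeterSystem M W) (hM : ∀ i j : Fin 4, M i j = tableEntry coxeterTableA4 i j) :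
    HasRegularDecomposition W :=
  cs.hasRegularDecomposition_of_tables hM (by decide +kernel) (ts := cosetTablesA4) rfl
    (by decide +kernel) (by decide +kernel) rfl (by decide +kernel) (by norm_num)
    (fun _ h => h.shift_sixty_ne_zero) (by decide +kernel)
    (by rintro _ ⟨⟩; rfl) rfl rfl checkA4

theorem CoxeterSystem.hasRegularDecomposition_B4 {M : CoxeterMatrix (Fin 4)}
    (cs : CoxeterSystem M W) (hM : ∀ i j : Fin 4, M i j = tableEntry coxeterTableB4 i j) :
    HasRegularDecomposition W :=
  cs.hasRegularDecomposition_of_tables hM (by decide +kernel) (ts := cosetTablesB4) rfl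
    (by decide +kernel) (by decide +kernel) rfl (by decide +kernel) (by norm_num)
    (fun _ h => h.shift_twentyFour_ne_zero) (by decide +kernel)
    (by rintro _ ⟨⟩; rfl) rfl rfl checkB4

theorem CoxeterSystem.hasRegularDecomposition_D4 {M : CoxeterMatrix (Fin 4)}
    (cs : CoxeterSystem M W) (hM : ∀ i j : Fin 4, M i j = tableEntry coxeterTableD4 i j) :
    HasRegularDecomposition W :=
  cs.hasRegularDecomposition_of_tables hM (by decide +kernel) (ts := cosetTablesD4) rfl
    (by decide +kernel) (by decide +kernel) rfl (by decide +kernel) (by norm_num)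
    (fun _ h => h.shift_twelve_ne_zero) (by decide +kernel)
    (by rintro _ ⟨⟩; rfl) rfl rfl checkD4

theorem CoxeterSystem.hasRegularDecomposition_F4 {M : CoxeterMatrix (Fin 4)}
    (cs : CoxeterSystem M W) (hM : ∀ i j : Fin 4, M i j = tableEntry coxeterTableF4 i j) :
    HasRegularDecomposition W :=
  cs.hasRegularDecomposition_of_tables hM (by decide +kernel) (ts := cosetTablesF4) rfl
    (by decide +kernel) (by decide +kernel) rfl (by decide +kernel) (by norm_num)
    (fun _ h => h.shift_twentyFour_ne_zero) (by decide +kernel)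
    (by rintro _ ⟨⟩; rfl) rfl rfl checkF4

theorem CoxeterSystem.hasRegularDecomposition_H4 {M : CoxeterMatrix (Fin 4)}
    (cs : CoxeterSystem M W) (hM : ∀ i j : Fin 4, M i j = tableEntry coxeterTableH4 i j) :
    HasRegularDecomposition W :=
  cs.hasRegularDecomposition_of_tables hM (by decide +kernel) (ts := cosetTablesH4) rfl
    (by decide +kernel) (by decide +kernel) rfl (by decide +kernel) (by norm_num)
    (fun _ h => h.shift_thirty_ne_zero) (by decide +kernel)
    (by rintro _ ⟨⟩; rfl) rfl rfl checkH4

end Groups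

end

noncomputable section

section Dihedral

open DihedralGroup

variable {n : ℕ}

/-- There is at most one element of order two in a finite cyclic group. -/
theorem ZMod.exists_two_mul_eq_zero_iff (n : ℕ) [NeZero n] :
    ∃ z : ZMod n, ∀ a : ZMod n, 2 * a = 0 ↔ a = 0 ∨ a = z := by
  have key (a : ZMod n) : 2 * a = 0 ↔ n ∣ 2 * a.val := by
    rw [← ZMod.natCast_eq_zero_iff]
    simp
  obtain ⟨m, hm | hm⟩ := n.even_or_odd'
  · refine ⟨(m : ZMod n), fun a => ?_⟩
    have hm0 : 0 < m := by
      have := NeZero.ne n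
      omega
    have hval : (m : ZMod n).val = m := ZMod.val_natCast_of_lt (by omega)
    rw [key, ← ZMod.val_eq_zero, ← (ZMod.val_injective n).eq_iff, hval]
    have ha := a.val_lt
    constructor
    · rintro ⟨k, hk⟩
      have : k < 2 := by
        by_contra! h
        have : n * 2 ≤ n * k := Nat.mul_le_mul_left n h
        omega
      interval_cases k <;> omega
    · rintro (h | h) <;> rw [h]
      · simp
      · rw [← hm]
  · refine ⟨0, fun a => ?_⟩
    rw [key, or_self, ← ZMod.val_eq_zero]
    have hc : Nat.Coprime n 2 := by
      rw [Nat.coprime_two_right]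
      exact ⟨m, hm⟩
    rw [hc.dvd_mul_left]
    have ha := a.val_lt
    constructor
    · intro h
      exact Nat.eq_zero_of_dvd_of_lt h ha
    · intro h
      simp [h]

/-- The values of the linear characters for the dihedral groups; here `z` is the element of order
two if there is one. -/
def dihedralCharacter (e : AddChar (ZMod n) ℂ) (z : ZMod n) :
    DihedralGroup n → DihedralGroup n → ℂ
  | r a, r b => e (a * b)
  | sr i, r b => if b = 0 then 1 else e (i * z)
  | r a, sr j => if a = 0 then 1 else e (j * z)
  | sr i, sr j => if i = j then -e (j * z) else -1

theorem DihedralGroup.commute_r_sr_iff {a j : ZMod n} : Commute (r a) (sr j) ↔ 2 * a = 0 := by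
  rw [commute_iff_eq, r_mul_sr, sr_mul_r, sr.injEq]
  constructor <;> intro h <;> linear_combination -h

theorem DihedralGroup.commute_sr_r_iff {a j : ZMod n} : Commute (sr j) (r a) ↔ 2 * a = 0 := by
  rw [Commute.symm_iff, commute_r_sr_iff]

theorem DihedralGroup.commute_sr_sr_iff {i j : ZMod n} :
    Commute (sr i) (sr j) ↔ 2 * (i - j) = 0 := by
  rw [commute_iff_eq, sr_mul_sr, sr_mul_sr, r.injEq]
  constructor <;> intro h <;> linear_combination -h

theorem DihedralGroup.hasRegularDecomposition (n : ℕ) [NeZero n] :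
    HasRegularDecomposition (DihedralGroup n) := by
  obtain ⟨z, hz⟩ := ZMod.exists_two_mul_eq_zero_iff n
  let e : AddChar (ZMod n) ℂ := ZMod.stdAddChar
  have hsum (a : ZMod n) (ha : a ≠ 0) : ∑ b, e (a * b) = 0 := by
    have := AddChar.sum_mulShift a (ZMod.isPrimitive_stdAddChar n)
    simpa [ha, mul_comm, e] using this
  have hzz : 2 * z = 0 := (hz z).2 (.inr rfl)
  have hadd (i j : ZMod n) : e ((i + j) * z) = e (i * z) * e (j * z) := by
    rw [add_mul, AddChar.map_add_eq_mul]
  have hsq (i : ZMod n) : e (i * z) * e (i * z) = 1 := by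
    rw [← hadd, ← two_mul, mul_right_comm, hzz, zero_mul, AddChar.map_zero_eq_one]
  have hsub (i j : ZMod n) : e ((i - j) * z) = e (i * z) * e (j * z) := by
    rw [← hadd]
    congr 1
    linear_combination -j * hzz
  have h2 (i : ZMod n) : e (2 * i * z) = 1 := by
    rw [two_mul, hadd, hsq]
  have hzi (i : ZMod n) : e (z * i) = e (i * z) := by rw [mul_comm]
  have hss' (i j : ZMod n) : Commute (sr i) (sr j) ↔ i = j ∨ i = j + z := by
    rw [commute_sr_sr_iff, hz, sub_eq_zero, sub_eq_iff_eq_add']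
  refine ⟨dihedralCharacter e z, ?_, ?_, ?_, ?_⟩
  · have hr (k a : ZMod n) : r k * r a * (r k)⁻¹ = r a := by simp
    have hrs (k i : ZMod n) : r k * sr i * (r k)⁻¹ = sr (i - 2 * k) := by
      simp only [inv_r, r_mul_sr, sr_mul_r]
      congr 1
      ring
    have hsr (k a : ZMod n) : sr k * r a * (sr k)⁻¹ = r (-a) := by simp
    have hss (k i : ZMod n) : sr k * sr i * (sr k)⁻¹ = sr (2 * k - i) := by
      simp only [inv_sr, sr_mul_sr, r_mul_sr]
      congr 1
      ring
    rintro (k | k) (a | i) (b | j) -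
    all_goals simp only [hr, hrs, hsr, hss]
    all_goals simp [dihedralCharacter, hsub, h2]
  · rintro (b | j) <;> simp [one_def, dihedralCharacter, -r_zero]
  · rintro (a | i) (a' | i') (b | j) h h'
    all_goals simp only [dihedralCharacter, r_mul_r, r_mul_sr, sr_mul_r, sr_mul_sr]
    · rw [add_mul, AddChar.map_add_eq_mul]
    all_goals
      try simp only [commute_r_sr_iff, commute_sr_r_iff, hss', hz] at h
      try simp only [commute_r_sr_iff, commute_sr_r_iff, hss', hz] at h'
    all_goals by_cases hz0 : z = 0
    all_goals try rcases h with h | h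
    all_goals try rcases h' with h' | h'
    all_goals simp [h, h', hz0, hzz, hsq, hadd, ← two_mul]
    · rw [hsub, mul_comm]
    · exact fun h => (h <| by rw [add_assoc, ← two_mul, hzz, add_zero]).elim
    all_goals rw [hsub, mul_comm]
  · have hsplit (F : DihedralGroup n → ℂ) : ∑ h, F h = ∑ b, F (r b) + ∑ j, F (sr j) := by
      rw [← equivSum.symm.sum_comp, Fintype.sum_sum_type]
      rfl
    rintro (a | i) hg <;> rw [hsplit]
    · replace hg : a ≠ 0 := fun h => hg (by rw [h, r_zero])
      have hrr (b : ZMod n) : Commute (r a) (r b) := by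
        rw [commute_iff_eq, r_mul_r, r_mul_r, add_comm]
      simp only [commute_r_sr_iff, dihedralCharacter, hz, hg, false_or, hrr, if_true, if_false,
        hsum a hg, zero_add]
      split_ifs with h
      · simp_rw [mul_comm _ z]
        exact hsum z (h ▸ hg)
      · exact Finset.sum_const_zero
    · have hadd' : ∑ j : ZMod n, (if Commute (sr i) (sr j) then dihedralCharacter e z (sr i) (sr j) else 0) =
          ∑ b : ZMod n, if 2 * b = 0 then (if b = 0 then -e (i * z) else -1) else 0 := by
        rw [← (Equiv.subLeft i).sum_comp fun j =>
          if Commute (sr i) (sr j) then dihedralCharacter e z (sr i) (sr j) else 0]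
        refine Finset.sum_congr rfl fun b _ => ?_
        rw [Equiv.subLeft_apply, commute_sr_sr_iff, sub_sub_cancel]
        by_cases hb : b = 0 <;> simp [dihedralCharacter, hb, eq_comm (a := i)]
      rw [hadd', ← Finset.sum_add_distrib]
      simp only [commute_sr_r_iff, dihedralCharacter]
      have hterm (b : ZMod n) : ((if 2 * b = 0 then if b = 0 then 1 else e (i * z) else 0) +
          if 2 * b = 0 then if b = 0 then -e (i * z) else -1 else 0) =
            (1 - e (i * z)) * ((if b = 0 then 1 else 0) - if b = z then 1 else 0) := by
        simp only [hz]
        by_cases h0 : b = 0 <;> by_cases h1 : b = z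
        · rw [← h1, h0]
          simp
        · simp [h0, h0 ▸ h1, sub_eq_add_neg]
        · simp [h1, h1 ▸ h0, sub_eq_add_neg]
        · simp [h0, h1]
      rw [Finset.sum_congr rfl fun b _ => hterm b, ← Finset.mul_sum, Finset.sum_sub_distrib]
      simp

/-- A group generated by two involutions with product of order dividing `n` that maps onto the
dihedral group of order `2 * n` is isomorphic to it. -/
theorem HasRegularDecomposition.of_involutions {W : Type*} [Group W] [Fintype W] {n : ℕ} [NeZero n]
    {a b : W} (ha : a * a = 1) (hb : b * b = 1) (hab : (a * b) ^ n = 1)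
    (hclosure : Subgroup.closure {a, b} = ⊤) (f : W →* DihedralGroup n) (hfa : f a = sr 0)
    (hfb : f b = sr 1) : HasRegularDecomposition W := by
  have hfab : f (a * b) = r 1 := by simp [hfa, hfb]
  let F : DihedralGroup n → W
    | r i => (a * b) ^ i.val
    | sr i => a * (a * b) ^ i.val
  have hfF : Function.LeftInverse f F := by
    rintro (i | i)
    · simp only [F, map_pow, hfab, r_one_pow, ZMod.natCast_val, ZMod.cast_id]
    · change f (a * (a * b) ^ i.val) = sr i
      rw [map_mul, map_pow, hfab, hfa, r_one_pow, ZMod.natCast_val, ZMod.cast_id, sr_mul_r, zero_add]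
  have hval (i : ZMod n) : (a * b) ^ (i + 1).val = a * b * (a * b) ^ i.val := by
    rw [← pow_succ', ZMod.val_add, ← pow_eq_pow_mod _ hab, pow_add, pow_succ,
      ZMod.val_one_eq_one_mod, ← pow_eq_pow_mod _ hab, pow_one]
  have hmul (g : DihedralGroup n) (y : W) (hy : y ∈ ({a, b} : Set W)) : y * F g ∈ Set.range F := by
    rcases hy with rfl | rfl <;> obtain (i | i) := g
    · exact ⟨sr i, rfl⟩
    · exact ⟨r i, by simp only [F, ← mul_assoc, ha, one_mul]⟩
    · exact ⟨sr (i + 1), by simp only [F, hval, ← mul_assoc, ha, one_mul]⟩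
    · refine ⟨r (i - 1), ?_⟩
      obtain ⟨i, rfl⟩ : ∃ j, i = j + 1 := ⟨i - 1, by ring⟩
      simp only [F, hval, ← mul_assoc, add_sub_cancel_right]
      simp only [mul_assoc y, ha, hb, mul_one, one_mul]
  have hsurj : Function.Surjective F := by
    intro w
    have hw : w ∈ Subgroup.closure {a, b} := hclosure ▸ Subgroup.mem_top w
    induction hw using Subgroup.closure_induction_left with
    | one => exact ⟨r 0, show (a * b) ^ (0 : ZMod n).val = 1 by rw [ZMod.val_zero, pow_zero]⟩
    | mul_left y hy x hx ih =>
      obtain ⟨g, rfl⟩ := ih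
      exact hmul g y hy
    | inv_mul_cancel y hy x hx ih =>
      obtain ⟨g, rfl⟩ := ih
      have hyy : y * y = 1 := by rcases hy with rfl | rfl <;> assumption
      rw [inv_eq_of_mul_eq_one_right hyy]
      exact hmul g y hy
  have hinj : Function.Injective f := fun x y h => by
    obtain ⟨x, rfl⟩ := hsurj x
    obtain ⟨y, rfl⟩ := hsurj y
    rw [hfF, hfF] at h
    rw [h]
  exact .of_mulEquiv (MulEquiv.ofBijective f ⟨hinj, hfF.surjective⟩).symm
    (DihedralGroup.hasRegularDecomposition n)

end Dihedral

end

section GeometricRepresentation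

open Module Polynomial.Chebyshev Real

/-- Two reflections whose linear forms are adapted to the angle `π / m` satisfy the braid
relation of length `m`. -/
theorem Module.reflection_mul_reflection_pow_eq_one {V : Type*} [AddCommGroup V] [Module ℝ V]
    {x y : V} {f g : Dual ℝ V} (hf : f x = 2) (hg : g y = 2) {m : ℕ} (hm : 2 ≤ m)
    (hfy : f y = -2 * cos (π / m)) (hgx : g x = -2 * cos (π / m)) :
    (reflection hf * reflection hg) ^ m = 1 := by
  have hm0 : (m : ℝ) ≠ 0 := by positivity
  rcases hm.eq_or_lt with rfl | hm3
  · simp only [Nat.cast_ofNat, cos_pi_div_two, mul_zero] at hfy hgx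
    ext z
    simp only [pow_two, LinearEquiv.mul_apply, reflection_apply, map_sub, map_smul, hf, hg, hfy, hgx,
      LinearEquiv.coe_one, id_eq]
    module
  set θ : ℝ := 2 * π / m with hθ
  have ht : 2 * cos θ = f y * g x - 2 := by
    have : θ = 2 * (π / m) := by ring
    rw [this, cos_two_mul, hfy, hgx]
    ring
  have hsin : sin θ ≠ 0 := by
    refine (sin_pos_of_pos_of_lt_pi (by positivity) ?_).ne'
    have : (3 : ℝ) ≤ m := by exact_mod_cast hm3
    rw [hθ, div_lt_iff₀ (by positivity)]
    nlinarith [pi_pos]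
  have hS (k : ℤ) : (S ℝ k).eval (2 * cos θ) = sin ((k + 1) * θ) / sin θ := by
    rw [eq_div_iff hsin, S_two_mul_real_cos]
  have hmul : (m : ℝ) * θ = 2 * π := by
    rw [hθ]
    field_simp
  have key : (S ℝ ((m - 1) / 2)).eval (2 * cos θ) *
        ((S ℝ (m / 2)).eval (2 * cos θ) + (S ℝ ((m - 2) / 2)).eval (2 * cos θ)) = 0 ∧
      (S ℝ ((m - 2) / 2)).eval (2 * cos θ) *
        ((S ℝ ((m - 1) / 2)).eval (2 * cos θ) + (S ℝ ((m - 3) / 2)).eval (2 * cos θ)) = 0 := by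
    obtain ⟨k, hk | hk⟩ := m.even_or_odd'
    · have hz : (S ℝ (k - 1)).eval (2 * cos θ) = 0 := by
        have : (k : ℝ) * θ = π := by
          rw [hk] at hmul
          push_cast at hmul
          linarith
        rw [hS]
        simp [this]
      have h1 : ((m : ℤ) - 1) / 2 = k - 1 := by omega
      have h2 : ((m : ℤ) - 2) / 2 = k - 1 := by omega
      rw [h1, h2, hz]
      simp
    · have hz : (S ℝ k).eval (2 * cos θ) + (S ℝ (k - 1)).eval (2 * cos θ) = 0 := by
        have : ((k : ℝ) + 1) * θ = 2 * π - k * θ := by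
          rw [hk] at hmul
          push_cast at hmul
          linarith
        rw [hS, hS]
        simp [this, sin_two_pi_sub, neg_div]
      have h1 : ((m : ℤ) - 1) / 2 = k := by omega
      have h2 : ((m : ℤ) - 2) / 2 = k - 1 := by omega
      have h3 : (m : ℤ) / 2 = k := by omega
      have h4 : ((m : ℤ) - 3) / 2 = k - 1 := by omega
      rw [h1, h2, h3, h4, hz]
      simp
  ext z
  rw [reflection_mul_reflection_pow_apply hf hg m z _ ht, key.1, key.2]
  simp

variable {B W : Type*} [Fintype B] [Group W] {M : CoxeterMatrix B}

/-- Twice the linear form `x ↦ -∑ j, cos (π / M i j) * x j`. -/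
noncomputable def CoxeterMatrix.rootForm (M : CoxeterMatrix B) (i : B) : Dual ℝ (B → ℝ) :=
  ∑ j, (-2 * cos (π / M i j)) • LinearMap.proj j

theorem CoxeterMatrix.rootForm_apply (M : CoxeterMatrix B) (i : B) (x : B → ℝ) :
    M.rootForm i x = ∑ j, -2 * cos (π / M i j) * x j := by
  simp [CoxeterMatrix.rootForm]

theorem CoxeterMatrix.rootForm_single (M : CoxeterMatrix B) (i j : B) :
    M.rootForm i (Pi.single j 1) = -2 * cos (π / M i j) := by
  simp [CoxeterMatrix.rootForm_apply, Pi.single_apply]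

theorem CoxeterMatrix.rootForm_single_self (M : CoxeterMatrix B) (i : B) :
    M.rootForm i (Pi.single i 1) = 2 := by
  simp [CoxeterMatrix.rootForm_single]

theorem CoxeterMatrix.isLiftable_reflection (M : CoxeterMatrix B) :
    M.IsLiftable fun i => reflection (M.rootForm_single_self i) := by
  intro i j
  rcases eq_or_ne i j with rfl | hij
  · rw [M.diagonal, pow_one]
    exact LinearEquiv.ext fun _ => involutive_reflection _ _
  have hm1 := M.off_diagonal i j hij
  rcases Nat.lt_or_ge (M i j) 2 with h | h
  · have : M i j = 0 := by omega
    simp [this]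
  · refine Module.reflection_mul_reflection_pow_eq_one _ _ h (M.rootForm_single i j) ?_
    rw [M.rootForm_single, M.symmetric]

/-- The geometric representation of a Coxeter group. -/
noncomputable def CoxeterSystem.geometricRep (cs : CoxeterSystem M W) :
    W →* ((B → ℝ) ≃ₗ[ℝ] (B → ℝ)) :=
  cs.lift ⟨_, M.isLiftable_reflection⟩

theorem CoxeterSystem.geometricRep_simple (cs : CoxeterSystem M W) (i : B) (x : B → ℝ) :
    cs.geometricRep (cs.simple i) x = x - M.rootForm i x • Pi.single i 1 := by
  rw [CoxeterSystem.geometricRep, cs.lift_apply_simple, reflection_apply]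

/-- The canonical bilinear form of a finite Coxeter group is positive definite. -/
theorem CoxeterSystem.canonicalForm_pos [Finite W] (cs : CoxeterSystem M W) {x : B → ℝ}
    (hx : x ≠ 0) : 0 < ∑ i, ∑ j, x i * x j * -cos (π / M i j) := by
  have := Fintype.ofFinite W
  let ρ := cs.geometricRep
  let G (x y : B → ℝ) : ℝ := ∑ w : W, ρ w x ⬝ᵥ ρ w y
  have hGinv (v : W) (x y : B → ℝ) : G (ρ v x) (ρ v y) = G x y := by
    refine Fintype.sum_equiv (Equiv.mulRight v) _ _ fun w => ?_
    simp
  have hGcomm (x y : B → ℝ) : G x y = G y x := by simp only [G, dotProduct_comm]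
  have hGpos (x : B → ℝ) (hx : x ≠ 0) : 0 < G x x := by
    refine Finset.sum_pos (fun w _ => ?_) Finset.univ_nonempty
    have : ρ w x ≠ 0 := by simpa using hx
    have hne : ρ w x ⬝ᵥ ρ w x ≠ 0 := by simpa [dotProduct_self_eq_zero] using this
    refine lt_of_le_of_ne (Finset.sum_nonneg fun i _ => mul_self_nonneg _) hne.symm
  let Γ : LinearMap.BilinForm ℝ (B → ℝ) := LinearMap.mk₂ ℝ G
    (by intros; simp [G, Finset.sum_add_distrib])
    (by intros; simp [G, Finset.mul_sum])
    (by intros; simp [G, Finset.sum_add_distrib])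
    (by intros; simp [G, Finset.mul_sum])
  let e (i : B) : B → ℝ := Pi.single i 1
  have hroot (i : B) (x : B → ℝ) : 2 * Γ (e i) x = M.rootForm i x * Γ (e i) (e i) := by
    have h1 : Γ (ρ (cs.simple i) (e i)) (ρ (cs.simple i) x) = Γ (e i) x := hGinv _ _ _
    have h2 : ρ (cs.simple i) (e i) = -e i := by
      simp only [ρ, e, cs.geometricRep_simple, M.rootForm_single_self, two_smul]
      abel
    rw [h2] at h1
    simp only [ρ, cs.geometricRep_simple, map_sub, map_smul, map_neg, LinearMap.neg_apply,
      smul_eq_mul] at h1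
    change -Γ (e i) x - M.rootForm i x * -Γ (e i) (e i) = _ at h1
    linarith
  have hg (i : B) : 0 < Γ (e i) (e i) := hGpos _ (by simp [e])
  set q : B → ℝ := fun i => √(Γ (e i) (e i)) with hq
  have hqpos (i : B) : 0 < q i := Real.sqrt_pos.2 (hg i)
  have hqsq (i : B) : q i * q i = Γ (e i) (e i) := Real.mul_self_sqrt (hg i).le
  have hent (i j : B) : Γ (e i) (e j) = -cos (π / M i j) * (q i * q j) := by
    have h1 := hroot i (e j)
    have h2 := hroot j (e i)
    rw [show Γ (e j) (e i) = Γ (e i) (e j) from hGcomm _ _] at h2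
    rw [M.rootForm_single, ← hqsq] at h1
    rw [M.rootForm_single, ← hqsq, M.symmetric] at h2
    have h3 : cos (π / M i j) * ((q i - q j) * (q i + q j)) = 0 := by linarith
    have hsum : q i + q j ≠ 0 := (add_pos (hqpos i) (hqpos j)).ne'
    rcases mul_eq_zero.1 h3 with h | h
    · rw [h] at h1 ⊢
      linarith
    · have : q i = q j := by
        have := (mul_eq_zero.1 h).resolve_right hsum
        linarith
      rw [← this]
      linarith
  have hy : (∑ i, (x i / q i) • e i) ≠ 0 := by
    intro h
    apply hx
    ext i
    have := congrFun h i
    simp only [e, Finset.sum_apply, Pi.smul_apply, Pi.single_apply, smul_eq_mul, mul_ite, mul_one,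
      mul_zero, Finset.sum_ite_eq, Finset.mem_univ, if_true, Pi.zero_apply] at this
    exact (div_eq_zero_iff.1 this).resolve_right (hqpos i).ne'
  have hpos : 0 < Γ (∑ i, (x i / q i) • e i) (∑ i, (x i / q i) • e i) := hGpos _ hy
  convert hpos using 1
  simp only [map_sum, map_smul, LinearMap.sum_apply, LinearMap.smul_apply, smul_eq_mul, hent,
    Finset.mul_sum]
  refine Finset.sum_congr rfl fun i _ => Finset.sum_congr rfl fun j _ => ?_
  have := (hqpos i).ne'
  have := (hqpos j).ne'
  rw [M.symmetric]
  field_simp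

end GeometricRepresentation

section Products

variable {B W : Type*} [Group W] {M : CoxeterMatrix B}

/-- The restriction of a Coxeter matrix to a set of generators. -/
def CoxeterMatrix.restrict (M : CoxeterMatrix B) (p : B → Prop) :
    CoxeterMatrix {i // p i} where
  M := fun i j => M i j
  isSymm := Matrix.IsSymm.ext fun i j => M.symmetric j i
  diagonal i := M.diagonal i
  off_diagonal i j h := M.off_diagonal i j (Subtype.coe_injective.ne h)

theorem CoxeterMatrix.restrict_apply (M : CoxeterMatrix B) (p : B → Prop) (i j : {i // p i}) :
    M.restrict p i j = M i j :=
  rfl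

/-- The canonical map from a standard parabolic subgroup. -/
def CoxeterSystem.ofRestrict (cs : CoxeterSystem M W) (p : B → Prop) :
    (M.restrict p).Group →* W :=
  (M.restrict p).toCoxeterSystem.lift
    ⟨fun i => cs.simple i, fun i j => cs.simple_mul_simple_pow i j⟩

theorem CoxeterSystem.ofRestrict_simple (cs : CoxeterSystem M W) (p : B → Prop) (i : {i // p i}) :
    cs.ofRestrict p ((M.restrict p).toCoxeterSystem.simple i) = cs.simple i :=
  (M.restrict p).toCoxeterSystem.lift_apply_simple _ i

theorem CoxeterSystem.commute_ofRestrict (cs : CoxeterSystem M W) {p q : B → Prop}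
    (h : ∀ i j, p i → q j → M i j = 2) (x : (M.restrict p).Group) (y : (M.restrict q).Group) :
    Commute (cs.ofRestrict p x) (cs.ofRestrict q y) := by
  induction x using (M.restrict p).toCoxeterSystem.simple_induction with
  | one => simp
  | mul a b ha hb => simpa using ha.mul_left hb
  | simple i =>
    induction y using (M.restrict q).toCoxeterSystem.simple_induction with
    | one => simp
    | mul a b ha hb => simpa using ha.mul_right hb
    | simple j =>
      rw [cs.ofRestrict_simple, cs.ofRestrict_simple]
      have key := cs.simple_mul_simple_pow i j
      rw [h i j i.2 j.2, pow_two, mul_eq_one_iff_eq_inv, mul_inv_rev, cs.inv_simple,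
        cs.inv_simple] at key
      exact key

/-- The image of a generator in the product of two complementary parabolic subgroups. -/
noncomputable def CoxeterMatrix.simpleProd (M : CoxeterMatrix B) (p : B → Prop) (i : B) :
    (M.restrict p).Group × (M.restrict fun i => ¬ p i).Group :=
  if h : p i then ((M.restrict p).simple ⟨i, h⟩, 1)
  else (1, (M.restrict fun i => ¬ p i).simple ⟨i, h⟩)

theorem CoxeterMatrix.isLiftable_simpleProd (M : CoxeterMatrix B) {p : B → Prop}
    (hp : ∀ i j, p i → ¬ p j → M i j = 2) : M.IsLiftable (M.simpleProd p) := by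
  have h1 := (M.restrict p).toCoxeterSystem.simple_mul_simple_pow
  have h2 := (M.restrict fun i => ¬ p i).toCoxeterSystem.simple_mul_simple_pow
  have h1' := (M.restrict p).toCoxeterSystem.simple_sq
  have h2' := (M.restrict fun i => ¬ p i).toCoxeterSystem.simple_sq
  simp only [CoxeterMatrix.toCoxeterSystem_simple] at h1 h2 h1' h2'
  intro i j
  by_cases hi : p i <;> by_cases hj : p j
  · have := h1 ⟨i, hi⟩ ⟨j, hj⟩
    simpa [CoxeterMatrix.simpleProd, hi, hj, CoxeterMatrix.restrict_apply] using this
  · simp [CoxeterMatrix.simpleProd, hi, hj, hp i j hi hj, h1', h2']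
  · simp [CoxeterMatrix.simpleProd, hi, hj, M.symmetric i j, hp j i hj hi, h1', h2']
  · have := h2 ⟨i, hi⟩ ⟨j, hj⟩
    simpa [CoxeterMatrix.simpleProd, hi, hj, CoxeterMatrix.restrict_apply] using this

/-- A Coxeter group whose generators split into two commuting sets is a product. -/
theorem CoxeterSystem.exists_mulEquiv_prod (cs : CoxeterSystem M W) {p : B → Prop}
    (hp : ∀ i j, p i → ¬ p j → M i j = 2) :
    Nonempty ((M.restrict p).Group × (M.restrict fun i => ¬ p i).Group ≃* W) := by
  let g := (cs.ofRestrict p).noncommCoprod (cs.ofRestrict fun i => ¬ p i)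
    fun x y => cs.commute_ofRestrict hp x y
  let f := cs.lift ⟨_, M.isLiftable_simpleProd hp⟩
  have hf (i : B) : f (cs.simple i) = M.simpleProd p i := cs.lift_apply_simple _ i
  have h1 (x : (M.restrict p).Group) : f (cs.ofRestrict p x) = (x, 1) := by
    have : f.comp (cs.ofRestrict p) = MonoidHom.inl _ _ := by
      refine (M.restrict p).toCoxeterSystem.ext_simple fun i => ?_
      simp [cs.ofRestrict_simple, hf, CoxeterMatrix.simpleProd, i.2,
        -CoxeterMatrix.toCoxeterSystem_simple]
      rfl
    exact DFunLike.congr_fun this x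
  have h2 (x : (M.restrict fun i => ¬ p i).Group) :
      f (cs.ofRestrict (fun i => ¬ p i) x) = (1, x) := by
    have : f.comp (cs.ofRestrict fun i => ¬ p i) = MonoidHom.inr _ _ := by
      refine (M.restrict fun i => ¬ p i).toCoxeterSystem.ext_simple fun i => ?_
      simp [cs.ofRestrict_simple, hf, CoxeterMatrix.simpleProd, i.2,
        -CoxeterMatrix.toCoxeterSystem_simple]
      rfl
    exact DFunLike.congr_fun this x
  have hgf : g.comp f = MonoidHom.id W := by
    refine cs.ext_simple fun i => ?_
    by_cases hi : p i
    · simpa [hf, CoxeterMatrix.simpleProd, hi, g] using cs.ofRestrict_simple p ⟨i, hi⟩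
    · simpa [hf, CoxeterMatrix.simpleProd, hi, g] using
        cs.ofRestrict_simple (fun i => ¬ p i) ⟨i, hi⟩
  have hfg : f.comp g = MonoidHom.id _ := by
    ext1 x
    change f (cs.ofRestrict p x.1 * cs.ofRestrict (fun i => ¬ p i) x.2) = x
    simp [h1, h2]
  exact ⟨MonoidHom.toMulEquiv g f hfg hgf⟩

variable [Fintype W]

theorem CoxeterSystem.hasRegularDecomposition_of_commuting (cs : CoxeterSystem M W) {p : B → Prop}
    (hp : ∀ i j, p i → ¬ p j → M i j = 2)
    (h₁ : ∀ [Fintype (M.restrict p).Group], HasRegularDecomposition (M.restrict p).Group)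
    (h₂ : ∀ [Fintype (M.restrict fun i => ¬ p i).Group],
      HasRegularDecomposition (M.restrict fun i => ¬ p i).Group) :
    HasRegularDecomposition W := by
  obtain ⟨e⟩ := cs.exists_mulEquiv_prod hp
  have := Fintype.ofSurjective (fun w => (e.symm w).1) (Prod.fst_surjective.comp e.symm.surjective)
  have := Fintype.ofSurjective (fun w => (e.symm w).2) (Prod.snd_surjective.comp e.symm.surjective)
  exact (HasRegularDecomposition.prod h₁ h₂).of_mulEquiv e

end Products

section SmallRank

open DihedralGroup

variable {W : Type*} [Group W] [Fintype W]

theorem HasRegularDecomposition.of_subsingleton [Subsingleton W] : HasRegularDecomposition W :=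
  ⟨fun _ _ => 1, by simp, by simp, by simp, fun g hg => (hg (Subsingleton.elim _ _)).elim⟩

theorem CoxeterSystem.hasRegularDecomposition_rank_zero {M : CoxeterMatrix (Fin 0)}
    (cs : CoxeterSystem M W) : HasRegularDecomposition W := by
  have : Subsingleton W := by
    rw [← Subgroup.subsingleton_iff]
    refine subsingleton_of_bot_eq_top ?_
    rw [← cs.subgroup_closure_range_simple]
    simp
  exact .of_subsingleton

theorem CoxeterSystem.hasRegularDecomposition_rank_one {M : CoxeterMatrix (Fin 1)}
    (cs : CoxeterSystem M W) : HasRegularDecomposition W := by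
  refine HasRegularDecomposition.of_involutions (n := 1) (cs.simple_mul_simple_self 0)
    (cs.simple_mul_simple_self 0) (by simp) ?_
    (cs.lift ⟨fun _ => sr 0, fun i j => by simp [← r_zero]⟩) (cs.lift_apply_simple _ 0)
    ((cs.lift_apply_simple _ 0).trans (congrArg sr (Subsingleton.elim _ _)))
  rw [← cs.subgroup_closure_range_simple]
  congr 1
  ext w
  simp [Fin.exists_fin_one, eq_comm]

theorem CoxeterSystem.hasRegularDecomposition_rank_two {M : CoxeterMatrix (Fin 2)}
    (cs : CoxeterSystem M W) (hM : M 0 1 ≠ 0) : HasRegularDecomposition W := by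
  have : NeZero (M 0 1) := ⟨hM⟩
  refine HasRegularDecomposition.of_involutions (n := M 0 1) (cs.simple_mul_simple_self 0)
    (cs.simple_mul_simple_self 1) (cs.simple_mul_simple_pow 0 1) ?_
    (cs.lift ⟨![sr 0, sr 1], fun i j => ?_⟩) (cs.lift_apply_simple _ 0)
    (cs.lift_apply_simple _ 1)
  · rw [← cs.subgroup_closure_range_simple]
    congr 1
    ext w
    simp [Fin.exists_fin_two, eq_comm]
  · fin_cases i <;> fin_cases j <;> simp [M.symmetric 1 0, ← r_zero]

end SmallRank

section Classification

open Real

theorem CoxeterMatrix.cos_pi_div_le {k m : ℕ} (hk : k ≠ 0) (h : k ≤ m) :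
    cos (π / k) ≤ cos (π / m) := by
  have hk' : (0 : ℝ) < k := by positivity
  have hkm : (k : ℝ) ≤ m := by exact_mod_cast h
  have h1 : (1 : ℝ) ≤ k := by exact_mod_cast Nat.one_le_iff_ne_zero.2 hk
  refine cos_le_cos_of_nonneg_of_le_pi (by positivity) (div_le_self pi_pos.le h1) ?_
  gcongr

theorem half_le_cos_pi_div {m : ℕ} (h : 3 ≤ m) : 1 / 2 ≤ cos (π / m) := by
  simpa [cos_pi_div_three] using CoxeterMatrix.cos_pi_div_le three_ne_zero h

theorem half_le_sq_cos_pi_div {m : ℕ} (h : 4 ≤ m) : 1 / 2 ≤ cos (π / m) ^ 2 := by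
  have h1 := CoxeterMatrix.cos_pi_div_le four_ne_zero h
  rw [Nat.cast_ofNat, cos_pi_div_four] at h1
  have h2 : (√2 / 2) ^ 2 = 1 / 2 := by rw [div_pow, sq_sqrt (by norm_num)]; norm_num
  rw [← h2]
  gcongr

theorem five_eighths_lt_sq_cos_pi_div {m : ℕ} (h : 5 ≤ m) : 5 / 8 < cos (π / m) ^ 2 := by
  have h1 := CoxeterMatrix.cos_pi_div_le (by norm_num : 5 ≠ 0) h
  rw [Nat.cast_ofNat, cos_pi_div_five] at h1
  have h2 : 2 < √5 := by rw [lt_sqrt] <;> norm_num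
  have h3 : √5 ^ 2 = 5 := sq_sqrt (by norm_num)
  refine lt_of_lt_of_le ?_ (pow_le_pow_left₀ (by positivity) h1 2)
  rw [div_pow]
  linarith

theorem three_quarters_le_sq_cos_pi_div {m : ℕ} (h : 6 ≤ m) : 3 / 4 ≤ cos (π / m) ^ 2 := by
  have h1 := CoxeterMatrix.cos_pi_div_le (by norm_num : 6 ≠ 0) h
  rw [Nat.cast_ofNat, cos_pi_div_six] at h1
  have h2 : (√3 / 2) ^ 2 = 3 / 4 := by rw [div_pow, sq_sqrt (by norm_num)]; norm_num
  rw [← h2]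
  gcongr

namespace CoxeterSystem

variable {B W : Type*} [Fintype B] [Group W] [Finite W] {M : CoxeterMatrix B}

theorem canonicalForm_comp_pos (cs : CoxeterSystem M W) {ι : Type*} [Fintype ι] {f : ι → B}
    (hf : f.Injective) {y : ι → ℝ} (hy : y ≠ 0) :
    0 < ∑ a, ∑ b, y a * y b * -cos (π / M (f a) (f b)) := by
  have hne : Function.extend f y 0 ≠ 0 := by
    intro h
    apply hy
    ext a
    rw [← hf.extend_apply y 0, h]
    simp
  convert cs.canonicalForm_pos hne using 1
  have key (F : B → ℝ) (hF : ∀ i, (∀ a, f a ≠ i) → F i = 0) : ∑ i, F i = ∑ a, F (f a) := by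
    refine Eq.trans ?_ (Finset.sum_map Finset.univ ⟨f, hf⟩ F)
    refine (Finset.sum_subset (Finset.subset_univ _) fun i _ hi => hF i fun a ha => hi ?_).symm
    simp [← ha]
  have h0 (i : B) (hi : ∀ a, f a ≠ i) : Function.extend f y 0 i = 0 := by
    rw [Function.extend_apply' _ _ _ (by simpa using hi)]
    rfl
  rw [key _ fun i hi => by simp [h0 i hi]]
  refine Finset.sum_congr rfl fun a _ => ?_
  rw [key _ fun i hi => by simp [h0 i hi]]
  simp only [hf.extend_apply]

theorem cos_pi_div_lt_one (cs : CoxeterSystem M W) {i j : B} (hij : i ≠ j) :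
    cos (π / M i j) < 1 := by
  have h := cs.canonicalForm_comp_pos (f := ![i, j]) (y := 1)
    (by simp [Function.Injective, Fin.forall_fin_two, hij, hij.symm]) one_ne_zero
  simp [Fin.sum_univ_two, M.symmetric j i] at h
  linarith

theorem two_le_of_ne (cs : CoxeterSystem M W) {i j : B} (hij : i ≠ j) : 2 ≤ M i j := by
  have h1 := M.off_diagonal i j hij
  have h0 : M i j ≠ 0 := by
    intro h
    simpa [h] using cs.cos_pi_div_lt_one hij
  omega

theorem cos_pi_div_nonneg (cs : CoxeterSystem M W) {i j : B} (hij : i ≠ j) :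
    0 ≤ cos (π / M i j) := by
  simpa using CoxeterMatrix.cos_pi_div_le two_ne_zero (cs.two_le_of_ne hij)

section Three

theorem form_three_pos (cs : CoxeterSystem M W) {i j k : B} (hij : i ≠ j) (hik : i ≠ k)
    (hjk : j ≠ k) {x y z : ℝ} (h : y ≠ 0) :
    0 < x ^ 2 + y ^ 2 + z ^ 2 - 2 * (x * y * cos (π / M i j)) - 2 * (x * z * cos (π / M i k)) -
      2 * (y * z * cos (π / M j k)) := by
  have := cs.canonicalForm_comp_pos (f := ![i, j, k]) (y := ![x, y, z])
    (by simp [Function.Injective, Fin.forall_fin_succ, hij, hij.symm, hik, hik.symm, hjk, hjk.symm])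
    (fun h' => h (congrFun h' 1))
  simp [Fin.sum_univ_three, M.symmetric j i, M.symmetric k i, M.symmetric k j] at this
  linarith

/-- A finite Coxeter diagram contains no triangle. -/
theorem not_triangle (cs : CoxeterSystem M W) {i j k : B} (hij : i ≠ j) (hik : i ≠ k)
    (hjk : j ≠ k) (h₁ : 3 ≤ M i j) (h₂ : 3 ≤ M i k) (h₃ : 3 ≤ M j k) : False := by
  have := cs.form_three_pos hij hik hjk (x := 1) (y := 1) (z := 1) one_ne_zero
  have := half_le_cos_pi_div h₁
  have := half_le_cos_pi_div h₂
  have := half_le_cos_pi_div h₃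
  linarith

theorem sq_add_sq_lt_one (cs : CoxeterSystem M W) {i j k : B} (hij : i ≠ j) (hik : i ≠ k)
    (hjk : j ≠ k) : cos (π / M i j) ^ 2 + cos (π / M j k) ^ 2 < 1 := by
  have := cs.form_three_pos hij hik hjk (x := cos (π / M i j)) (y := 1) (z := cos (π / M j k))
    one_ne_zero
  have := mul_nonneg (mul_nonneg (cs.cos_pi_div_nonneg hij) (cs.cos_pi_div_nonneg hjk))
    (cs.cos_pi_div_nonneg hik)
  linarith

/-- The labels of a path of length two in a finite Coxeter diagram. -/
theorem labels_of_path_three (cs : CoxeterSystem M W) {i j k : B} (hij : i ≠ j) (hik : i ≠ k)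
    (hjk : j ≠ k) (h₁ : 3 ≤ M i j) (h₂ : 3 ≤ M j k) :
    M i j = 3 ∧ M j k ≤ 5 ∨ M j k = 3 ∧ M i j ≤ 5 := by
  have h := cs.sq_add_sq_lt_one hij hik hjk
  have h1 := half_le_cos_pi_div h₁
  have h2 := half_le_cos_pi_div h₂
  by_contra! hc
  rcases Nat.lt_or_ge (M i j) 4 with h3 | h3
  · have := three_quarters_le_sq_cos_pi_div (hc.1 (by omega))
    nlinarith
  · rcases Nat.lt_or_ge (M j k) 4 with h4 | h4
    · have := three_quarters_le_sq_cos_pi_div (hc.2 (by omega))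
      nlinarith
    · have := half_le_sq_cos_pi_div h3
      have := half_le_sq_cos_pi_div h4
      linarith

end Three

section Four

theorem form_four_pos (cs : CoxeterSystem M W) {f : Fin 4 → B} (hf : f.Injective)
    {x y z t : ℝ} (h : y ≠ 0) :
    0 < x ^ 2 + y ^ 2 + z ^ 2 + t ^ 2 - 2 * (x * y * cos (π / M (f 0) (f 1))) -
      2 * (x * z * cos (π / M (f 0) (f 2))) - 2 * (x * t * cos (π / M (f 0) (f 3))) -
      2 * (y * z * cos (π / M (f 1) (f 2))) - 2 * (y * t * cos (π / M (f 1) (f 3))) -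
      2 * (z * t * cos (π / M (f 2) (f 3))) := by
  have := cs.canonicalForm_comp_pos hf (y := ![x, y, z, t]) (fun h' => h (congrFun h' 1))
  simp [Fin.sum_univ_four, M.symmetric (f 1) (f 0), M.symmetric (f 2) (f 0),
    M.symmetric (f 3) (f 0), M.symmetric (f 2) (f 1), M.symmetric (f 3) (f 1),
    M.symmetric (f 3) (f 2)] at this
  linarith

/-- A finite Coxeter diagram contains no cycle of length four. -/
theorem not_square (cs : CoxeterSystem M W) {f : Fin 4 → B} (hf : f.Injective)
    (h₁ : 3 ≤ M (f 0) (f 1)) (h₂ : 3 ≤ M (f 1) (f 2)) (h₃ : 3 ≤ M (f 2) (f 3))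
    (h₄ : 3 ≤ M (f 0) (f 3)) : False := by
  have := cs.form_four_pos hf (x := 1) (y := 1) (z := 1) (t := 1) one_ne_zero
  have := half_le_cos_pi_div h₁
  have := half_le_cos_pi_div h₂
  have := half_le_cos_pi_div h₃
  have := half_le_cos_pi_div h₄
  have := cs.cos_pi_div_nonneg (hf.ne (show (0 : Fin 4) ≠ 2 by decide))
  have := cs.cos_pi_div_nonneg (hf.ne (show (1 : Fin 4) ≠ 3 by decide))
  linarith

/-- The labels of a star with three leaves in a finite Coxeter diagram. -/
theorem labels_of_star (cs : CoxeterSystem M W) {f : Fin 4 → B} (hf : f.Injective)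
    (h₀ : 3 ≤ M (f 0) (f 2)) (h₁ : 3 ≤ M (f 1) (f 2)) (h₃ : 3 ≤ M (f 2) (f 3)) :
    M (f 0) (f 2) = 3 ∧ M (f 1) (f 2) = 3 ∧ M (f 2) (f 3) = 3 := by
  have h0 := half_le_cos_pi_div h₀
  have h1 := half_le_cos_pi_div h₁
  have h3 := half_le_cos_pi_div h₃
  have key := cs.form_four_pos hf (x := cos (π / M (f 0) (f 2)))
    (y := cos (π / M (f 1) (f 2))) (z := 1) (t := cos (π / M (f 2) (f 3))) (by linarith)
  have p1 := cs.cos_pi_div_nonneg (hf.ne (show (0 : Fin 4) ≠ 1 by decide))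
  have p2 := cs.cos_pi_div_nonneg (hf.ne (show (0 : Fin 4) ≠ 3 by decide))
  have p3 := cs.cos_pi_div_nonneg (hf.ne (show (1 : Fin 4) ≠ 3 by decide))
  have h : cos (π / M (f 0) (f 2)) ^ 2 + cos (π / M (f 1) (f 2)) ^ 2 +
      cos (π / M (f 2) (f 3)) ^ 2 < 1 := by
    have := mul_nonneg (mul_nonneg (by linarith : 0 ≤ cos (π / M (f 0) (f 2)))
      (by linarith : 0 ≤ cos (π / M (f 1) (f 2)))) p1
    have := mul_nonneg (mul_nonneg (by linarith : 0 ≤ cos (π / M (f 0) (f 2)))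
      (by linarith : 0 ≤ cos (π / M (f 2) (f 3)))) p2
    have := mul_nonneg (mul_nonneg (by linarith : 0 ≤ cos (π / M (f 1) (f 2)))
      (by linarith : 0 ≤ cos (π / M (f 2) (f 3)))) p3
    linarith
  have q0 := pow_le_pow_left₀ (by norm_num) h0 2
  have q1 := pow_le_pow_left₀ (by norm_num) h1 2
  have q3 := pow_le_pow_left₀ (by norm_num) h3 2
  refine ⟨le_antisymm ?_ h₀, le_antisymm ?_ h₁, le_antisymm ?_ h₃⟩ <;>
  · by_contra! hc
    have := half_le_sq_cos_pi_div hc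
    linarith

/-- The labels of a path of length three in a finite Coxeter diagram. -/
theorem labels_of_path_four (cs : CoxeterSystem M W) {f : Fin 4 → B} (hf : f.Injective)
    (h₀ : 3 ≤ M (f 0) (f 1)) (h₁ : 3 ≤ M (f 1) (f 2)) (h₂ : 3 ≤ M (f 2) (f 3)) :
    M (f 1) (f 2) = 3 ∧ (M (f 0) (f 1) = 3 ∧ M (f 2) (f 3) ≤ 5 ∨
        M (f 2) (f 3) = 3 ∧ M (f 0) (f 1) ≤ 5) ∨
      M (f 1) (f 2) = 4 ∧ M (f 0) (f 1) = 3 ∧ M (f 2) (f 3) = 3 := by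
  have h01 := hf.ne (show (0 : Fin 4) ≠ 1 by decide)
  have h02 := hf.ne (show (0 : Fin 4) ≠ 2 by decide)
  have h03 := hf.ne (show (0 : Fin 4) ≠ 3 by decide)
  have h12 := hf.ne (show (1 : Fin 4) ≠ 2 by decide)
  have h13 := hf.ne (show (1 : Fin 4) ≠ 3 by decide)
  have h23 := hf.ne (show (2 : Fin 4) ≠ 3 by decide)
  have l1 := cs.labels_of_path_three h01 h02 h12 h₀ h₁
  have l2 := cs.labels_of_path_three h12 h13 h23 h₁ h₂
  have a0 := half_le_cos_pi_div h₀
  have a1 := half_le_cos_pi_div h₁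
  have a2 := half_le_cos_pi_div h₂
  have hsq : cos (π / M (f 0) (f 1)) ^ 2 < 1 := by
    have := cs.sq_add_sq_lt_one h01 h02 h12
    nlinarith
  have hdet : cos (π / M (f 1) (f 2)) ^ 2 <
      (1 - cos (π / M (f 0) (f 1)) ^ 2) * (1 - cos (π / M (f 2) (f 3)) ^ 2) := by
    set a := cos (π / M (f 0) (f 1))
    set b := cos (π / M (f 1) (f 2))
    set c := cos (π / M (f 2) (f 3))
    have key := cs.form_four_pos hf (x := a * b) (y := b) (z := 1 - a ^ 2)
      (t := c * (1 - a ^ 2)) (by linarith)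
    have hz : 0 < 1 - a ^ 2 := by linarith
    have p1 := mul_nonneg (mul_nonneg (mul_nonneg (by linarith : 0 ≤ a) (by linarith : 0 ≤ b)) hz.le)
      (cs.cos_pi_div_nonneg h02)
    have p2 := mul_nonneg (mul_nonneg (mul_nonneg (by linarith : 0 ≤ a) (by linarith : 0 ≤ b))
      (mul_nonneg (by linarith : 0 ≤ c) hz.le)) (cs.cos_pi_div_nonneg h03)
    have p3 := mul_nonneg (mul_nonneg (by linarith : 0 ≤ b)
      (mul_nonneg (by linarith : 0 ≤ c) hz.le)) (cs.cos_pi_div_nonneg h13)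
    have : 0 < (1 - a ^ 2) * ((1 - a ^ 2) * (1 - c ^ 2) - b ^ 2) := by linarith
    linarith [pos_of_mul_pos_right this hz.le]
  have q0 := pow_le_pow_left₀ (by norm_num) a0 2
  have q1 := pow_le_pow_left₀ (by norm_num) a1 2
  have q2 := pow_le_pow_left₀ (by norm_num) a2 2
  have hne : ¬ (4 ≤ M (f 0) (f 1) ∧ 4 ≤ M (f 2) (f 3)) := by
    rintro ⟨h, h'⟩
    have := half_le_sq_cos_pi_div h
    have := half_le_sq_cos_pi_div h'
    nlinarith
  have hb : ¬ 5 ≤ M (f 1) (f 2) := by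
    intro h
    have := five_eighths_lt_sq_cos_pi_div h
    nlinarith
  omega

end Four

end CoxeterSystem

end Classification

section Diagrams

/-- The graph on three vertices with prescribed edges. -/
def graphThree (a b c : Bool) : Fin 3 → Fin 3 → Bool :=
  ![![false, a, b], ![a, false, c], ![b, c, false]]

/-- The graph on four vertices with prescribed edges. -/
def graphFour (a b c d e f : Bool) : Fin 4 → Fin 4 → Bool :=
  ![![false, a, b, c], ![a, false, d, e], ![b, d, false, f], ![c, e, f, false]]

theorem graphThree_shape (a b c : Bool) :
    (∃ p : Fin 3 → Bool, (∃ i, p i = true) ∧ (∃ i, p i = false) ∧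
      ∀ i j, p i = true → p j = false → graphThree a b c i j = false) ∨
    (∀ i j, i ≠ j → graphThree a b c i j = true) ∨
    ∃ σ : Equiv.Perm (Fin 3), graphThree a b c (σ 0) (σ 1) = true ∧
      graphThree a b c (σ 1) (σ 2) = true ∧ graphThree a b c (σ 0) (σ 2) = false := by
  revert a b c
  decide +kernel

theorem graphFour_shape (a b c d e f : Bool) :
    (∃ p : Fin 4 → Bool, (∃ i, p i = true) ∧ (∃ i, p i = false) ∧
      ∀ i j, p i = true → p j = false → graphFour a b c d e f i j = false) ∨
    (∃ σ : Equiv.Perm (Fin 4), graphFour a b c d e f (σ 0) (σ 1) = true ∧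
      graphFour a b c d e f (σ 0) (σ 2) = true ∧ graphFour a b c d e f (σ 1) (σ 2) = true) ∨
    (∃ σ : Equiv.Perm (Fin 4), graphFour a b c d e f (σ 0) (σ 1) = true ∧
      graphFour a b c d e f (σ 1) (σ 2) = true ∧ graphFour a b c d e f (σ 2) (σ 3) = true ∧
      graphFour a b c d e f (σ 0) (σ 3) = true) ∨
    (∃ σ : Equiv.Perm (Fin 4), graphFour a b c d e f (σ 0) (σ 1) = true ∧
      graphFour a b c d e f (σ 1) (σ 2) = true ∧ graphFour a b c d e f (σ 2) (σ 3) = true ∧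
      graphFour a b c d e f (σ 0) (σ 2) = false ∧ graphFour a b c d e f (σ 0) (σ 3) = false ∧
      graphFour a b c d e f (σ 1) (σ 3) = false) ∨
    ∃ σ : Equiv.Perm (Fin 4), graphFour a b c d e f (σ 0) (σ 2) = true ∧
      graphFour a b c d e f (σ 1) (σ 2) = true ∧ graphFour a b c d e f (σ 2) (σ 3) = true ∧
      graphFour a b c d e f (σ 0) (σ 1) = false ∧ graphFour a b c d e f (σ 0) (σ 3) = false ∧
      graphFour a b c d e f (σ 1) (σ 3) = false := by
  revert a b c d e f
  decide +kernel

theorem eq_graphThree {E : Fin 3 → Fin 3 → Bool} (hE : ∀ i j, E i j = E j i)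
    (hE' : ∀ i, E i i = false) : E = graphThree (E 0 1) (E 0 2) (E 1 2) := by
  funext i j
  fin_cases i <;> fin_cases j <;> simp [graphThree, hE', hE 1 0, hE 2 0, hE 2 1]

theorem eq_graphFour {E : Fin 4 → Fin 4 → Bool} (hE : ∀ i j, E i j = E j i)
    (hE' : ∀ i, E i i = false) :
    E = graphFour (E 0 1) (E 0 2) (E 0 3) (E 1 2) (E 1 3) (E 2 3) := by
  funext i j
  fin_cases i <;> fin_cases j <;>
    simp [graphFour, hE', hE 1 0, hE 2 0, hE 2 1, hE 3 0, hE 3 1, hE 3 2]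

/-- The edges of the Coxeter diagram. -/
def CoxeterMatrix.edge {B : Type*} (M : CoxeterMatrix B) (i j : B) : Bool :=
  decide (3 ≤ M i j)

theorem CoxeterMatrix.edge_comm {B : Type*} (M : CoxeterMatrix B) (i j : B) :
    M.edge i j = M.edge j i := by
  rw [CoxeterMatrix.edge, CoxeterMatrix.edge, M.symmetric]

theorem CoxeterMatrix.edge_self {B : Type*} (M : CoxeterMatrix B) (i : B) :
    M.edge i i = false := by
  simp [CoxeterMatrix.edge]

/-- A Coxeter matrix of rank three as a table; the last row is only there to match the tables of
rank four. -/
theorem CoxeterMatrix.eq_tableEntry_three (M : CoxeterMatrix (Fin 3)) (i j : Fin 3) :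
    M i j = tableEntry [[1, M 0 1, M 0 2, 2], [M 0 1, 1, M 1 2, 2], [M 0 2, M 1 2, 1, 3],
      [2, 2, 3, 1]] i j := by
  fin_cases i <;> fin_cases j <;>
    first
    | exact rfl
    | exact M.diagonal _
    | exact M.symmetric _ _

theorem CoxeterMatrix.eq_tableEntry_four (M : CoxeterMatrix (Fin 4)) (i j : Fin 4) :
    M i j = tableEntry [[1, M 0 1, M 0 2, M 0 3], [M 0 1, 1, M 1 2, M 1 3],
      [M 0 2, M 1 2, 1, M 2 3], [M 0 3, M 1 3, M 2 3, 1]] i j := by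
  fin_cases i <;> fin_cases j <;>
    first
    | exact rfl
    | exact M.diagonal _
    | exact M.symmetric _ _

namespace CoxeterSystem

variable {B W : Type*} [Group W]

theorem edge_eq_false_iff [Fintype B] [Finite W] {M : CoxeterMatrix B} (cs : CoxeterSystem M W)
    {i j : B} (hij : i ≠ j) : M.edge i j = false ↔ M i j = 2 := by
  have := cs.two_le_of_ne hij
  rw [CoxeterMatrix.edge, decide_eq_false_iff_not]
  omega

variable [Fintype W]

theorem hasRegularDecomposition_path_three {M : CoxeterMatrix (Fin 3)} (cs : CoxeterSystem M W)
    (h01 : 3 ≤ M 0 1) (h01' : M 0 1 ≤ 5) (h12 : M 1 2 = 3) (h02 : M 0 2 = 2) :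
    HasRegularDecomposition W := by
  have hM := M.eq_tableEntry_three
  rw [h12, h02] at hM
  have h : M 0 1 = 3 ∨ M 0 1 = 4 ∨ M 0 1 = 5 := by omega
  rcases h with h | h | h <;> rw [h] at hM
  · exact cs.hasRegularDecomposition_A3 hM
  · exact cs.hasRegularDecomposition_B3 hM
  · exact cs.hasRegularDecomposition_H3 hM

theorem hasRegularDecomposition_path_four {M : CoxeterMatrix (Fin 4)} (cs : CoxeterSystem M W)
    (h : M 1 2 = 3 ∧ 3 ≤ M 0 1 ∧ M 0 1 ≤ 5 ∨ M 1 2 = 4 ∧ M 0 1 = 3) (h23 : M 2 3 = 3)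
    (h02 : M 0 2 = 2) (h03 : M 0 3 = 2) (h13 : M 1 3 = 2) :
    HasRegularDecomposition W := by
  have hM := M.eq_tableEntry_four
  rw [h23, h02, h03, h13] at hM
  have h : M 1 2 = 3 ∧ (M 0 1 = 3 ∨ M 0 1 = 4 ∨ M 0 1 = 5) ∨ M 1 2 = 4 ∧ M 0 1 = 3 := by omega
  rcases h with ⟨h, h' | h' | h'⟩ | ⟨h, h'⟩ <;> rw [h, h'] at hM
  · exact cs.hasRegularDecomposition_A4 hM
  · exact cs.hasRegularDecomposition_B4 hM
  · exact cs.hasRegularDecomposition_H4 hM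
  · exact cs.hasRegularDecomposition_F4 hM

theorem hasRegularDecomposition_star {M : CoxeterMatrix (Fin 4)} (cs : CoxeterSystem M W)
    (h02 : M 0 2 = 3) (h12 : M 1 2 = 3) (h23 : M 2 3 = 3) (h01 : M 0 1 = 2) (h03 : M 0 3 = 2)
    (h13 : M 1 3 = 2) : HasRegularDecomposition W := by
  have hM := M.eq_tableEntry_four
  rw [h02, h12, h23, h01, h03, h13] at hM
  exact cs.hasRegularDecomposition_D4 hM

theorem hasRegularDecomposition_rank_three {M : CoxeterMatrix (Fin 3)} (cs : CoxeterSystem M W)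
    (hsplit : ∀ p : Fin 3 → Prop, (∃ i, p i) → (∃ i, ¬ p i) →
      (∀ i j, p i → ¬ p j → M i j = 2) → HasRegularDecomposition W) :
    HasRegularDecomposition W := by
  have hshape := graphThree_shape (M.edge 0 1) (M.edge 0 2) (M.edge 1 2)
  rw [← eq_graphThree M.edge_comm M.edge_self] at hshape
  obtain ⟨p, hp, hp', h⟩ | h | ⟨σ, h01, h12, h02⟩ := hshape
  · refine hsplit (fun i => p i = true) hp (by simpa using hp') fun i j hi hj => ?_
    refine (cs.edge_eq_false_iff ?_).1 (h i j hi (by simpa using hj))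
    rintro rfl
    exact hj hi
  · simp only [CoxeterMatrix.edge, decide_eq_true_eq] at h
    exact (cs.not_triangle (i := 0) (j := 1) (k := 2) (by decide) (by decide) (by decide)
      (h _ _ (by decide)) (h _ _ (by decide)) (h _ _ (by decide))).elim
  · have n01 : σ 0 ≠ σ 1 := σ.injective.ne (by decide)
    have n02 : σ 0 ≠ σ 2 := σ.injective.ne (by decide)
    have n12 : σ 1 ≠ σ 2 := σ.injective.ne (by decide)
    rw [cs.edge_eq_false_iff n02] at h02
    simp only [CoxeterMatrix.edge, decide_eq_true_eq] at h01 h12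
    obtain ⟨h, h'⟩ | ⟨h, h'⟩ := cs.labels_of_path_three n01 n02 n12 h01 h12
    · refine (cs.reindex (Fin.revPerm.trans σ).symm).hasRegularDecomposition_path_three
        ?_ ?_ ?_ ?_
      · exact h12.trans_eq (M.symmetric _ _)
      · exact (M.symmetric _ _).trans_le h'
      · exact (M.symmetric _ _).trans h
      · exact (M.symmetric _ _).trans h02
    · exact (cs.reindex σ.symm).hasRegularDecomposition_path_three h01 h' h h02

theorem hasRegularDecomposition_rank_four {M : CoxeterMatrix (Fin 4)} (cs : CoxeterSystem M W)
    (hsplit : ∀ p : Fin 4 → Prop, (∃ i, p i) → (∃ i, ¬ p i) →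
      (∀ i j, p i → ¬ p j → M i j = 2) → HasRegularDecomposition W) :
    HasRegularDecomposition W := by
  have hshape := graphFour_shape (M.edge 0 1) (M.edge 0 2) (M.edge 0 3) (M.edge 1 2) (M.edge 1 3)
    (M.edge 2 3)
  rw [← eq_graphFour M.edge_comm M.edge_self] at hshape
  have hne (σ : Equiv.Perm (Fin 4)) {i j : Fin 4} (h : i ≠ j) : σ i ≠ σ j := σ.injective.ne h
  have hle {i j : Fin 4} (h : M.edge i j = true) : 3 ≤ M i j := of_decide_eq_true h
  obtain ⟨p, hp, hp', h⟩ | ⟨σ, h01, h02, h12⟩ | ⟨σ, h01, h12, h23, h03⟩ |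
    ⟨σ, h01, h12, h23, h02, h03, h13⟩ | ⟨σ, h02, h12, h23, h01, h03, h13⟩ := hshape
  · refine hsplit (fun i => p i = true) hp (by simpa using hp') fun i j hi hj => ?_
    refine (cs.edge_eq_false_iff ?_).1 (h i j hi (by simpa using hj))
    rintro rfl
    exact hj hi
  · exact (cs.not_triangle (hne σ (by decide)) (hne σ (by decide)) (hne σ (by decide))
      (hle h01) (hle h02) (hle h12)).elim
  · exact (cs.not_square σ.injective (hle h01) (hle h12) (hle h23) (hle h03)).elim
  · rw [cs.edge_eq_false_iff (hne σ (by decide))] at h02 h03 h13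
    have h01 := hle h01
    have h23 := hle h23
    have labels := cs.labels_of_path_four σ.injective h01 (hle h12) h23
    by_cases h : M (σ 2) (σ 3) = 3
    · exact (cs.reindex σ.symm).hasRegularDecomposition_path_four
        (show M (σ 1) (σ 2) = 3 ∧ 3 ≤ M (σ 0) (σ 1) ∧ M (σ 0) (σ 1) ≤ 5 ∨
          M (σ 1) (σ 2) = 4 ∧ M (σ 0) (σ 1) = 3 by omega) h h02 h03 h13
    · refine (cs.reindex (Fin.revPerm.trans σ).symm).hasRegularDecomposition_path_four
        (show M (σ 2) (σ 1) = 3 ∧ 3 ≤ M (σ 3) (σ 2) ∧ M (σ 3) (σ 2) ≤ 5 ∨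
          M (σ 2) (σ 1) = 4 ∧ M (σ 3) (σ 2) = 3 from ?_) ?_ ?_ ?_ ?_
      · rw [M.symmetric (σ 2), M.symmetric (σ 3)]
        omega
      · exact (M.symmetric _ _).trans (show M (σ 0) (σ 1) = 3 by omega)
      · exact (M.symmetric _ _).trans h13
      · exact (M.symmetric _ _).trans h03
      · exact (M.symmetric _ _).trans h02
  · rw [cs.edge_eq_false_iff (hne σ (by decide))] at h01 h03 h13
    obtain ⟨h02, h12, h23⟩ := cs.labels_of_star σ.injective (hle h02) (hle h12) (hle h23)
    exact (cs.reindex σ.symm).hasRegularDecomposition_star h02 h12 h23 h01 h03 h13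

/-- The groups are taken in `Type` so that the induction can pass to parabolic subgroups. -/
theorem hasRegularDecomposition_fin {n : ℕ} (hn : n ≤ 4) {W : Type} [Group W] [Fintype W]
    {M : CoxeterMatrix (Fin n)} (cs : CoxeterSystem M W) : HasRegularDecomposition W := by
  induction n using Nat.strong_induction_on generalizing W with
  | _ n ih =>
    have hrestrict (p : Fin n → Prop) (hp : ∃ i, ¬ p i) [Fintype (M.restrict p).Group] :
        HasRegularDecomposition (M.restrict p).Group := by
      have hlt : Fintype.card {i // p i} < n := by
        obtain ⟨i, hi⟩ := hp
        simpa using Fintype.card_subtype_lt hi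
      exact ih _ hlt (by omega)
        ((M.restrict p).toCoxeterSystem.reindex (Fintype.equivFin {i // p i}))
    have hsplit (p : Fin n → Prop) (hp : ∃ i, p i) (hp' : ∃ i, ¬ p i)
        (h : ∀ i j, p i → ¬ p j → M i j = 2) : HasRegularDecomposition W :=
      cs.hasRegularDecomposition_of_commuting h (hrestrict p hp') (hrestrict _ (by simpa using hp))
    clear ih hrestrict
    interval_cases n
    · exact cs.hasRegularDecomposition_rank_zero
    · exact cs.hasRegularDecomposition_rank_one
    · have := cs.two_le_of_ne (show (0 : Fin 2) ≠ 1 by decide)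
      exact cs.hasRegularDecomposition_rank_two (by omega)
    · exact cs.hasRegularDecomposition_rank_three hsplit
    · exact cs.hasRegularDecomposition_rank_four hsplit

theorem hasRegularDecomposition [Fintype B] {M : CoxeterMatrix B} (cs : CoxeterSystem M W)
    (hB : Fintype.card B ≤ 4) : HasRegularDecomposition W := by
  let cs' := cs.reindex (Fintype.equivFin B)
  have := Fintype.ofEquiv W cs'.mulEquiv.toEquiv
  exact (hasRegularDecomposition_fin hB
    (CoxeterMatrix.toCoxeterSystem _)).of_mulEquiv cs'.mulEquiv.symm

end CoxeterSystem

end Diagrams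

/-- Let `(W,S)` be a finite Coxeter group of rank at most `4` and let `R` be a
set of representatives of the conjugacy classes of `W`.  Then for each `w ∈ R` there exists a
linear character `φ_w` of the centralizer `C_W(w)` such that the regular character of `W` equals
`Σ_{w ∈ R} Ind_{C_W(w)}^W φ_w`. -/
theorem regular_character_decomposition_rank_le_four
    {B W : Type*} [Fintype B] [Group W] [Fintype W]
    {M : CoxeterMatrix B} (cs : CoxeterSystem M W)
    (hrank : Fintype.card B ≤ 4)
    (R : Finset W)
    (hR : ∀ w : W, ∃! r, r ∈ R ∧ IsConj r w) :
    ∃ φ : (w : W) → (Subgroup.centralizer {w} →* ℂˣ),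
      ∀ g : W, regularChar W g =
        ∑ w ∈ R, indFun (Subgroup.centralizer {w}) (fun y => (φ w y : ℂ)) g := by
  exact (cs.hasRegularDecomposition hrank).exists_centralizer_characters R hR
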